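/- arXiv:1205.7010 — 4 statements merged into one kernel-verified Lean document; each statement's English description precedes it below -/
import Mathlib

section
/- Let k be a field of characteristic ≠ 2 and let H_4' be a second copy of Sweedler's Hopf algebra H_4. Then (H_4', H_4, ▷, ◁) is a matched pair of Hopf algebras if and only if both actions are trivial (h▷a = ε(h)a, h◁a = ε(a)h) or there exists λ ∈ k such that: 1▷ is the identity on H_4'; g▷1 = 1, g▷G = G, g▷X = -X, g▷(GX) = -GX; x▷1 = 0, x▷G = 0, x▷X = λ - λG, x▷(GX) = λ - λG; (gx)▷1 = 0, (gx)▷G = 0, (gx)▷X = λ - λG, (gx)▷(GX) = λ - λG; and ·◁1 is the identity on H_4; 1◁G = 1, g◁G = g, x◁G = -x, (gx)◁G = -gx; 1◁X = g◁X = 0, x◁X = λ - λg, (gx)◁X = -λ + λg; 1◁(GX) = g◁(GX) = 0, x◁(GX) = -λ + λg, (gx)◁(GX) = λ - λg. -/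
open TensorProduct

noncomputable section

set_option linter.all false
set_option linter.unusedSimpArgs false
set_option linter.unusedVariables false
set_option maxHeartbeats 4000000

/-- A matched pair of Hopf algebras `(A, H, ▷, ◁)` (Majid, Kassel, Takeuchi):
`▷ : H ⊗ A → A` makes `A` into a left `H`-module coalgebra, `◁ : H ⊗ A → H` makes `H`
into a right `A`-module coalgebra, and the compatibility conditions (mp1)–(mp4) hold.
The Sweedler-notation conditions (mp2)–(mp4) are expressed as equalities of linear maps. -/
structure IsMatchedPair (k : Type*) [CommRing k] (A H : Type*) [Ring A] [Ring H]
    [HopfAlgebra k A] [HopfAlgebra k H]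
    (rhd : H ⊗[k] A →ₗ[k] A) (lhd : H ⊗[k] A →ₗ[k] H) : Prop where
  /-- `(A, ▷)` is a left `H`-module. -/
  one_rhd : ∀ a : A, rhd ((1 : H) ⊗ₜ[k] a) = a
  mul_rhd : ∀ (g h : H) (a : A),
    rhd ((g * h) ⊗ₜ[k] a) = rhd (g ⊗ₜ[k] rhd (h ⊗ₜ[k] a))
  /-- `(H, ◁)` is a right `A`-module (written with `H` as the left tensor factor). -/
  lhd_one : ∀ h : H, lhd (h ⊗ₜ[k] (1 : A)) = h
  lhd_mul : ∀ (h : H) (a b : A),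
    lhd (h ⊗ₜ[k] (a * b)) = lhd (lhd (h ⊗ₜ[k] a) ⊗ₜ[k] b)
  /-- `▷` is a morphism of coalgebras. -/
  counit_rhd : Coalgebra.counit (R := k) ∘ₗ rhd =
    (TensorProduct.lid k k).toLinearMap ∘ₗ
      TensorProduct.map (Coalgebra.counit (R := k)) (Coalgebra.counit (R := k))
  comul_rhd : Coalgebra.comul (R := k) ∘ₗ rhd =
    TensorProduct.map rhd rhd ∘ₗ
      (TensorProduct.tensorTensorTensorComm k H H A A).toLinearMap ∘ₗ
        TensorProduct.map (Coalgebra.comul (R := k)) (Coalgebra.comul (R := k))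
  /-- `◁` is a morphism of coalgebras. -/
  counit_lhd : Coalgebra.counit (R := k) ∘ₗ lhd =
    (TensorProduct.lid k k).toLinearMap ∘ₗ
      TensorProduct.map (Coalgebra.counit (R := k)) (Coalgebra.counit (R := k))
  comul_lhd : Coalgebra.comul (R := k) ∘ₗ lhd =
    TensorProduct.map lhd lhd ∘ₗ
      (TensorProduct.tensorTensorTensorComm k H H A A).toLinearMap ∘ₗ
        TensorProduct.map (Coalgebra.comul (R := k)) (Coalgebra.comul (R := k))
  /-- (mp1): `h ▷ 1 = ε(h) 1`. -/
  rhd_unit : ∀ h : H, rhd (h ⊗ₜ[k] (1 : A)) = Coalgebra.counit (R := k) h • (1 : A)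
  /-- (mp1): `1 ◁ a = ε(a) 1`. -/
  unit_lhd : ∀ a : A, lhd ((1 : H) ⊗ₜ[k] a) = Coalgebra.counit (R := k) a • (1 : H)
  /-- (mp2): `g ▷ (ab) = (g₍₁₎ ▷ a₍₁₎)((g₍₂₎ ◁ a₍₂₎) ▷ b)`, as linear maps
  `H ⊗ (A ⊗ A) → A`. -/
  mp2 : rhd ∘ₗ LinearMap.lTensor H (LinearMap.mul' k A) =
    LinearMap.mul' k A ∘ₗ LinearMap.lTensor A rhd ∘ₗ
      (TensorProduct.assoc k A H A).toLinearMap ∘ₗ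
        LinearMap.rTensor A (TensorProduct.map rhd lhd) ∘ₗ
          LinearMap.rTensor A (TensorProduct.tensorTensorTensorComm k H H A A).toLinearMap ∘ₗ
            (TensorProduct.assoc k (H ⊗[k] H) (A ⊗[k] A) A).symm.toLinearMap ∘ₗ
              TensorProduct.map (Coalgebra.comul (R := k))
                (TensorProduct.map (Coalgebra.comul (R := k)) LinearMap.id)
  /-- (mp3): `(gh) ◁ a = (g ◁ (h₍₁₎ ▷ a₍₁₎))(h₍₂₎ ◁ a₍₂₎)`, as linear maps
  `(H ⊗ H) ⊗ A → H`. -/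
  mp3 : lhd ∘ₗ LinearMap.rTensor A (LinearMap.mul' k H) =
    LinearMap.mul' k H ∘ₗ LinearMap.rTensor H lhd ∘ₗ
      (TensorProduct.assoc k H A H).symm.toLinearMap ∘ₗ
        LinearMap.lTensor H (TensorProduct.map rhd lhd) ∘ₗ
          LinearMap.lTensor H (TensorProduct.tensorTensorTensorComm k H H A A).toLinearMap ∘ₗ
            LinearMap.lTensor H (TensorProduct.map (Coalgebra.comul (R := k))
              (Coalgebra.comul (R := k))) ∘ₗ
              (TensorProduct.assoc k H H A).toLinearMap
  /-- (mp4): `g₍₁₎ ◁ a₍₁₎ ⊗ g₍₂₎ ▷ a₍₂₎ = g₍₂₎ ◁ a₍₂₎ ⊗ g₍₁₎ ▷ a₍₁₎`, as linear maps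
  `H ⊗ A → H ⊗ A`. -/
  mp4 : TensorProduct.map lhd rhd ∘ₗ
      (TensorProduct.tensorTensorTensorComm k H H A A).toLinearMap ∘ₗ
        TensorProduct.map (Coalgebra.comul (R := k)) (Coalgebra.comul (R := k)) =
    TensorProduct.map lhd rhd ∘ₗ
      (TensorProduct.tensorTensorTensorComm k H H A A).toLinearMap ∘ₗ
        TensorProduct.map
          ((TensorProduct.comm k H H).toLinearMap ∘ₗ Coalgebra.comul (R := k))
          ((TensorProduct.comm k A A).toLinearMap ∘ₗ Coalgebra.comul (R := k))

/-- `H` is (a model of) Sweedler's 4-dimensional Hopf algebra `H₄` with generators `g`, `x`: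
`g² = 1`, `x² = 0`, `xg = -gx`, the family `{1, g, x, gx}` is a basis of `H`, `g` is
group-like, `x` is `(1, g)`-primitive, and `S(g) = g`, `S(x) = -gx`. -/
structure IsSweedler (k : Type*) [CommRing k] (H : Type*) [Ring H] [HopfAlgebra k H]
    (g x : H) : Prop where
  g_sq : g * g = 1
  x_sq : x * x = 0
  x_mul_g : x * g = -(g * x)
  li : LinearIndependent k ![(1 : H), g, x, g * x]
  span : Submodule.span k {(1 : H), g, x, g * x} = ⊤
  comul_g : Coalgebra.comul (R := k) g = g ⊗ₜ[k] g
  comul_x : Coalgebra.comul (R := k) x = x ⊗ₜ[k] (1 : H) + g ⊗ₜ[k] x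
  counit_g : Coalgebra.counit (R := k) g = 1
  counit_x : Coalgebra.counit (R := k) x = 0
  antipode_g : HopfAlgebra.antipode (R := k) g = g
  antipode_x : HopfAlgebra.antipode (R := k) x = -(g * x)


theorem sw_coords {k H : Type*} [Field k] [Ring H] [HopfAlgebra k H] {g x : H}
    (hH : IsSweedler k H g x) :
    ∃ φ : Fin 4 → H →ₗ[k] k,
      (∀ y, y = φ 0 y • (1 : H) + φ 1 y • g + φ 2 y • x + φ 3 y • (g * x)) ∧
      (∀ i, φ i 1 = if i = 0 then 1 else 0) ∧
      (∀ i, φ i g = if i = 1 then 1 else 0) ∧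
      (∀ i, φ i x = if i = 2 then 1 else 0) ∧
      (∀ i, φ i (g * x) = if i = 3 then 1 else 0) := by
  have hs : ⊤ ≤ Submodule.span k (Set.range ![(1 : H), g, x, g * x]) := by
    rw [← hH.span]
    apply Submodule.span_mono
    intro y hy
    simp only [Set.mem_insert_iff, Set.mem_singleton_iff] at hy
    rcases hy with rfl | rfl | rfl | rfl
    · exact ⟨0, rfl⟩
    · exact ⟨1, rfl⟩
    · exact ⟨2, rfl⟩
    · exact ⟨3, rfl⟩
  let B := Module.Basis.mk hH.li hs
  have hB : ∀ j, B j = ![(1 : H), g, x, g * x] j := fun j => by simp [B]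
  have key : ∀ i j, B.coord i (![(1 : H), g, x, g * x] j) = if i = j then 1 else 0 := by
    intro i j
    rw [← hB, Module.Basis.coord_apply, Module.Basis.repr_self, Finsupp.single_apply]
    simp only [eq_comm]
  refine ⟨B.coord, ?_, fun i => key i 0, fun i => key i 1, fun i => key i 2, fun i => key i 3⟩
  intro y
  conv_lhs => rw [← B.sum_repr y]
  rw [Fin.sum_univ_four]
  simp only [hB]
  rfl

/-- product functional -/
def sw_T {k A B : Type*} [Field k] [AddCommGroup A] [AddCommGroup B] [Module k A] [Module k B]
    (φ : A →ₗ[k] k) (ψ : B →ₗ[k] k) : A ⊗[k] B →ₗ[k] k :=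
  (TensorProduct.lid k k).toLinearMap ∘ₗ TensorProduct.map φ ψ

theorem sw_T_tmul {k A B : Type*} [Field k] [AddCommGroup A] [AddCommGroup B] [Module k A]
    [Module k B] (φ : A →ₗ[k] k) (ψ : B →ₗ[k] k) (a : A) (b : B) :
    sw_T φ ψ (a ⊗ₜ[k] b) = φ a * ψ b := by
  simp [sw_T]

theorem sw_comul_gx {k H : Type*} [Field k] [Ring H] [HopfAlgebra k H] {g x : H}
    (hH : IsSweedler k H g x) :
    Coalgebra.comul (R := k) (g * x) = (g * x) ⊗ₜ[k] g + (1 : H) ⊗ₜ[k] (g * x) := by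
  rw [Bialgebra.comul_mul, hH.comul_g, hH.comul_x, mul_add]
  simp [hH.g_sq]

theorem sw_counit_gx {k H : Type*} [Field k] [Ring H] [HopfAlgebra k H] {g x : H}
    (hH : IsSweedler k H g x) :
    Coalgebra.counit (R := k) (g * x) = 0 := by
  rw [Bialgebra.counit_mul, hH.counit_x, mul_zero]

theorem sw_comul_one {k H : Type*} [Field k] [Ring H] [HopfAlgebra k H] :
    Coalgebra.comul (R := k) (1 : H) = (1 : H) ⊗ₜ[k] (1 : H) := by
  rw [Bialgebra.comul_one]; rfl

/-- `(g,g)`-primitive elements vanish. -/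
theorem sw_prim_gg {k H : Type*} [Field k] [Ring H] [HopfAlgebra k H] {g x : H}
    (hH : IsSweedler k H g x) (y : H)
    (hy : Coalgebra.comul (R := k) y = y ⊗ₜ[k] g + g ⊗ₜ[k] y) : y = 0 := by
  obtain ⟨φ, hφ, h1, hg, hx, hgx⟩ := sw_coords hH
  have e := hφ y
  generalize φ 0 y = a at e
  generalize φ 1 y = b at e
  generalize φ 2 y = c at e
  generalize φ 3 y = d at e
  subst e
  simp only [map_add, map_smul, sw_comul_one, hH.comul_g, hH.comul_x, sw_comul_gx hH] at hy
  have T := fun i j => congrArg (sw_T (φ i) (φ j)) hy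
  simp only [map_add, map_smul, sw_T_tmul, h1, hg, hx, hgx, smul_eq_mul] at T
  have t0 := T 0 0
  have t1 := T 1 1
  have t2 := T 2 0
  have t3 := T 0 3
  simp at t0 t1 t2 t3
  simp [t0, t1, t2, t3]

/-- `(1,g)`-primitive elements. -/
theorem sw_prim {k H : Type*} [Field k] [Ring H] [HopfAlgebra k H] {g x : H}
    (hH : IsSweedler k H g x) (y : H)
    (hy : Coalgebra.comul (R := k) y = y ⊗ₜ[k] (1 : H) + g ⊗ₜ[k] y) :
    ∃ a b : k, y = a • x + b • ((1 : H) - g) := by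
  obtain ⟨φ, hφ, h1, hg, hx, hgx⟩ := sw_coords hH
  have e := hφ y
  generalize φ 0 y = a at e
  generalize φ 1 y = b at e
  generalize φ 2 y = c at e
  generalize φ 3 y = d at e
  subst e
  simp only [map_add, map_smul, sw_comul_one, hH.comul_g, hH.comul_x, sw_comul_gx hH] at hy
  have T := fun i j => congrArg (sw_T (φ i) (φ j)) hy
  simp only [map_add, map_smul, sw_T_tmul, h1, hg, hx, hgx, smul_eq_mul] at T
  have t0 := T 1 0
  have t3 := T 0 3
  simp at t0 t3
  refine ⟨c, a, ?_⟩
  have : b = -a := by linear_combination -t0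
  subst this
  subst t3
  module

/-- Group-likes. -/
theorem sw_grp {k H : Type*} [Field k] [Ring H] [HopfAlgebra k H] {g x : H}
    (hH : IsSweedler k H g x) (y : H)
    (hy : Coalgebra.comul (R := k) y = y ⊗ₜ[k] y) (hc : Coalgebra.counit (R := k) y = 1) :
    y = 1 ∨ y = g := by
  obtain ⟨φ, hφ, h1, hg, hx, hgx⟩ := sw_coords hH
  have e := hφ y
  generalize φ 0 y = a at e
  generalize φ 1 y = b at e
  generalize φ 2 y = c at e
  generalize φ 3 y = d at e
  subst e
  simp only [map_add, map_smul, sw_comul_one, hH.comul_g, hH.comul_x, sw_comul_gx hH] at hy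
  have T := fun i j => congrArg (sw_T (φ i) (φ j)) hy
  simp only [map_add, map_smul, sw_T_tmul, h1, hg, hx, hgx, smul_eq_mul] at T
  simp only [map_add, map_smul, Bialgebra.counit_one, hH.counit_g, hH.counit_x,
    sw_counit_gx hH, smul_eq_mul] at hc
  have t01 := T 0 1
  have t22 := T 2 2
  have t33 := T 3 3
  simp at t01 t22 t33 hc
  subst t22 t33
  rcases t01 with rfl | rfl
  · right
    simp at hc
    simp [hc]
  · left
    simp at hc
    simp [hc]

theorem sw_one_ne {k H : Type*} [Field k] [Ring H] [HopfAlgebra k H] {g x : H}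
    (hH : IsSweedler k H g x) : g ≠ 1 := by
  obtain ⟨φ, hφ, h1, hg, hx, hgx⟩ := sw_coords hH
  intro h
  have a := hg 0
  rw [h, h1] at a
  simp at a


theorem sw_ext {k H M : Type*} [Field k] [Ring H] [HopfAlgebra k H] [AddCommGroup M] [Module k M]
    {g x : H} (hH : IsSweedler k H g x) (f f' : H →ₗ[k] M)
    (h1 : f 1 = f' 1) (hg : f g = f' g) (hx : f x = f' x) (hgx : f (g * x) = f' (g * x)) :
    f = f' := by
  apply LinearMap.ext_on hH.span
  intro y hy
  simp only [Set.mem_insert_iff, Set.mem_singleton_iff] at hy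
  rcases hy with rfl | rfl | rfl | rfl <;> assumption

theorem sw_ext2 {k H A M : Type*} [Field k] [Ring H] [HopfAlgebra k H] [Ring A] [HopfAlgebra k A]
    [AddCommGroup M] [Module k M]
    {g x : H} (hH : IsSweedler k H g x) {G X : A} (hA : IsSweedler k A G X)
    (f f' : H ⊗[k] A →ₗ[k] M)
    (h : ∀ u ∈ [(1 : H), g, x, g * x], ∀ v ∈ [(1 : A), G, X, G * X],
      f (u ⊗ₜ[k] v) = f' (u ⊗ₜ[k] v)) : f = f' := by
  apply TensorProduct.ext
  apply sw_ext hH <;> apply sw_ext hA <;> exact h _ (by simp) _ (by simp)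

/-- The explicit table. -/
structure SwTable {k A H : Type*} [Field k] [Ring A] [HopfAlgebra k A] [Ring H] [HopfAlgebra k H]
    (G X : A) (g x : H) (rhd : H ⊗[k] A →ₗ[k] A) (lhd : H ⊗[k] A →ₗ[k] H) (α lam : k) : Prop where
  r1 : ∀ a : A, rhd ((1 : H) ⊗ₜ[k] a) = a
  rg1 : rhd (g ⊗ₜ[k] (1 : A)) = 1
  rgG : rhd (g ⊗ₜ[k] G) = G
  rgX : rhd (g ⊗ₜ[k] X) = α • X
  rgY : rhd (g ⊗ₜ[k] (G * X)) = α • (G * X)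
  rx1 : rhd (x ⊗ₜ[k] (1 : A)) = 0
  rxG : rhd (x ⊗ₜ[k] G) = 0
  rxX : rhd (x ⊗ₜ[k] X) = lam • (1 : A) - lam • G
  rxY : rhd (x ⊗ₜ[k] (G * X)) = lam • (1 : A) - lam • G
  ry1 : rhd ((g * x) ⊗ₜ[k] (1 : A)) = 0
  ryG : rhd ((g * x) ⊗ₜ[k] G) = 0
  ryX : rhd ((g * x) ⊗ₜ[k] X) = lam • (1 : A) - lam • G
  ryY : rhd ((g * x) ⊗ₜ[k] (G * X)) = lam • (1 : A) - lam • G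
  l1 : ∀ h : H, lhd (h ⊗ₜ[k] (1 : A)) = h
  l1G : lhd ((1 : H) ⊗ₜ[k] G) = 1
  lgG : lhd (g ⊗ₜ[k] G) = g
  lxG : lhd (x ⊗ₜ[k] G) = α • x
  lyG : lhd ((g * x) ⊗ₜ[k] G) = α • (g * x)
  l1X : lhd ((1 : H) ⊗ₜ[k] X) = 0
  lgX : lhd (g ⊗ₜ[k] X) = 0
  lxX : lhd (x ⊗ₜ[k] X) = lam • (1 : H) - lam • g
  lyX : lhd ((g * x) ⊗ₜ[k] X) = -(lam • (1 : H)) + lam • g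
  l1Y : lhd ((1 : H) ⊗ₜ[k] (G * X)) = 0
  lgY : lhd (g ⊗ₜ[k] (G * X)) = 0
  lxY : lhd (x ⊗ₜ[k] (G * X)) = -(lam • (1 : H)) + lam • g
  lyY : lhd ((g * x) ⊗ₜ[k] (G * X)) = lam • (1 : H) - lam • g

theorem sw_mul_table {k H : Type*} [Field k] [Ring H] [HopfAlgebra k H] {g x : H}
    (hH : IsSweedler k H g x) : g * (g * x) = x ∧ x * (g * x) = 0 ∧ (g * x) * g = - x ∧
      (g * x) * x = 0 ∧ (g * x) * (g * x) = 0 := by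
  have h1 : g * (g * x) = x := by rw [← mul_assoc, hH.g_sq, one_mul]
  have h2 : x * (g * x) = 0 := by rw [← mul_assoc, hH.x_mul_g, neg_mul, mul_assoc, hH.x_sq]; simp
  refine ⟨h1, h2, ?_, ?_, ?_⟩
  · rw [mul_assoc, hH.x_mul_g, mul_neg, h1]
  · rw [mul_assoc, hH.x_sq, mul_zero]
  · rw [mul_assoc, h2, mul_zero]

section
variable {k : Type*} [Field k] 
    {A : Type*} [Ring A] [HopfAlgebra k A] {G X : A} 
    {H : Type*} [Ring H] [HopfAlgebra k H] {g x : H} 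
    {rhd : H ⊗[k] A →ₗ[k] A} {lhd : H ⊗[k] A →ₗ[k] H} {α lam : k}

theorem sw_mul_rhd (hA : IsSweedler k A G X) (hH : IsSweedler k H g x)
    (hα : (α = 1 ∧ lam = 0) ∨ α = -1) (t : SwTable G X g x rhd lhd α lam)
    (u v : H) (a : A) : rhd ((u * v) ⊗ₜ[k] a) = rhd (u ⊗ₜ[k] rhd (v ⊗ₜ[k] a)) := by
  obtain ⟨r1, rg1, rgG, rgX, rgY, rx1, rxG, rxX, rxY, ry1, ryG, ryX, ryY, l1, l1G, lgG, lxG, lyG,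
    l1X, lgX, lxX, lyX, l1Y, lgY, lxY, lyY⟩ := t
  obtain ⟨m1, m2, m3, m4, m5⟩ := sw_mul_table hH
  have key : rhd ∘ₗ LinearMap.rTensor A (LinearMap.mul' k H) =
      rhd ∘ₗ LinearMap.lTensor H rhd ∘ₗ (TensorProduct.assoc k H H A).toLinearMap := by
    apply TensorProduct.ext
    apply sw_ext2 hH hH
    intro u hu v hv
    simp only [List.mem_cons, List.not_mem_nil, or_false] at hu hv
    rcases hα with ⟨rfl, rfl⟩ | rfl <;>
    rcases hu with rfl | rfl | rfl | rfl <;> rcases hv with rfl | rfl | rfl | rfl <;>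
    apply sw_ext hA <;>
    simp [r1, rg1, rgG, rgX, rgY, rx1, rxG, rxX, rxY, ry1, ryG, ryX, ryY, hH.g_sq, hH.x_sq,
      hH.x_mul_g, m1, m2, m3, m4, m5, tmul_sub, tmul_add, tmul_neg, neg_tmul]
  simpa using congrArg (fun f => f ((u ⊗ₜ[k] v) ⊗ₜ[k] a)) key

theorem sw_lhd_mul (hA : IsSweedler k A G X) (hH : IsSweedler k H g x)
    (hα : (α = 1 ∧ lam = 0) ∨ α = -1) (t : SwTable G X g x rhd lhd α lam)
    (u : H) (a b : A) : lhd (u ⊗ₜ[k] (a * b)) = lhd (lhd (u ⊗ₜ[k] a) ⊗ₜ[k] b) := by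
  obtain ⟨r1, rg1, rgG, rgX, rgY, rx1, rxG, rxX, rxY, ry1, ryG, ryX, ryY, l1, l1G, lgG, lxG, lyG,
    l1X, lgX, lxX, lyX, l1Y, lgY, lxY, lyY⟩ := t
  obtain ⟨m1, m2, m3, m4, m5⟩ := sw_mul_table hA
  have key : lhd ∘ₗ LinearMap.lTensor H (LinearMap.mul' k A) =
      lhd ∘ₗ LinearMap.rTensor A lhd ∘ₗ (TensorProduct.assoc k H A A).symm.toLinearMap := by
    apply TensorProduct.ext
    apply sw_ext hH <;> apply sw_ext2 hA hA <;>
    intro u hu v hv <;>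
    simp only [List.mem_cons, List.not_mem_nil, or_false] at hu hv <;>
    rcases hα with ⟨rfl, rfl⟩ | rfl <;>
    rcases hu with rfl | rfl | rfl | rfl <;> rcases hv with rfl | rfl | rfl | rfl <;>
    simp [l1, l1G, lgG, lxG, lyG, l1X, lgX, lxX, lyX, l1Y, lgY, lxY, lyY, hA.g_sq, hA.x_sq,
      hA.x_mul_g, m1, m2, m3, m4, m5, sub_tmul, add_tmul, tmul_neg, neg_tmul, ← smul_tmul']
    <;> abel
  simpa using congrArg (fun f => f (u ⊗ₜ[k] (a ⊗ₜ[k] b))) key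

theorem sw_counits (hA : IsSweedler k A G X) (hH : IsSweedler k H g x)
    (hα : (α = 1 ∧ lam = 0) ∨ α = -1) (t : SwTable G X g x rhd lhd α lam) :
    Coalgebra.counit (R := k) ∘ₗ rhd =
    (TensorProduct.lid k k).toLinearMap ∘ₗ
      TensorProduct.map (Coalgebra.counit (R := k)) (Coalgebra.counit (R := k)) ∧
    Coalgebra.counit (R := k) ∘ₗ lhd =
    (TensorProduct.lid k k).toLinearMap ∘ₗ
      TensorProduct.map (Coalgebra.counit (R := k)) (Coalgebra.counit (R := k)) ∧
    (∀ h : H, rhd (h ⊗ₜ[k] (1 : A)) = Coalgebra.counit (R := k) h • (1 : A)) ∧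
    (∀ a : A, lhd ((1 : H) ⊗ₜ[k] a) = Coalgebra.counit (R := k) a • (1 : H)) := by
  obtain ⟨r1, rg1, rgG, rgX, rgY, rx1, rxG, rxX, rxY, ry1, ryG, ryX, ryY, l1, l1G, lgG, lxG, lyG,
    l1X, lgX, lxX, lyX, l1Y, lgY, lxY, lyY⟩ := t
  have c1 := sw_counit_gx hA
  have c2 := sw_counit_gx hH
  refine ⟨?_, ?_, ?_, ?_⟩
  · apply sw_ext2 hH hA
    intro u hu v hv
    simp only [List.mem_cons, List.not_mem_nil, or_false] at hu hv
    rcases hu with rfl | rfl | rfl | rfl <;> rcases hv with rfl | rfl | rfl | rfl <;>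
    simp [r1, rg1, rgG, rgX, rgY, rx1, rxG, rxX, rxY, ry1, ryG, ryX, ryY, -Bialgebra.counit_mul,
      c1, c2, hA.counit_g, hA.counit_x, hH.counit_g, hH.counit_x]
  · apply sw_ext2 hH hA
    intro u hu v hv
    simp only [List.mem_cons, List.not_mem_nil, or_false] at hu hv
    rcases hu with rfl | rfl | rfl | rfl <;> rcases hv with rfl | rfl | rfl | rfl <;>
    simp [l1, l1G, lgG, lxG, lyG, l1X, lgX, lxX, lyX, l1Y, lgY, lxY, lyY, -Bialgebra.counit_mul,
      c1, c2, hA.counit_g, hA.counit_x, hH.counit_g, hH.counit_x]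
  · have key : rhd ∘ₗ (TensorProduct.mk k H A).flip 1 =
      (Coalgebra.counit (R := k) (A := H)).smulRight (1 : A) := by
      apply sw_ext hH <;>
      simp [r1, rg1, rx1, ry1, -Bialgebra.counit_mul, c1, c2, hH.counit_g, hH.counit_x]
    intro h
    simpa using congrArg (fun f => f h) key
  · have key : lhd ∘ₗ (TensorProduct.mk k H A) 1 =
      (Coalgebra.counit (R := k) (A := A)).smulRight (1 : H) := by
      apply sw_ext hA <;>
      simp [l1, l1G, l1X, l1Y, -Bialgebra.counit_mul, c1, c2, hA.counit_g, hA.counit_x]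
    intro h
    simpa using congrArg (fun f => f h) key

theorem sw_comuls (hA : IsSweedler k A G X) (hH : IsSweedler k H g x)
    (hα : (α = 1 ∧ lam = 0) ∨ α = -1) (t : SwTable G X g x rhd lhd α lam) :
    Coalgebra.comul (R := k) ∘ₗ rhd =
    TensorProduct.map rhd rhd ∘ₗ
      (TensorProduct.tensorTensorTensorComm k H H A A).toLinearMap ∘ₗ
        TensorProduct.map (Coalgebra.comul (R := k)) (Coalgebra.comul (R := k)) := by
  obtain ⟨r1, rg1, rgG, rgX, rgY, rx1, rxG, rxX, rxY, ry1, ryG, ryX, ryY, l1, l1G, lgG, lxG, lyG,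
    l1X, lgX, lxX, lyX, l1Y, lgY, lxY, lyY⟩ := t
  have c1 := sw_comul_gx hA
  have c2 := sw_comul_gx hH
  apply sw_ext2 hH hA
  intro u hu v hv
  simp only [List.mem_cons, List.not_mem_nil, or_false] at hu hv
  rcases hα with ⟨rfl, rfl⟩ | rfl <;>
  rcases hu with rfl | rfl | rfl | rfl <;> rcases hv with rfl | rfl | rfl | rfl <;>
  simp [r1, rg1, rgG, rgX, rgY, rx1, rxG, rxX, rxY, ry1, ryG, ryX, ryY, -Bialgebra.comul_mul,
    -Bialgebra.comul_one, sw_comul_one,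
    c1, c2, hA.comul_g, hA.comul_x, hH.comul_g, hH.comul_x, sub_tmul, tmul_sub, add_tmul, tmul_add,
    neg_tmul, tmul_neg, ← smul_tmul'] <;> abel

theorem sw_comuls_l (hA : IsSweedler k A G X) (hH : IsSweedler k H g x)
    (hα : (α = 1 ∧ lam = 0) ∨ α = -1) (t : SwTable G X g x rhd lhd α lam) :
    Coalgebra.comul (R := k) ∘ₗ lhd =
    TensorProduct.map lhd lhd ∘ₗ
      (TensorProduct.tensorTensorTensorComm k H H A A).toLinearMap ∘ₗ
        TensorProduct.map (Coalgebra.comul (R := k)) (Coalgebra.comul (R := k)) := by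
  obtain ⟨r1, rg1, rgG, rgX, rgY, rx1, rxG, rxX, rxY, ry1, ryG, ryX, ryY, l1, l1G, lgG, lxG, lyG,
    l1X, lgX, lxX, lyX, l1Y, lgY, lxY, lyY⟩ := t
  have c1 := sw_comul_gx hA
  have c2 := sw_comul_gx hH
  apply sw_ext2 hH hA
  intro u hu v hv
  simp only [List.mem_cons, List.not_mem_nil, or_false] at hu hv
  rcases hα with ⟨rfl, rfl⟩ | rfl <;>
  rcases hu with rfl | rfl | rfl | rfl <;> rcases hv with rfl | rfl | rfl | rfl <;>
  simp [l1, l1G, lgG, lxG, lyG, l1X, lgX, lxX, lyX, l1Y, lgY, lxY, lyY, -Bialgebra.comul_mul,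
    -Bialgebra.comul_one, sw_comul_one,
    c1, c2, hA.comul_g, hA.comul_x, hH.comul_g, hH.comul_x, sub_tmul, tmul_sub, add_tmul, tmul_add,
    neg_tmul, tmul_neg, ← smul_tmul'] <;> abel

/-- The twist `u ⊗ v ↦ (u₁ ▷ v₁) ⊗ (u₂ ◁ v₂)`. -/
def sw_tw (rhd : H ⊗[k] A →ₗ[k] A) (lhd : H ⊗[k] A →ₗ[k] H) : H ⊗[k] A →ₗ[k] A ⊗[k] H :=
  TensorProduct.map rhd lhd ∘ₗ (TensorProduct.tensorTensorTensorComm k H H A A).toLinearMap ∘ₗ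
    TensorProduct.map (Coalgebra.comul (R := k)) (Coalgebra.comul (R := k))

theorem sw_tw_table (hA : IsSweedler k A G X) (hH : IsSweedler k H g x)
    (hα : (α = 1 ∧ lam = 0) ∨ α = -1) (t : SwTable G X g x rhd lhd α lam) :
    sw_tw rhd lhd (1 ⊗ₜ 1) = 1 ⊗ₜ 1 ∧ sw_tw rhd lhd (1 ⊗ₜ G) = G ⊗ₜ 1 ∧
    sw_tw rhd lhd (1 ⊗ₜ X) = X ⊗ₜ 1 ∧ sw_tw rhd lhd (1 ⊗ₜ (G * X)) = (G * X) ⊗ₜ 1 ∧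
    sw_tw rhd lhd (g ⊗ₜ 1) = 1 ⊗ₜ g ∧ sw_tw rhd lhd (g ⊗ₜ G) = G ⊗ₜ g ∧
    sw_tw rhd lhd (g ⊗ₜ X) = α • (X ⊗ₜ g) ∧
    sw_tw rhd lhd (g ⊗ₜ (G * X)) = α • ((G * X) ⊗ₜ g) ∧
    sw_tw rhd lhd (x ⊗ₜ 1) = 1 ⊗ₜ x ∧ sw_tw rhd lhd (x ⊗ₜ G) = α • (G ⊗ₜ x) ∧
    sw_tw rhd lhd (x ⊗ₜ X) = (lam • (1 : A) - lam • G) ⊗ₜ 1 + α • (X ⊗ₜ x) +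
      G ⊗ₜ (lam • (1 : H) - lam • g) ∧
    sw_tw rhd lhd (x ⊗ₜ (G * X)) = (lam • (1 : A) - lam • G) ⊗ₜ 1 + (G * X) ⊗ₜ x -
      1 ⊗ₜ (lam • (1 : H) - lam • g) ∧
    sw_tw rhd lhd ((g * x) ⊗ₜ 1) = 1 ⊗ₜ (g * x) ∧
    sw_tw rhd lhd ((g * x) ⊗ₜ G) = α • (G ⊗ₜ (g * x)) ∧
    sw_tw rhd lhd ((g * x) ⊗ₜ X) = (lam • (1 : A) - lam • G) ⊗ₜ g + X ⊗ₜ (g * x) -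
      G ⊗ₜ (lam • (1 : H) - lam • g) ∧
    sw_tw rhd lhd ((g * x) ⊗ₜ (G * X)) = (lam • (1 : A) - lam • G) ⊗ₜ g +
      α • ((G * X) ⊗ₜ (g * x)) + 1 ⊗ₜ (lam • (1 : H) - lam • g) := by
  obtain ⟨r1, rg1, rgG, rgX, rgY, rx1, rxG, rxX, rxY, ry1, ryG, ryX, ryY, l1, l1G, lgG, lxG, lyG,
    l1X, lgX, lxX, lyX, l1Y, lgY, lxY, lyY⟩ := t
  have c1 := sw_comul_gx hA
  have c2 := sw_comul_gx hH
  have ha : α * α = 1 := by rcases hα with ⟨rfl, _⟩ | rfl <;> simp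
  refine ⟨?_, ?_, ?_, ?_, ?_, ?_, ?_, ?_, ?_, ?_, ?_, ?_, ?_, ?_, ?_, ?_⟩ <;>
  simp [sw_tw, r1, rg1, rgG, rgX, rgY, rx1, rxG, rxX, rxY, ry1, ryG, ryX, ryY,
    l1, l1G, lgG, lxG, lyG, l1X, lgX, lxX, lyX, l1Y, lgY, lxY, lyY, -Bialgebra.comul_mul,
    -Bialgebra.comul_one, sw_comul_one,
    c1, c2, hA.comul_g, hA.comul_x, hH.comul_g, hH.comul_x, sub_tmul, tmul_sub, add_tmul, tmul_add,
    neg_tmul, tmul_neg, ← smul_tmul', smul_smul, ha] <;> abel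

theorem sw_mp2 (hA : IsSweedler k A G X) (hH : IsSweedler k H g x)
    (hα : (α = 1 ∧ lam = 0) ∨ α = -1) (t : SwTable G X g x rhd lhd α lam) :
    rhd ∘ₗ LinearMap.lTensor H (LinearMap.mul' k A) =
    LinearMap.mul' k A ∘ₗ LinearMap.lTensor A rhd ∘ₗ
      (TensorProduct.assoc k A H A).toLinearMap ∘ₗ
        LinearMap.rTensor A (TensorProduct.map rhd lhd) ∘ₗ
          LinearMap.rTensor A (TensorProduct.tensorTensorTensorComm k H H A A).toLinearMap ∘ₗ
            (TensorProduct.assoc k (H ⊗[k] H) (A ⊗[k] A) A).symm.toLinearMap ∘ₗ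
              TensorProduct.map (Coalgebra.comul (R := k))
                (TensorProduct.map (Coalgebra.comul (R := k)) LinearMap.id) := by
  obtain ⟨a1, a2, a3, a4, a5, a6, a7, a8, a9, b1, b2, b3, b4, b5, b6, b7⟩ := sw_tw_table hA hH hα t
  obtain ⟨r1, rg1, rgG, rgX, rgY, rx1, rxG, rxX, rxY, ry1, ryG, ryX, ryY, l1, l1G, lgG, lxG, lyG,
    l1X, lgX, lxX, lyX, l1Y, lgY, lxY, lyY⟩ := t
  have c1 := sw_comul_gx hA
  have c2 := sw_comul_gx hH
  obtain ⟨m1, m2, m3, m4, m5⟩ := sw_mul_table hA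
  have key : rhd ∘ₗ LinearMap.lTensor H (LinearMap.mul' k A) =
      LinearMap.mul' k A ∘ₗ LinearMap.lTensor A rhd ∘ₗ
      (TensorProduct.assoc k A H A).toLinearMap ∘ₗ LinearMap.rTensor A (sw_tw rhd lhd) ∘ₗ
      (TensorProduct.assoc k H A A).symm.toLinearMap := by
    generalize sw_tw rhd lhd = T at *
    apply TensorProduct.ext
    apply sw_ext hH <;> apply sw_ext2 hA hA <;>
    intro u hu v hv <;>
    simp only [List.mem_cons, List.not_mem_nil, or_false] at hu hv <;>
    rcases hα with ⟨rfl, rfl⟩ | rfl <;>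
    rcases hu with rfl | rfl | rfl | rfl <;> rcases hv with rfl | rfl | rfl | rfl <;>
    simp [r1, rg1, rgG, rgX, rgY, rx1, rxG, rxX, rxY, ry1, ryG, ryX, ryY, a1, a2, a3, a4, a5, a6, a7, a8, a9, b1, b2, b3, b4, b5, b6, b7,
      hA.g_sq, hA.x_sq, hA.x_mul_g, m1, m2, m3, m4, m5, sub_tmul, tmul_sub, add_tmul, tmul_add,
      neg_tmul, tmul_neg, ← smul_tmul', sub_mul, mul_sub] <;> abel
  rw [key, sw_tw, LinearMap.rTensor_comp, LinearMap.rTensor_comp]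
  have nat : LinearMap.rTensor A (TensorProduct.map (Coalgebra.comul (R := k) (A := H))
      (Coalgebra.comul (R := k) (A := A))) ∘ₗ (TensorProduct.assoc k H A A).symm.toLinearMap =
      (TensorProduct.assoc k (H ⊗[k] H) (A ⊗[k] A) A).symm.toLinearMap ∘ₗ
              TensorProduct.map (Coalgebra.comul (R := k))
                (TensorProduct.map (Coalgebra.comul (R := k)) LinearMap.id) := by
    apply TensorProduct.ext
    apply LinearMap.ext
    intro u
    apply TensorProduct.ext'
    intro v w
    simp
  simp only [LinearMap.comp_assoc, nat]

theorem sw_mp3 (hA : IsSweedler k A G X) (hH : IsSweedler k H g x)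
    (hα : (α = 1 ∧ lam = 0) ∨ α = -1) (t : SwTable G X g x rhd lhd α lam) :
    lhd ∘ₗ LinearMap.rTensor A (LinearMap.mul' k H) =
    LinearMap.mul' k H ∘ₗ LinearMap.rTensor H lhd ∘ₗ
      (TensorProduct.assoc k H A H).symm.toLinearMap ∘ₗ
        LinearMap.lTensor H (TensorProduct.map rhd lhd) ∘ₗ
          LinearMap.lTensor H (TensorProduct.tensorTensorTensorComm k H H A A).toLinearMap ∘ₗ
            LinearMap.lTensor H (TensorProduct.map (Coalgebra.comul (R := k))
              (Coalgebra.comul (R := k))) ∘ₗ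
              (TensorProduct.assoc k H H A).toLinearMap := by
  obtain ⟨a1, a2, a3, a4, a5, a6, a7, a8, a9, b1, b2, b3, b4, b5, b6, b7⟩ := sw_tw_table hA hH hα t
  obtain ⟨r1, rg1, rgG, rgX, rgY, rx1, rxG, rxX, rxY, ry1, ryG, ryX, ryY, l1, l1G, lgG, lxG, lyG,
    l1X, lgX, lxX, lyX, l1Y, lgY, lxY, lyY⟩ := t
  have c1 := sw_comul_gx hA
  have c2 := sw_comul_gx hH
  obtain ⟨m1, m2, m3, m4, m5⟩ := sw_mul_table hH
  have key : lhd ∘ₗ LinearMap.rTensor A (LinearMap.mul' k H) =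
      LinearMap.mul' k H ∘ₗ LinearMap.rTensor H lhd ∘ₗ
      (TensorProduct.assoc k H A H).symm.toLinearMap ∘ₗ
      LinearMap.lTensor H (sw_tw rhd lhd) ∘ₗ (TensorProduct.assoc k H H A).toLinearMap := by
    generalize sw_tw rhd lhd = T at *
    apply TensorProduct.ext
    apply sw_ext2 hH hH
    intro u hu v hv
    simp only [List.mem_cons, List.not_mem_nil, or_false] at hu hv
    rcases hα with ⟨rfl, rfl⟩ | rfl <;>
    rcases hu with rfl | rfl | rfl | rfl <;> rcases hv with rfl | rfl | rfl | rfl <;>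
    apply sw_ext hA <;>
    simp [l1, l1G, lgG, lxG, lyG, l1X, lgX, lxX, lyX, l1Y, lgY, lxY, lyY, a1, a2, a3, a4, a5, a6, a7, a8, a9, b1, b2, b3, b4, b5, b6, b7,
      hH.g_sq, hH.x_sq, hH.x_mul_g, m1, m2, m3, m4, m5, sub_tmul, tmul_sub, add_tmul, tmul_add,
      neg_tmul, tmul_neg, ← smul_tmul', sub_mul, mul_sub, add_mul] <;> abel
  rw [key, sw_tw, LinearMap.lTensor_comp, LinearMap.lTensor_comp]
  simp only [LinearMap.comp_assoc]

theorem sw_mp4 (hA : IsSweedler k A G X) (hH : IsSweedler k H g x)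
    (hα : (α = 1 ∧ lam = 0) ∨ α = -1) (t : SwTable G X g x rhd lhd α lam) :
    TensorProduct.map lhd rhd ∘ₗ
      (TensorProduct.tensorTensorTensorComm k H H A A).toLinearMap ∘ₗ
        TensorProduct.map (Coalgebra.comul (R := k)) (Coalgebra.comul (R := k)) =
    TensorProduct.map lhd rhd ∘ₗ
      (TensorProduct.tensorTensorTensorComm k H H A A).toLinearMap ∘ₗ
        TensorProduct.map
          ((TensorProduct.comm k H H).toLinearMap ∘ₗ Coalgebra.comul (R := k))
          ((TensorProduct.comm k A A).toLinearMap ∘ₗ Coalgebra.comul (R := k)) := by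
  obtain ⟨r1, rg1, rgG, rgX, rgY, rx1, rxG, rxX, rxY, ry1, ryG, ryX, ryY, l1, l1G, lgG, lxG, lyG,
    l1X, lgX, lxX, lyX, l1Y, lgY, lxY, lyY⟩ := t
  have c1 := sw_comul_gx hA
  have c2 := sw_comul_gx hH
  apply sw_ext2 hH hA
  intro u hu v hv
  simp only [List.mem_cons, List.not_mem_nil, or_false] at hu hv
  rcases hα with ⟨rfl, rfl⟩ | rfl <;>
  rcases hu with rfl | rfl | rfl | rfl <;> rcases hv with rfl | rfl | rfl | rfl <;>
  simp [r1, rg1, rgG, rgX, rgY, rx1, rxG, rxX, rxY, ry1, ryG, ryX, ryY,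
    l1, l1G, lgG, lxG, lyG, l1X, lgX, lxX, lyX, l1Y, lgY, lxY, lyY, -Bialgebra.comul_mul,
    -Bialgebra.comul_one, sw_comul_one,
    c1, c2, hA.comul_g, hA.comul_x, hH.comul_g, hH.comul_x, sub_tmul, tmul_sub, add_tmul, tmul_add,
    neg_tmul, tmul_neg, ← smul_tmul'] <;> abel

theorem sw_back (hA : IsSweedler k A G X) (hH : IsSweedler k H g x)
    (hα : (α = 1 ∧ lam = 0) ∨ α = -1) (t : SwTable G X g x rhd lhd α lam) :
    IsMatchedPair k A H rhd lhd where
  one_rhd := t.r1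
  mul_rhd := sw_mul_rhd hA hH hα t
  lhd_one := t.l1
  lhd_mul := sw_lhd_mul hA hH hα t
  counit_rhd := (sw_counits hA hH hα t).1
  counit_lhd := (sw_counits hA hH hα t).2.1
  rhd_unit := (sw_counits hA hH hα t).2.2.1
  unit_lhd := (sw_counits hA hH hα t).2.2.2
  comul_rhd := sw_comuls hA hH hα t
  comul_lhd := sw_comuls_l hA hH hα t
  mp2 := sw_mp2 hA hH hα t
  mp3 := sw_mp3 hA hH hα t
  mp4 := sw_mp4 hA hH hα t

theorem sw_fwd (hchar : (2 : k) ≠ 0) (hA : IsSweedler k A G X) (hH : IsSweedler k H g x)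
    (m : IsMatchedPair k A H rhd lhd) :
    ∃ α lam : k, ((α = 1 ∧ lam = 0) ∨ α = -1) ∧ SwTable G X g x rhd lhd α lam := by
  have cA := sw_comul_gx hA
  have cH := sw_comul_gx hH
  obtain ⟨m1, m2, m3, m4, m5⟩ := sw_mul_table hH
  obtain ⟨n1, n2, n3, n4, n5⟩ := sw_mul_table hA
  have CR := fun u v => congrArg (fun f => f (u ⊗ₜ[k] v)) m.comul_rhd
  have CL := fun u v => congrArg (fun f => f (u ⊗ₜ[k] v)) m.comul_lhd
  have ER := fun u v => congrArg (fun f => f (u ⊗ₜ[k] v)) m.counit_rhd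
  have EL := fun u v => congrArg (fun f => f (u ⊗ₜ[k] v)) m.counit_lhd
  have M2 := fun u v w => congrArg (fun f => f (u ⊗ₜ[k] (v ⊗ₜ[k] w))) m.mp2
  have M3 := fun u v w => congrArg (fun f => f ((u ⊗ₜ[k] v) ⊗ₜ[k] w)) m.mp3
  have M4 := fun u v => congrArg (fun f => f (u ⊗ₜ[k] v)) m.mp4
  simp only [LinearMap.comp_apply, LinearEquiv.coe_coe, TensorProduct.map_tmul,
    LinearMap.lTensor_tmul, LinearMap.rTensor_tmul, LinearMap.mul'_apply, LinearMap.id_apply,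
    TensorProduct.lid_tmul, smul_eq_mul, TensorProduct.assoc_tmul] at CR CL ER EL M2 M3 M4
  have r1 := m.one_rhd
  have l1 := m.lhd_one
  have ru := m.rhd_unit
  have lu := m.unit_lhd
  have rgG : rhd (g ⊗ₜ[k] G) = G := by
    have h1 := CR g G
    have h2 := ER g G
    simp [hA.comul_g, hH.comul_g, hA.counit_g, hH.counit_g] at h1 h2
    rcases sw_grp hA _ h1 h2 with h | h
    · exfalso
      have h3 := m.mul_rhd g g G
      rw [hH.g_sq, h, r1, ru, hH.counit_g, one_smul] at h3
      exact sw_one_ne hA h3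
    · exact h
  have lgG : lhd (g ⊗ₜ[k] G) = g := by
    have h1 := CL g G
    have h2 := EL g G
    simp [hA.comul_g, hH.comul_g, hA.counit_g, hH.counit_g] at h1 h2
    rcases sw_grp hH _ h1 h2 with h | h
    · exfalso
      have h3 := m.lhd_mul g G G
      rw [hA.g_sq, h, l1, lu, hA.counit_g, one_smul] at h3
      exact sw_one_ne hH h3
    · exact h
  have rg1 : rhd (g ⊗ₜ[k] (1 : A)) = 1 := by simp [ru, hH.counit_g]
  have l1G : lhd ((1 : H) ⊗ₜ[k] G) = 1 := by simp [lu, hA.counit_g]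
  have rx1 : rhd (x ⊗ₜ[k] (1 : A)) = 0 := by simp [ru, hH.counit_x]
  have l1X : lhd ((1 : H) ⊗ₜ[k] X) = 0 := by simp [lu, hA.counit_x]
  have ry1 : rhd ((g * x) ⊗ₜ[k] (1 : A)) = 0 := by simp [ru, hH.counit_x]
  have l1Y : lhd ((1 : H) ⊗ₜ[k] (G * X)) = 0 := by simp [lu, hA.counit_x]
  have rxG : rhd (x ⊗ₜ[k] G) = 0 := by
    apply sw_prim_gg hA
    have h1 := CR x G
    simpa [hA.comul_g, hH.comul_x, add_tmul, r1, rgG] using h1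
  have lgX : lhd (g ⊗ₜ[k] X) = 0 := by
    apply sw_prim_gg hH
    have h1 := CL g X
    simpa [hA.comul_x, hH.comul_g, tmul_add, l1, lgG] using h1
  obtain ⟨α, β, rgX⟩ : ∃ a b : k, rhd (g ⊗ₜ[k] X) = a • X + b • ((1 : A) - G) := by
    apply sw_prim hA
    have h1 := CR g X
    simpa [hA.comul_x, hH.comul_g, tmul_add, rg1, rgG] using h1
  obtain ⟨α', β', lxG⟩ : ∃ a b : k, lhd (x ⊗ₜ[k] G) = a • x + b • ((1 : H) - g) := by
    apply sw_prim hH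
    have h1 := CL x G
    simpa [hA.comul_g, hH.comul_x, add_tmul, l1G, lgG] using h1
  obtain ⟨φ, hφ, p1, pg, px, pgx⟩ := sw_coords hH
  obtain ⟨ψ, hψ, q1, qg, qx, qgx⟩ := sw_coords hA
  have rgY := M2 g G X
  simp [hA.comul_g, hH.comul_g, rgG, lgG, rgX, mul_add, mul_sub, hA.g_sq] at rgY
  have rgY' := M2 g X G
  simp [hA.comul_x, hH.comul_g, rgG, lgG, rgX, lgX, l1, add_mul, sub_mul, hA.g_sq, tmul_add,
    add_tmul, hA.x_mul_g, rgY, tmul_neg] at rgY'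
  have hβ : β = 0 := by
    have := congrArg (ψ 0) rgY'
    simp [q1, qg, qx, qgx, -neg_add_rev] at this
    have h2 : 2 * β = 0 := by linear_combination this
    simpa [hchar] using h2
  subst hβ
  have lyG := M3 g x G
  simp [hA.comul_g, hH.comul_x, rgG, rxG, l1G, lgG, lxG, r1, mul_add, mul_sub, hH.g_sq,
    tmul_add, add_tmul] at lyG
  have lyG' := M3 x g G
  simp [hA.comul_g, hH.comul_g, rgG, rxG, l1G, lgG, lxG, r1, add_mul, sub_mul, hH.g_sq,
    tmul_add, add_tmul, hH.x_mul_g, neg_tmul, lyG] at lyG'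
  have hβ' : β' = 0 := by
    have := congrArg (φ 0) lyG'
    simp [p1, pg, px, pgx, -neg_add_rev] at this
    have h2 : 2 * β' = 0 := by linear_combination this
    simpa [hchar] using h2
  subst hβ'
  simp at rgX rgY lxG lyG
  have hα2 : α * α = 1 := by
    have h3 := m.mul_rhd g g X
    rw [hH.g_sq, r1, rgX, tmul_smul, map_smul, rgX] at h3
    have := congrArg (ψ 2) h3
    simp [qx] at this
    exact this.symm
  have h4 := M4 x X
  simp [hA.comul_x, hH.comul_x, tmul_add, add_tmul, l1, r1, lxG, lgX, l1X, rx1, rxG, rgX, lgG,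
    rgG, ← smul_tmul'] at h4
  have T := fun i j => congrArg (sw_T (φ i) (ψ j)) h4
  simp only [map_add, map_smul, sw_T_tmul, p1, pg, px, pgx, q1, qg, qx, qgx, smul_eq_mul] at T
  have t00 := T 0 0
  have t01 := T 0 1
  have t02 := T 0 2
  have t03 := T 0 3
  have t10 := T 1 0
  have t20 := T 2 0
  have t30 := T 3 0
  have t22 := T 2 2
  simp at t00 t01 t02 t03 t10 t20 t30 t22
  subst t22
  have rxX : rhd (x ⊗ₜ[k] X) = ψ 0 (rhd (x ⊗ₜ[k] X)) • (1 : A) - ψ 0 (rhd (x ⊗ₜ[k] X)) • G := by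
    have e1 : ψ 1 (rhd (x ⊗ₜ[k] X)) = - ψ 0 (rhd (x ⊗ₜ[k] X)) := by
      linear_combination -t01 - t00
    conv_lhs => rw [hψ (rhd (x ⊗ₜ[k] X))]
    rw [← t02, ← t03, e1]
    module
  have lxX : lhd (x ⊗ₜ[k] X) = ψ 0 (rhd (x ⊗ₜ[k] X)) • (1 : H) - ψ 0 (rhd (x ⊗ₜ[k] X)) • g := by
    have e1 : φ 1 (lhd (x ⊗ₜ[k] X)) = - ψ 0 (rhd (x ⊗ₜ[k] X)) := by
      linear_combination t10
    conv_lhs => rw [hφ (lhd (x ⊗ₜ[k] X))]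
    rw [t20, t30, e1, t00]
    module
  generalize ψ 0 (rhd (x ⊗ₜ[k] X)) = lam at rxX lxX
  have rxY := M2 x G X
  simp [hA.comul_g, hH.comul_x, add_tmul, rxG, l1G, rgG, lxG, rxX, ← smul_tmul', mul_sub,
    hA.g_sq] at rxY
  have rxY' := M2 x X G
  simp [hA.comul_x, hH.comul_x, add_tmul, tmul_add, sub_tmul, rxG, l1G, rgG, lxG, rxX, lxX, l1X,
    l1, r1, ← smul_tmul', mul_sub, sub_mul, hA.g_sq, hA.x_mul_g, tmul_neg] at rxY'
  have rxY2 : rhd (x ⊗ₜ[k] (G * X)) = lam • (1 : A) - lam • G := by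
    rw [← neg_inj, rxY']
    abel
  have hα : (α' = 1 ∧ lam = 0) ∨ α' = -1 := by
    have h2 : (α' - 1) * (α' + 1) = 0 := by linear_combination hα2
    rcases mul_eq_zero.1 h2 with h | h
    · left
      have h1 : α' = 1 := by linear_combination h
      refine ⟨h1, ?_⟩
      have h5 := rxY.symm.trans rxY2
      rw [h1] at h5
      have h6 := congrArg (ψ 1) h5
      simp [q1, qg] at h6
      have h7 : 2 * lam = 0 := by linear_combination h6
      simpa [hchar] using h7
    · right
      linear_combination h
  have lyX := M3 g x X
  simp [hA.comul_x, hH.comul_x, add_tmul, tmul_add, tmul_sub, rxG, l1G, rgG, lxG, rxX, lxX, l1X,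
    l1, r1, rgX, lgX, lgG, ← smul_tmul', mul_sub, sub_mul, hH.g_sq] at lyX
  have lxY := m.lhd_mul x G X
  rw [lxG, ← smul_tmul', map_smul, lxX] at lxY
  have lyY := m.lhd_mul (g * x) G X
  rw [lyG, ← smul_tmul', map_smul, lyX] at lyY
  refine ⟨α', lam, hα, ?_⟩
  constructor <;> try assumption
  · rw [m.mul_rhd, rxG, tmul_zero, map_zero]
  · rw [m.mul_rhd, rxX, tmul_sub, tmul_smul, tmul_smul, map_sub, map_smul, map_smul, rg1, rgG]
  · rw [m.mul_rhd, rxY2, tmul_sub, tmul_smul, tmul_smul, map_sub, map_smul, map_smul, rg1, rgG]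
  · rw [lyX]; abel
  · rw [m.lhd_mul, lgG, lgX]
  · rw [lxY]; rcases hα with ⟨rfl, rfl⟩ | rfl <;> module
  · rw [lyY]; rcases hα with ⟨rfl, rfl⟩ | rfl <;> module

theorem sw_triv (hA : IsSweedler k A G X) (hH : IsSweedler k H g x)
    (h : ∀ (h : H) (a : A),
          rhd (h ⊗ₜ[k] a) = Coalgebra.counit (R := k) h • a ∧
          lhd (h ⊗ₜ[k] a) = Coalgebra.counit (R := k) a • h) :
    SwTable G X g x rhd lhd (1 : k) 0 := by
  constructor <;> intros <;> simp [h, hA.counit_g, hA.counit_x, hH.counit_g, hH.counit_x]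

theorem sw_triv' (hA : IsSweedler k A G X) (hH : IsSweedler k H g x)
    (t : SwTable G X g x rhd lhd (1 : k) 0) (h : H) (a : A) :
    rhd (h ⊗ₜ[k] a) = Coalgebra.counit (R := k) h • a ∧
          lhd (h ⊗ₜ[k] a) = Coalgebra.counit (R := k) a • h := by
  obtain ⟨r1, rg1, rgG, rgX, rgY, rx1, rxG, rxX, rxY, ry1, ryG, ryX, ryY, l1, l1G, lgG, lxG, lyG,
    l1X, lgX, lxX, lyX, l1Y, lgY, lxY, lyY⟩ := t
  have k1 : rhd = (TensorProduct.lid k A).toLinearMap ∘ₗ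
      LinearMap.rTensor A (Coalgebra.counit (R := k) (A := H)) := by
    apply sw_ext2 hH hA
    intro u hu v hv
    simp only [List.mem_cons, List.not_mem_nil, or_false] at hu hv
    rcases hu with rfl | rfl | rfl | rfl <;> rcases hv with rfl | rfl | rfl | rfl <;>
    simp [r1, rg1, rgG, rgX, rgY, rx1, rxG, rxX, rxY, ry1, ryG, ryX, ryY,
      hA.counit_g, hA.counit_x, hH.counit_g, hH.counit_x]
  have k2 : lhd = (TensorProduct.rid k H).toLinearMap ∘ₗ
      LinearMap.lTensor H (Coalgebra.counit (R := k) (A := A)) := by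
    apply sw_ext2 hH hA
    intro u hu v hv
    simp only [List.mem_cons, List.not_mem_nil, or_false] at hu hv
    rcases hu with rfl | rfl | rfl | rfl <;> rcases hv with rfl | rfl | rfl | rfl <;>
    simp [l1, l1G, lgG, lxG, lyG, l1X, lgX, lxX, lyX, l1Y, lgY, lxY, lyY,
      hA.counit_g, hA.counit_x, hH.counit_g, hH.counit_x]
  exact ⟨by simp [k1], by simp [k2]⟩

end

/-- Let `k` be a field of characteristic `≠ 2` and let `H₄'` (with generators `G, X`) and
`H₄` (with generators `g, x`) be two copies of Sweedler's Hopf algebra.  Then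
`(H₄', H₄, ▷, ◁)` is a matched pair of Hopf algebras if and only if both actions are
trivial, or there exists `λ ∈ k` such that the actions are given by the tables of
Theorem 2.5 (parameterized by `λ`). -/
theorem sweedler_matchedPairs
    {k : Type*} [Field k] (hchar : (2 : k) ≠ 0)
    {A : Type*} [Ring A] [HopfAlgebra k A] {G X : A} (hA : IsSweedler k A G X)
    {H : Type*} [Ring H] [HopfAlgebra k H] {g x : H} (hH : IsSweedler k H g x)
    (rhd : H ⊗[k] A →ₗ[k] A) (lhd : H ⊗[k] A →ₗ[k] H) :
    IsMatchedPair k A H rhd lhd ↔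
      ((∀ (h : H) (a : A),
          rhd (h ⊗ₜ[k] a) = Coalgebra.counit (R := k) h • a ∧
          lhd (h ⊗ₜ[k] a) = Coalgebra.counit (R := k) a • h) ∨
        ∃ lam : k,
          -- the left action ▷
          (∀ a : A, rhd ((1 : H) ⊗ₜ[k] a) = a) ∧
          rhd (g ⊗ₜ[k] (1 : A)) = 1 ∧
          rhd (g ⊗ₜ[k] G) = G ∧
          rhd (g ⊗ₜ[k] X) = -X ∧
          rhd (g ⊗ₜ[k] (G * X)) = -(G * X) ∧
          rhd (x ⊗ₜ[k] (1 : A)) = 0 ∧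
          rhd (x ⊗ₜ[k] G) = 0 ∧
          rhd (x ⊗ₜ[k] X) = lam • (1 : A) - lam • G ∧
          rhd (x ⊗ₜ[k] (G * X)) = lam • (1 : A) - lam • G ∧
          rhd ((g * x) ⊗ₜ[k] (1 : A)) = 0 ∧
          rhd ((g * x) ⊗ₜ[k] G) = 0 ∧
          rhd ((g * x) ⊗ₜ[k] X) = lam • (1 : A) - lam • G ∧
          rhd ((g * x) ⊗ₜ[k] (G * X)) = lam • (1 : A) - lam • G ∧
          -- the right action ◁
          (∀ h : H, lhd (h ⊗ₜ[k] (1 : A)) = h) ∧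
          lhd ((1 : H) ⊗ₜ[k] G) = 1 ∧
          lhd (g ⊗ₜ[k] G) = g ∧
          lhd (x ⊗ₜ[k] G) = -x ∧
          lhd ((g * x) ⊗ₜ[k] G) = -(g * x) ∧
          lhd ((1 : H) ⊗ₜ[k] X) = 0 ∧
          lhd (g ⊗ₜ[k] X) = 0 ∧
          lhd (x ⊗ₜ[k] X) = lam • (1 : H) - lam • g ∧
          lhd ((g * x) ⊗ₜ[k] X) = -(lam • (1 : H)) + lam • g ∧
          lhd ((1 : H) ⊗ₜ[k] (G * X)) = 0 ∧
          lhd (g ⊗ₜ[k] (G * X)) = 0 ∧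
          lhd (x ⊗ₜ[k] (G * X)) = -(lam • (1 : H)) + lam • g ∧
          lhd ((g * x) ⊗ₜ[k] (G * X)) = lam • (1 : H) - lam • g) := by
  constructor
  · intro m
    obtain ⟨α, lam, hα, t⟩ := sw_fwd hchar hA hH m
    rcases hα with ⟨rfl, rfl⟩ | rfl
    · exact Or.inl (sw_triv' hA hH t)
    · right
      obtain ⟨r1, rg1, rgG, rgX, rgY, rx1, rxG, rxX, rxY, ry1, ryG, ryX, ryY, l1, l1G, lgG, lxG,
        lyG, l1X, lgX, lxX, lyX, l1Y, lgY, lxY, lyY⟩ := t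
      rw [neg_one_smul] at rgX rgY lxG lyG
      exact ⟨lam, r1, rg1, rgG, rgX, rgY, rx1, rxG, rxX, rxY, ry1, ryG, ryX, ryY, l1, l1G, lgG,
        lxG, lyG, l1X, lgX, lxX, lyX, l1Y, lgY, lxY, lyY⟩
  · rintro (h | ⟨lam, r1, rg1, rgG, rgX, rgY, rx1, rxG, rxX, rxY, ry1, ryG, ryX, ryY, l1, l1G, lgG,
      lxG, lyG, l1X, lgX, lxX, lyX, l1Y, lgY, lxY, lyY⟩)
    · exact sw_back hA hH (Or.inl ⟨rfl, rfl⟩) (sw_triv hA hH h)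
    · rw [← neg_one_smul k] at rgX rgY lxG lyG
      exact sw_back hA hH (Or.inr rfl) ⟨r1, rg1, rgG, rgX, rgY, rx1, rxG, rxX, rxY, ry1, ryG, ryX,
        ryY, l1, l1G, lgG, lxG, lyG, l1X, lgX, lxX, lyX, l1Y, lgY, lxY, lyY⟩

end
end

section
/- Let k be a field of characteristic ≠ 2. A Hopf algebra E factorizes through H_4 and H_4 (two copies of Sweedler's Hopf algebra) if and only if E is isomorphic as a Hopf algebra to H_4 ⊗ H_4 or to H_{16,λ} for some λ ∈ k. -/
open TensorProduct

noncomputable section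

/-- A Hopf algebra `E` factorizes through `A` and `H` if there are injective morphisms of
Hopf algebras (equivalently, of bialgebras) `i : A → E` and `j : H → E` such that the
linear map `A ⊗ H → E`, `a ⊗ h ↦ i(a)j(h)` is bijective. -/
def FactorizesThrough (k : Type*) [CommRing k] (E A H : Type*) [Ring E] [Ring A] [Ring H]
    [HopfAlgebra k E] [HopfAlgebra k A] [HopfAlgebra k H] : Prop :=
  ∃ (i : A →ₐc[k] E) (j : H →ₐc[k] E), Function.Injective i ∧ Function.Injective j ∧
    Function.Bijective (LinearMap.mul' k E ∘ₗ TensorProduct.map i.toLinearMap j.toLinearMap)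

/-- `E` is (a model of) the Hopf algebra `𝓗_{16, λ}`: it is generated by `g`, `x`, `G`, `X`
subject to the relations `g² = G² = 1`, `x² = X² = 0`, `gx = -xg`, `GX = -XG`, `gG = Gg`,
`gX = -Xg`, `xG = -Gx`, `xX + Xx = λ(1 - Gg)`, the sixteen products of elements of
`{1, G, X, GX}` with elements of `{1, g, x, gx}` form a basis of `E`, the elements
`g`, `G` are group-like, `x` is `(1, g)`-primitive and `X` is `(1, G)`-primitive. -/
structure IsH16 (k : Type*) [CommRing k] (E : Type*) [Ring E] [HopfAlgebra k E]
    (g x G X : E) (lam : k) : Prop where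
  g_sq : g * g = 1
  G_sq : G * G = 1
  x_sq : x * x = 0
  X_sq : X * X = 0
  gx_eq : g * x = -(x * g)
  GX_eq : G * X = -(X * G)
  gG_comm : g * G = G * g
  gX_anticomm : g * X = -(X * g)
  xG_anticomm : x * G = -(G * x)
  xX_rel : x * X + X * x = lam • ((1 : E) - G * g)
  li : LinearIndependent k
    (fun p : Fin 4 × Fin 4 => ![(1 : E), G, X, G * X] p.1 * ![(1 : E), g, x, g * x] p.2)
  span : Submodule.span k
    (Set.range (fun p : Fin 4 × Fin 4 =>
      ![(1 : E), G, X, G * X] p.1 * ![(1 : E), g, x, g * x] p.2)) = ⊤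
  comul_g : Coalgebra.comul (R := k) g = g ⊗ₜ[k] g
  comul_G : Coalgebra.comul (R := k) G = G ⊗ₜ[k] G
  comul_x : Coalgebra.comul (R := k) x = x ⊗ₜ[k] (1 : E) + g ⊗ₜ[k] x
  comul_X : Coalgebra.comul (R := k) X = X ⊗ₜ[k] (1 : E) + G ⊗ₜ[k] X
  counit_g : Coalgebra.counit (R := k) g = 1
  counit_G : Coalgebra.counit (R := k) G = 1
  counit_x : Coalgebra.counit (R := k) x = 0
  counit_X : Coalgebra.counit (R := k) X = 0

universe u

namespace SweedlerFac

/-- Structure constants of the Sweedler coalgebra in the basis `1, g, x, gx`. -/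
def sw (k : Type*) [Field k] : Fin 4 → Fin 4 → Fin 4 → k :=
  ![![![1, 0, 0, 0], ![0, 0, 0, 0], ![0, 0, 0, 0], ![0, 0, 0, 0]],
    ![![0, 0, 0, 0], ![0, 1, 0, 0], ![0, 0, 0, 0], ![0, 0, 0, 0]],
    ![![0, 0, 0, 0], ![0, 0, 1, 0], ![1, 0, 0, 0], ![0, 0, 0, 0]],
    ![![0, 0, 0, 1], ![0, 0, 0, 0], ![0, 0, 0, 0], ![0, 1, 0, 0]]]

structure Sw4 (k : Type*) [Field k] {E : Type*} [Ring E] [Bialgebra k E] (G X : E) : Prop where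
  G_sq : G * G = 1
  X_sq : X * X = 0
  XG : X * G = -(G * X)
  comul_G : Coalgebra.comul (R := k) G = G ⊗ₜ[k] G
  comul_X : Coalgebra.comul (R := k) X = X ⊗ₜ[k] (1 : E) + G ⊗ₜ[k] X
  counit_G : Coalgebra.counit (R := k) G = 1
  counit_X : Coalgebra.counit (R := k) X = 0

variable {k : Type*} [Field k] {E : Type*} [Ring E] [Bialgebra k E] {G X g x : E}

theorem Sw4.comul (h : Sw4 k G X) (a : Fin 4) :
    Coalgebra.comul (R := k) (![(1 : E), G, X, G * X] a) =
      ∑ s, ∑ t, sw k a s t • (![(1 : E), G, X, G * X] s ⊗ₜ[k] ![(1 : E), G, X, G * X] t) := by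
  fin_cases a <;>
    simp [sw, Fin.sum_univ_four, h.comul_G, h.comul_X, mul_add,
      Algebra.TensorProduct.tmul_mul_tmul, h.G_sq, Algebra.TensorProduct.one_def]
  all_goals abel

theorem coef_comul (hG : Sw4 k G X) (hg : Sw4 k g x) (b : Module.Basis (Fin 4 × Fin 4) k E)
    (hb : ∀ p, b p = ![(1 : E), G, X, G * X] p.1 * ![(1 : E), g, x, g * x] p.2) (y : E)
    (q r : Fin 4 × Fin 4) :
    (b.tensorProduct b).repr (Coalgebra.comul (R := k) y) (q, r) =
      ∑ p, b.repr y p * (sw k p.1 q.1 r.1 * sw k p.2 q.2 r.2) := by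
  have key : ((b.tensorProduct b).coord (q, r)) ∘ₗ (Coalgebra.comul (R := k) (A := E)) =
      ∑ p : Fin 4 × Fin 4, (sw k p.1 q.1 r.1 * sw k p.2 q.2 r.2) • b.coord p := by
    refine b.ext fun p => ?_
    have : Coalgebra.comul (R := k) (b p) =
        ∑ s', ∑ t', ∑ s, ∑ t, (sw k p.1 s t * sw k p.2 s' t') •
          (b.tensorProduct b) ((s, s'), (t, t')) := by
      rw [hb, Bialgebra.comul_mul, hG.comul, hg.comul]
      simp only [Finset.sum_mul, Finset.mul_sum, smul_mul_smul_comm,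
        Algebra.TensorProduct.tmul_mul_tmul, Module.Basis.tensorProduct_apply, hb]
    simp only [LinearMap.comp_apply, this, map_sum, map_smul, Module.Basis.coord_apply,
      Module.Basis.repr_self, LinearMap.sum_apply, LinearMap.smul_apply]
    obtain ⟨q1, q2⟩ := q
    obtain ⟨r1, r2⟩ := r
    simp only [Finsupp.single_apply, Prod.mk.injEq, smul_eq_mul, mul_ite, mul_one, mul_zero,
      ite_and, Finset.sum_ite_eq, Finset.mem_univ, if_true]
    rw [Finset.sum_eq_single q2, Finset.sum_eq_single r2, Finset.sum_eq_single q1,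
      Finset.sum_eq_single r1]
    all_goals simp +contextual
  have := LinearMap.congr_fun key y
  simpa [LinearMap.sum_apply, mul_comm] using this

theorem coef_tmul (b : Module.Basis (Fin 4 × Fin 4) k E) (y z : E) (q r : Fin 4 × Fin 4) :
    (b.tensorProduct b).repr (y ⊗ₜ[k] z) (q, r) = b.repr y q * b.repr z r := by
  rw [Module.Basis.tensorProduct_repr_tmul_apply, smul_eq_mul, mul_comm]

section Classify

variable (hG : Sw4 k G X) (hg : Sw4 k g x) (b : Module.Basis (Fin 4 × Fin 4) k E)
    (hb : ∀ p, b p = ![(1 : E), G, X, G * X] p.1 * ![(1 : E), g, x, g * x] p.2)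

theorem expand (hb : ∀ p, b p = ![(1 : E), G, X, G * X] p.1 * ![(1 : E), g, x, g * x] p.2)
    (y : E) : y = ∑ p, b.repr y p • (![(1 : E), G, X, G * X] p.1 * ![(1 : E), g, x, g * x] p.2) := by
  conv_lhs => rw [← b.sum_repr y]
  simp only [hb]

include hG hg hb

theorem grouplike_eq (y : E) (hy : Coalgebra.comul (R := k) y = y ⊗ₜ[k] y) :
    y = b.repr y (0, 0) • (1 : E) + b.repr y (1, 0) • G + b.repr y (0, 1) • g
      + b.repr y (1, 1) • (G * g) := by
  have H : ∀ q r, ∑ p, b.repr y p * (sw k p.1 q.1 r.1 * sw k p.2 q.2 r.2) =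
      b.repr y q * b.repr y r := fun q r => by
    rw [← coef_comul hG hg b hb, hy, coef_tmul]
  have Z : ∀ a c : Fin 4, (2 ≤ a ∨ 2 ≤ c) → b.repr y (a, c) = 0 := by
    intro a c hac
    have h := H (a, c) (a, c)
    fin_cases a <;> fin_cases c <;> simp at hac <;>
      simpa [Fintype.sum_prod_type, Fin.sum_univ_four, sw] using h
  conv_lhs => rw [expand b hb y]
  simp [Fintype.sum_prod_type, Fin.sum_univ_four, Z]
  abel

/-- Skew-primitive elements. -/
theorem skew_coef (u y : E) (hy : Coalgebra.comul (R := k) y = y ⊗ₜ[k] (1 : E) + u ⊗ₜ[k] y)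
    (q r : Fin 4 × Fin 4) : ∑ p, b.repr y p * (sw k p.1 q.1 r.1 * sw k p.2 q.2 r.2) =
      b.repr y q * (if (0, 0) = r then 1 else 0) + b.repr u q * b.repr y r := by
  have h1 : (1 : E) = b (0, 0) := by simp [hb]
  rw [← coef_comul hG hg b hb, hy, map_add, Finsupp.add_apply, coef_tmul, coef_tmul, h1,
    Module.Basis.repr_self, Finsupp.single_apply]

theorem skew_G (y : E) (hy : Coalgebra.comul (R := k) y = y ⊗ₜ[k] (1 : E) + G ⊗ₜ[k] y) :
    ∃ a c : k, y = a • X + c • (1 - G) := by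
  have hu : G = b (1, 0) := by simp [hb]
  have H := skew_coef hG hg b hb _ y hy
  have hr : b.repr G = Finsupp.single (1, 0) 1 := by rw [hu, Module.Basis.repr_self]
  simp only [hr, Finsupp.single_apply, Fintype.sum_prod_type, Fin.sum_univ_four] at H
  have e1 := H (1, 0) (0, 0)
  have e2 := H (0, 1) (0, 1)
  have e3 := H (1, 1) (1, 1)
  have e4 := H (0, 1) (0, 2)
  have e5 := H (0, 3) (0, 1)
  have e6 := H (1, 1) (1, 2)
  have e7 := H (1, 3) (1, 1)
  have e8 := H (2, 1) (0, 1)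
  have e9 := H (3, 0) (1, 0)
  have e10 := H (3, 1) (1, 1)
  have e11 := H (2, 1) (0, 2)
  have e12 := H (2, 3) (0, 1)
  have e13 := H (3, 1) (1, 2)
  have e14 := H (3, 3) (1, 1)
  simp [sw] at e1 e2 e3 e4 e5 e6 e7 e8 e9 e10 e11 e12 e13 e14
  refine ⟨b.repr y (2, 0), b.repr y (0, 0), ?_⟩
  have e1' : b.repr y (1, 0) = - b.repr y (0, 0) := by linear_combination -e1
  conv_lhs => rw [expand b hb y]
  simp [Fintype.sum_prod_type, Fin.sum_univ_four, e1', e2, e3, e4, e5, e6, e7, e8, e9, e10, e11, e12, e13, e14]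
  module

theorem skew_g (y : E) (hy : Coalgebra.comul (R := k) y = y ⊗ₜ[k] (1 : E) + g ⊗ₜ[k] y) :
    ∃ a c : k, y = a • x + c • (1 - g) := by
  have hu : g = b (0, 1) := by simp [hb]
  have H := skew_coef hG hg b hb _ y hy
  have hr : b.repr g = Finsupp.single (0, 1) 1 := by rw [hu, Module.Basis.repr_self]
  simp only [hr, Finsupp.single_apply, Fintype.sum_prod_type, Fin.sum_univ_four] at H
  have e1 := H (0, 1) (0, 0)
  have e2 := H (1, 0) (1, 0)
  have e3 := H (1, 1) (1, 1)
  have e4 := H (1, 0) (2, 0)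
  have e5 := H (3, 0) (1, 0)
  have e6 := H (1, 1) (2, 1)
  have e7 := H (3, 1) (1, 1)
  have e8 := H (1, 2) (1, 0)
  have e9 := H (0, 3) (0, 1)
  have e10 := H (1, 3) (1, 1)
  have e11 := H (1, 2) (2, 0)
  have e12 := H (3, 2) (1, 0)
  have e13 := H (1, 3) (2, 1)
  have e14 := H (3, 3) (1, 1)
  simp [sw] at e1 e2 e3 e4 e5 e6 e7 e8 e9 e10 e11 e12 e13 e14
  refine ⟨b.repr y (0, 2), b.repr y (0, 0), ?_⟩
  have e1' : b.repr y (0, 1) = - b.repr y (0, 0) := by linear_combination -e1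
  conv_lhs => rw [expand b hb y]
  simp [Fintype.sum_prod_type, Fin.sum_univ_four, e1', e2, e3, e4, e5, e6, e7, e8, e9, e10, e11, e12, e13, e14]
  module

theorem skew_Gg (y : E)
    (hy : Coalgebra.comul (R := k) y = y ⊗ₜ[k] (1 : E) + (G * g) ⊗ₜ[k] y) :
    ∃ c : k, y = c • (1 - G * g) := by
  have hu : G * g = b (1, 1) := by simp [hb]
  have H := skew_coef hG hg b hb _ y hy
  have hr : b.repr (G * g) = Finsupp.single (1, 1) 1 := by rw [hu, Module.Basis.repr_self]
  simp only [hr, Finsupp.single_apply, Fintype.sum_prod_type, Fin.sum_univ_four] at H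
  have e1 := H (1, 1) (0, 0)
  have e2 := H (1, 0) (1, 0)
  have e3 := H (0, 1) (0, 1)
  have e4 := H (1, 0) (2, 0)
  have e5 := H (3, 0) (1, 0)
  have e6 := H (2, 1) (0, 1)
  have e7 := H (3, 1) (1, 1)
  have e8 := H (0, 1) (0, 2)
  have e9 := H (0, 3) (0, 1)
  have e10 := H (1, 3) (1, 1)
  have e11 := H (1, 2) (2, 0)
  have e12 := H (3, 2) (1, 0)
  have e13 := H (1, 3) (2, 1)
  have e14 := H (3, 3) (1, 1)
  have e15 := H (1, 2) (1, 0)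
  simp [sw] at e1 e2 e3 e4 e5 e6 e7 e8 e9 e10 e11 e12 e13 e14 e15
  refine ⟨b.repr y (0, 0), ?_⟩
  have e1' : b.repr y (1, 1) = - b.repr y (0, 0) := by linear_combination -e1
  conv_lhs => rw [expand b hb y]
  simp [Fintype.sum_prod_type, Fin.sum_univ_four, e1', e2, e3, e4, e5, e6, e7, e8, e9, e10, e11, e12, e13, e14, e15]
  module

theorem comm_gG : g * G = G * g := by
  have hy : Coalgebra.comul (R := k) (g * G) = (g * G) ⊗ₜ[k] (g * G) := by
    rw [Bialgebra.comul_mul, hG.comul_G, hg.comul_G, Algebra.TensorProduct.tmul_mul_tmul]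
  have b00 : (1 : E) = b (0, 0) := by simp [hb]
  have b10 : G = b (1, 0) := by simp [hb]
  have b01 : g = b (0, 1) := by simp [hb]
  have b11 : G * g = b (1, 1) := by simp [hb]
  have hne : ∀ p q, p ≠ q → b p ≠ b q := fun p q h h' => h (b.injective h')
  have H : ∀ q r, ∑ p, b.repr (g * G) p * (sw k p.1 q.1 r.1 * sw k p.2 q.2 r.2) =
      b.repr (g * G) q * b.repr (g * G) r := fun q r => by
    rw [← coef_comul hG hg b hb, hy, coef_tmul]
  have E0 := grouplike_eq hG hg b hb _ hy
  have H' := fun a c d e => H (a, c) (d, e)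
  generalize b.repr (g * G) = f at E0 H'
  have o1 := H' 0 0 0 0
  have o2 := H' 0 1 0 1
  have o3 := H' 1 0 1 0
  have o4 := H' 1 1 1 1
  have o5 := H' 0 0 0 1
  have o6 := H' 0 0 1 0
  have o7 := H' 0 0 1 1
  have o8 := H' 0 1 1 0
  have o9 := H' 0 1 1 1
  have o10 := H' 1 0 1 1
  simp [sw, Fintype.sum_prod_type, Fin.sum_univ_four] at o1 o2 o3 o4 o5 o6 o7 o8 o9 o10
  have gg : g * (g * G) = G := by rw [← mul_assoc, hg.G_sq, one_mul]
  have GG : (g * G) * G = g := by rw [mul_assoc, hG.G_sq, mul_one]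
  by_cases h1 : f (0, 0) = 0
  · by_cases h2 : f (0, 1) = 0
    · by_cases h3 : f (1, 0) = 0
      · by_cases h4 : f (1, 1) = 0
        · exfalso
          simp [h1, h2, h3, h4] at E0
          rw [E0] at gg
          exact b.ne_zero (1, 0) (by rw [← b10, ← gg, mul_zero])
        · simpa [h1, h2, h3, mul_right_eq_self₀, h4, show f (1, 1) = 1 from
            mul_left_cancel₀ h4 (by rw [mul_one]; exact o4.symm)] using E0
      · exfalso
        have h0 : f (1, 0) = 1 := mul_left_cancel₀ h3 (by rw [mul_one]; exact o3.symm)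
        simp [h3] at o10
        simp [h1, h2, o10, h0] at E0
        rw [E0, hG.G_sq] at GG
        exact hne (0, 0) (0, 1) (by decide) (by rw [← b00, ← b01, GG])
    · exfalso
      have h0 : f (0, 1) = 1 := mul_left_cancel₀ h2 (by rw [mul_one]; exact o2.symm)
      simp [h2] at o8 o9
      simp [h1, o8, o9, h0] at E0
      rw [E0, hg.G_sq] at gg
      exact hne (0, 0) (1, 0) (by decide) (by rw [← b00, ← b10, gg])
  · exfalso
    have h0 : f (0, 0) = 1 := mul_left_cancel₀ h1 (by rw [mul_one]; exact o1.symm)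
    simp [h1] at o5 o6 o7
    simp [o5, o6, o7, h0] at E0
    rw [E0, mul_one] at gg
    exact hne (0, 1) (1, 0) (by decide) (by rw [← b01, ← b10, gg])

end Classify

section Relations

theorem conj_eq (hchar : (2 : k) ≠ 0) (hG : Sw4 k G X)
    (hX : ∀ a b c : k, a • (1 : E) + b • G + c • X = 0 → a = 0 ∧ b = 0 ∧ c = 0)
    (v : E) (hv : v * v = 1) (a c : k)
    (h : v * X * v = a • X + c • (1 - G)) :
    ∃ s : k, v * X = s • (X * v) := by
  have h2 : (v * X * v) * (v * X * v) = 0 := by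
    calc (v * X * v) * (v * X * v) = v * X * (v * v) * X * v := by noncomm_ring
      _ = v * (X * X) * v := by rw [hv]; noncomm_ring
      _ = 0 := by rw [hG.X_sq]; simp
  have h3 : (a • X + c • (1 - G)) * (a • X + c • (1 - G)) =
      (2 * c * c) • (1 : E) + (- (2 * c * c)) • G + (2 * a * c) • X := by
    simp only [mul_add, add_mul, smul_mul_smul_comm, mul_sub, sub_mul, mul_one, one_mul, hG.X_sq,
      hG.XG, hG.G_sq]
    module
  rw [h, h3] at h2
  have hc : c = 0 := by
    have := (hX _ _ _ h2).1
    simpa [hchar] using this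
  refine ⟨a, ?_⟩
  rw [hc, zero_smul, add_zero] at h
  calc v * X = v * X * (v * v) := by rw [hv, mul_one]
    _ = (v * X * v) * v := by noncomm_ring
    _ = _ := by rw [h, smul_mul_assoc]

theorem sign_sq {v Y : E} {s : k} (hv : v * v = 1) (hY : Y ≠ 0) (h : v * Y = s • (Y * v)) :
    s = 1 ∨ s = -1 := by
  have h1 : Y = (s * s) • Y := by
    calc Y = v * (v * Y) := by rw [← mul_assoc, hv, one_mul]
      _ = s • (v * Y * v) := by rw [mul_assoc v Y v, ← mul_smul_comm, ← h]
      _ = (s * s) • (Y * (v * v)) := by rw [h, smul_mul_assoc, smul_smul, mul_assoc]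
      _ = _ := by rw [hv, mul_one]
  have h2 : (s * s - 1) • Y = 0 := by rw [sub_smul, one_smul, ← h1, sub_self]
  have h3 : s * s - 1 = 0 := (smul_eq_zero.1 h2).resolve_right hY
  exact mul_self_eq_one_iff.1 (by linear_combination h3)

theorem relations (hchar : (2 : k) ≠ 0) (hG : Sw4 k G X) (hg : Sw4 k g x)
    (b : Module.Basis (Fin 4 × Fin 4) k E)
    (hb : ∀ p, b p = ![(1 : E), G, X, G * X] p.1 * ![(1 : E), g, x, g * x] p.2) :
    g * G = G * g ∧ ((g * X = X * g ∧ x * G = G * x ∧ x * X = X * x) ∨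
      (g * X = -(X * g) ∧ x * G = -(G * x) ∧ ∃ lam : k, x * X + X * x = lam • (1 - G * g))) := by
  have hc := comm_gG hG hg b hb
  have b00 : b (0, 0) = 1 := by simp [hb]
  have b10 : b (1, 0) = G := by simp [hb]
  have b01 : b (0, 1) = g := by simp [hb]
  have b11 : b (1, 1) = G * g := by simp [hb]
  have b20 : b (2, 0) = X := by simp [hb]
  have b02 : b (0, 2) = x := by simp [hb]
  have b12 : b (1, 2) = G * x := by simp [hb]
  have b21 : b (2, 1) = X * g := by simp [hb]
  have liG : ∀ a c d : k, a • (1 : E) + c • G + d • X = 0 → a = 0 ∧ c = 0 ∧ d = 0 := by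
    intro a c d h
    rw [← b00, ← b10, ← b20] at h
    have h' := fun p => congrArg (fun z => b.repr z p) h
    have h0 := h' (0, 0)
    have h1 := h' (1, 0)
    have h2 := h' (2, 0)
    simp at h0 h1 h2
    exact ⟨h0, h1, h2⟩
  have lig : ∀ a c d : k, a • (1 : E) + c • g + d • x = 0 → a = 0 ∧ c = 0 ∧ d = 0 := by
    intro a c d h
    rw [← b00, ← b01, ← b02] at h
    have h' := fun p => congrArg (fun z => b.repr z p) h
    have h0 := h' (0, 0)
    have h1 := h' (0, 1)
    have h2 := h' (0, 2)
    simp at h0 h1 h2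
    exact ⟨h0, h1, h2⟩
  have gGg : g * G * g = G := by rw [hc, mul_assoc, hg.G_sq, mul_one]
  have GgG : G * g * G = g := by rw [← hc, mul_assoc, hG.G_sq, mul_one]
  obtain ⟨α, hα⟩ : ∃ s : k, g * X = s • (X * g) := by
    obtain ⟨a, c, h⟩ := skew_G hG hg b hb (g * X * g) (by
      simp only [Bialgebra.comul_mul, hG.comul_X, hg.comul_G, mul_add, add_mul,
        Algebra.TensorProduct.tmul_mul_tmul, mul_one, hg.G_sq, gGg])
    exact conj_eq hchar hG liG g hg.G_sq a c h
  obtain ⟨β', hβ'⟩ : ∃ s : k, G * x = s • (x * G) := by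
    obtain ⟨a, c, h⟩ := skew_g hG hg b hb (G * x * G) (by
      simp only [Bialgebra.comul_mul, hg.comul_X, hG.comul_G, mul_add, add_mul,
        Algebra.TensorProduct.tmul_mul_tmul, mul_one, hG.G_sq, GgG])
    exact conj_eq hchar hg lig G hG.G_sq a c h
  have hα2 := sign_sq hg.G_sq (b20 ▸ b.ne_zero (2, 0)) hα
  have hβ2 := sign_sq hG.G_sq (b02 ▸ b.ne_zero (0, 2)) hβ'
  have hβ : x * G = β' • (G * x) := by
    have : β' * β' = 1 := by rcases hβ2 with h | h <;> rw [h] <;> ring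
    rw [hβ', smul_smul, this, one_smul]
  have hxX : Coalgebra.comul (R := k) (x * X) = (x * X) ⊗ₜ[k] (1 : E) + β' • (G * x) ⊗ₜ[k] X
      + α • (X * g) ⊗ₜ[k] x + (G * g) ⊗ₜ[k] (x * X) := by
    simp only [Bialgebra.comul_mul, hG.comul_X, hg.comul_X, mul_add, add_mul,
        Algebra.TensorProduct.tmul_mul_tmul, mul_one, one_mul, hα, hβ, hc, TensorProduct.smul_tmul']
    abel
  have hXx : Coalgebra.comul (R := k) (X * x) = (X * x) ⊗ₜ[k] (1 : E) + (G * x) ⊗ₜ[k] X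
      + (X * g) ⊗ₜ[k] x + (G * g) ⊗ₜ[k] (X * x) := by
    simp only [Bialgebra.comul_mul, hG.comul_X, hg.comul_X, mul_add, add_mul,
        Algebra.TensorProduct.tmul_mul_tmul, mul_one, one_mul]
    abel
  have hαβ : α = β' := by
    have H := coef_comul hG hg b hb (x * X)
    have e1 := H (1, 2) (2, 0)
    have e2 := H (2, 1) (0, 2)
    rw [hxX] at e1 e2
    have r0 : b.repr 1 = Finsupp.single (0, 0) 1 := by rw [← b00, Module.Basis.repr_self]
    have r1 : b.repr (G * g) = Finsupp.single (1, 1) 1 := by rw [← b11, Module.Basis.repr_self]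
    have r2 : b.repr (G * x) = Finsupp.single (1, 2) 1 := by rw [← b12, Module.Basis.repr_self]
    have r3 : b.repr (X * g) = Finsupp.single (2, 1) 1 := by rw [← b21, Module.Basis.repr_self]
    have r4 : b.repr X = Finsupp.single (2, 0) 1 := by rw [← b20, Module.Basis.repr_self]
    have r5 : b.repr x = Finsupp.single (0, 2) 1 := by rw [← b02, Module.Basis.repr_self]
    simp only [map_add, map_smul, Finsupp.add_apply, Finsupp.smul_apply, coef_tmul,
      r0, r1, r2, r3, r4, r5] at e1 e2
    simp [sw, Fintype.sum_prod_type, Fin.sum_univ_four] at e1 e2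
    rw [e1, e2]
  subst hαβ
  have hd : Coalgebra.comul (R := k) (x * X - α • (X * x)) =
      (x * X - α • (X * x)) ⊗ₜ[k] (1 : E) + (G * g) ⊗ₜ[k] (x * X - α • (X * x)) := by
    rw [map_sub, map_smul, hxX, hXx]
    simp only [smul_add, TensorProduct.sub_tmul, TensorProduct.tmul_sub, TensorProduct.smul_tmul',
      TensorProduct.tmul_smul]
    abel
  obtain ⟨lam, hlam⟩ := skew_Gg hG hg b hb _ hd
  refine ⟨hc, ?_⟩
  rcases hα2 with rfl | rfl
  · left
    rw [one_smul] at hα hβ hlam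
    refine ⟨hα, hβ, ?_⟩
    have h1 : g * (x * X - X * x) * g = -(x * X - X * x) := by
      have hgx : g * x = -(x * g) := by rw [hg.XG, neg_neg]
      calc g * (x * X - X * x) * g = (g * x) * X * g - (g * X) * (x * g) := by noncomm_ring
        _ = (-(x * g)) * X * g - (X * g) * (x * g) := by rw [hgx, hα]
        _ = -(x * (g * X) * g) - X * (g * x) * g := by noncomm_ring
        _ = -(x * X - X * x) * (g * g) := by rw [hgx, hα]; noncomm_ring
        _ = _ := by rw [hg.G_sq, mul_one]
    have h2 : g * (x * X - X * x) * g = x * X - X * x := by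
      rw [hlam, mul_smul_comm, smul_mul_assoc, mul_sub, sub_mul, mul_one, hg.G_sq, ← mul_assoc, gGg]
    rw [h1] at h2
    have h3 : (2 : k) • (x * X - X * x) = 0 := by
      rw [two_smul]; nth_rewrite 1 [← h2]; simp
    exact sub_eq_zero.1 ((smul_eq_zero.1 h3).resolve_left hchar)
  · right
    rw [neg_one_smul] at hα hβ hlam
    exact ⟨hα, hβ, lam, by rw [← hlam, sub_neg_eq_add]⟩

end Relations

section Homs

variable {A : Type*} [Ring A] [HopfAlgebra k A] {gA xA : A}

theorem ofSweedler (hA : IsSweedler k A gA xA) : Sw4 k gA xA :=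
  ⟨hA.g_sq, hA.x_sq, hA.x_mul_g, hA.comul_g, hA.comul_x, hA.counit_g, hA.counit_x⟩

theorem Sw4.map (h : Sw4 k g x) {F : Type*} [Ring F] [Bialgebra k F] (i : E →ₐc[k] F) :
    Sw4 k (i g) (i x) where
  G_sq := by rw [← map_mul, h.G_sq, map_one]
  X_sq := by rw [← map_mul, h.X_sq, map_zero]
  XG := by rw [← map_mul, h.XG, map_neg, map_mul]
  comul_G := by
    rw [← CoalgHomClass.map_comp_comul_apply, h.comul_G]; rfl
  comul_X := by
    rw [← CoalgHomClass.map_comp_comul_apply, h.comul_X, map_add]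
    simp
  counit_G := by rw [CoalgHomClass.counit_comp_apply, h.counit_G]
  counit_X := by rw [CoalgHomClass.counit_comp_apply, h.counit_X]

/-- The standard basis of a Sweedler algebra. -/
def swBasis (hA : IsSweedler k A gA xA) : Module.Basis (Fin 4) k A :=
  Module.Basis.mk hA.li (by
    rw [← hA.span]
    refine Submodule.span_mono ?_
    rintro z (rfl | rfl | rfl | rfl)
    exacts [⟨0, rfl⟩, ⟨1, rfl⟩, ⟨2, rfl⟩, ⟨3, rfl⟩])

theorem swBasis_apply (hA : IsSweedler k A gA xA) (a : Fin 4) :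
    swBasis hA a = ![(1 : A), gA, xA, gA * xA] a := by
  simp [swBasis]

theorem Sw4.table (h : Sw4 k G X) : G * (G * X) = X ∧ X * (G * X) = 0 ∧ G * X * G = -X ∧
    G * X * X = 0 ∧ G * X * (G * X) = 0 := by
  have h1 : G * (G * X) = X := by rw [← mul_assoc, h.G_sq, one_mul]
  have h2 : X * (G * X) = 0 := by
    rw [← mul_assoc, h.XG, neg_mul, mul_assoc, h.X_sq, mul_zero, neg_zero]
  refine ⟨h1, h2, ?_, ?_, ?_⟩
  · rw [mul_assoc, h.XG, mul_neg, h1]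
  · rw [mul_assoc, h.X_sq, mul_zero]
  · rw [mul_assoc, h2, mul_zero]

theorem exists_hom (hA : IsSweedler k A gA xA) (hG : Sw4 k G X) :
    ∃ φ : A →ₐc[k] E, φ gA = G ∧ φ xA = X := by
  let b := swBasis hA
  let f : A →ₗ[k] E := b.constr k ![(1 : E), G, X, G * X]
  have hf : ∀ a, f (![(1 : A), gA, xA, gA * xA] a) = ![(1 : E), G, X, G * X] a := fun a => by
    rw [← swBasis_apply hA]; exact b.constr_basis k _ a
  have f1 : f 1 = 1 := hf 0
  have fg : f gA = G := hf 1
  have fx : f xA = X := hf 2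
  have fgx : f (gA * xA) = G * X := hf 3
  obtain ⟨t1, t2, t3, t4, t5⟩ := hG.table
  obtain ⟨s1, s2, s3, s4, s5⟩ := (ofSweedler hA).table
  have hmul : ∀ y z, f (y * z) = f y * f z := by
    have : (LinearMap.mul k A).compr₂ f = (LinearMap.mul k E).compl₁₂ f f := by
      refine b.ext fun p => b.ext fun q => ?_
      simp only [LinearMap.compr₂_apply, LinearMap.compl₁₂_apply, LinearMap.mul_apply', b,
        swBasis_apply, hf]
      fin_cases p <;> fin_cases q <;>
        simp [f1, fg, fx, fgx, t1, t2, t3, t4, t5, s1, s2, s3, s4, s5, hA.g_sq, hA.x_sq,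
          hA.x_mul_g, hG.G_sq, hG.X_sq, hG.XG]
    exact fun y z => LinearMap.congr_fun₂ this y z
  let F : A →ₐ[k] E := AlgHom.ofLinearMap f f1 hmul
  have Fg : F gA = G := fg
  have Fx : F xA = X := fx
  refine ⟨BialgHom.ofAlgHom F ?_ ?_, Fg, Fx⟩
  · refine AlgHom.toLinearMap_injective (b.ext fun p => ?_)
    simp only [b, swBasis_apply]
    fin_cases p <;> simp [Fg, Fx, hG.counit_G, hG.counit_X, hA.counit_g, hA.counit_x]
  · refine AlgHom.toLinearMap_injective (b.ext fun p => ?_)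
    simp only [b, swBasis_apply]
    fin_cases p <;> simp [Fg, Fx, hG.comul_G, hG.comul_X, hA.comul_g, hA.comul_x, mul_add,
      Algebra.TensorProduct.one_def]

/-- The canonical map `A ⊗ B → E`. -/
abbrev canon {B : Type*} [Ring B] [HopfAlgebra k B] (i : A →ₐc[k] E) (j : B →ₐc[k] E) :
    A ⊗[k] B →ₗ[k] E :=
  LinearMap.mul' k E ∘ₗ TensorProduct.map i.toLinearMap j.toLinearMap

variable {B : Type*} [Ring B] [HopfAlgebra k B] {gB xB : B}

theorem canon_tmul (i : A →ₐc[k] E) (j : B →ₐc[k] E) (a : A) (c : B) :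
    canon i j (a ⊗ₜ c) = i a * j c := by
  simp [canon]
  rfl

theorem canon_basis (hA : IsSweedler k A gA xA) (hB : IsSweedler k B gB xB)
    (i : A →ₐc[k] E) (j : B →ₐc[k] E) (p : Fin 4 × Fin 4) :
    canon i j ((swBasis hA).tensorProduct (swBasis hB) p) =
      ![(1 : E), i gA, i xA, i gA * i xA] p.1 * ![(1 : E), j gB, j xB, j gB * j xB] p.2 := by
  obtain ⟨p, q⟩ := p
  rw [Module.Basis.tensorProduct_apply, canon_tmul, swBasis_apply, swBasis_apply]
  congr 1
  · fin_cases p <;> simp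
  · fin_cases q <;> simp

theorem inj_of_bij [Nontrivial A] [Nontrivial B] (i : A →ₐc[k] E) (j : B →ₐc[k] E)
    (h : Function.Injective (canon i j)) : Function.Injective i ∧ Function.Injective j := by
  constructor
  · intro a a' haa
    have : (a ⊗ₜ[k] (1 : B)) = a' ⊗ₜ[k] (1 : B) := h (by
      rw [canon_tmul, canon_tmul, haa])
    exact Algebra.TensorProduct.includeLeft_injective (S := k)
      (FaithfulSMul.algebraMap_injective k B) this
  · intro a a' haa
    have : ((1 : A) ⊗ₜ[k] a) = (1 : A) ⊗ₜ[k] a' := h (by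
      rw [canon_tmul, canon_tmul, haa])
    exact Algebra.TensorProduct.includeRight_injective
      (FaithfulSMul.algebraMap_injective k A) this

theorem sw_nontrivial (hA : IsSweedler k A gA xA) : Nontrivial A :=
  ⟨1, 0, hA.li.ne_zero 0⟩

/-- Commuting images give a bialgebra map from the tensor product. -/
theorem exists_lift (i : A →ₐc[k] E) (j : B →ₐc[k] E) (hc : ∀ a c, Commute (i a) (j c)) :
    ∃ φ : A ⊗[k] B →ₐc[k] E, ⇑φ = canon i j := by
  let F : A ⊗[k] B →ₐ[k] E := Algebra.TensorProduct.lift (i : A →ₐ[k] E) (j : B →ₐ[k] E) hc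
  have hF : ∀ a c, F (a ⊗ₜ c) = i a * j c := fun a c =>
    Algebra.TensorProduct.lift_tmul _ _ _ a c
  have hi : ∀ a, Coalgebra.comul (R := k) (i a) =
      TensorProduct.map i.toLinearMap i.toLinearMap (Coalgebra.comul (R := k) a) := fun a =>
    (CoalgHomClass.map_comp_comul_apply i a).symm
  have hj : ∀ a, Coalgebra.comul (R := k) (j a) =
      TensorProduct.map j.toLinearMap j.toLinearMap (Coalgebra.comul (R := k) a) := fun a =>
    (CoalgHomClass.map_comp_comul_apply j a).symm
  refine ⟨BialgHom.ofAlgHom F ?_ ?_, ?_⟩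
  · apply Algebra.TensorProduct.ext'
    intro a c
    simp [hF, TensorProduct.counit_tmul]
    ring
  · apply Algebra.TensorProduct.ext'
    intro a c
    simp only [AlgHom.comp_apply, hF, Bialgebra.comulAlgHom_apply, Bialgebra.comul_mul, hi, hj,
      TensorProduct.comul_tmul]
    generalize Coalgebra.comul (R := k) a = u
    generalize Coalgebra.comul (R := k) c = v
    induction u with
    | zero => simp
    | add u1 u2 h1 h2 => simp only [TensorProduct.add_tmul, map_add, h1, h2, add_mul]
    | tmul a1 a2 =>
      induction v with
      | zero => simp
      | add u1 u2 h1 h2 => simp only [TensorProduct.tmul_add, map_add, h1, h2, mul_add]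
      | tmul c1 c2 =>
        simp [hF]
        rfl
  · ext z
    induction z with
    | zero => simp
    | add u1 u2 h1 h2 => simp only [map_add, h1, h2]
    | tmul a c => rw [canon_tmul]; exact hF a c

theorem exists_incl : ∃ (i : A →ₐc[k] A ⊗[k] B) (j : B →ₐc[k] A ⊗[k] B),
    (∀ a, i a = a ⊗ₜ 1) ∧ ∀ c, j c = 1 ⊗ₜ c := by
  refine ⟨BialgHom.ofAlgHom Algebra.TensorProduct.includeLeft ?_ ?_,
    BialgHom.ofAlgHom Algebra.TensorProduct.includeRight ?_ ?_, fun _ => rfl, fun _ => rfl⟩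
  · ext a; simp [TensorProduct.counit_tmul]
  · ext a
    simp only [AlgHom.comp_apply, Bialgebra.comulAlgHom_apply,
      Algebra.TensorProduct.includeLeft_apply, TensorProduct.comul_tmul, Bialgebra.comul_one]
    generalize Coalgebra.comul (R := k) a = u
    induction u with
    | zero => simp
    | add u1 u2 h1 h2 => simp only [TensorProduct.add_tmul, map_add, h1, h2]
    | tmul a1 a2 => simp [Algebra.TensorProduct.one_def]
  · ext a; simp [TensorProduct.counit_tmul]
  · ext a
    simp only [AlgHom.comp_apply, Bialgebra.comulAlgHom_apply,
      Algebra.TensorProduct.includeRight_apply, TensorProduct.comul_tmul, Bialgebra.comul_one]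
    generalize Coalgebra.comul (R := k) a = u
    induction u with
    | zero => simp
    | add u1 u2 h1 h2 => simp only [TensorProduct.tmul_add, map_add, h1, h2]
    | tmul a1 a2 => simp [Algebra.TensorProduct.one_def]

end Homs

end SweedlerFac

open SweedlerFac in
/-- Let `k` be a field of characteristic `≠ 2`, and let `A`, `B` be two copies of
Sweedler's Hopf algebra `H₄`.  A Hopf algebra `E` factorizes through `A` and `B` if and
only if `E ≅ H₄ ⊗ H₄` or `E ≅ 𝓗_{16, λ}` for some `λ ∈ k` (equivalently: `E` admits a
presentation as `𝓗_{16, λ}`). -/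
theorem factorizes_through_sweedler_iff
    {k : Type u} [Field k] (hchar : (2 : k) ≠ 0)
    {A : Type u} [Ring A] [HopfAlgebra k A] {gA xA : A} (hA : IsSweedler k A gA xA)
    {B : Type u} [Ring B] [HopfAlgebra k B] {gB xB : B} (hB : IsSweedler k B gB xB)
    {E : Type u} [Ring E] [HopfAlgebra k E] :
    FactorizesThrough k E A B ↔
      (Nonempty (E ≃ₐc[k] (A ⊗[k] B)) ∨
        ∃ (lam : k) (g x G X : E), IsH16 k E g x G X lam) := by
  have nA := sw_nontrivial hA
  have nB := sw_nontrivial hB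
  constructor
  · rintro ⟨i, j, -, -, hbij⟩
    change Function.Bijective (canon i j) at hbij
    let b := ((swBasis hA).tensorProduct (swBasis hB)).map
      (LinearEquiv.ofBijective (canon i j) hbij)
    have hb : ∀ p, b p = ![(1 : E), i gA, i xA, i gA * i xA] p.1 *
        ![(1 : E), j gB, j xB, j gB * j xB] p.2 := fun p => by
      rw [Module.Basis.map_apply, LinearEquiv.ofBijective_apply, canon_basis]
    have hG := (ofSweedler hA).map i
    have hg := (ofSweedler hB).map j
    obtain ⟨hc, ⟨h1, h2, h3⟩ | ⟨h1, h2, lam, h3⟩⟩ := relations hchar hG hg b hb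
    · left
      have hcomm : ∀ a c, Commute (i a) (j c) := by
        have : (LinearMap.mul k E).compl₁₂ i.toLinearMap j.toLinearMap =
            (LinearMap.mul k E).flip.compl₁₂ i.toLinearMap j.toLinearMap := by
          refine (swBasis hA).ext fun p => (swBasis hB).ext fun q => ?_
          change i _ * j _ = j _ * i _
          rw [swBasis_apply, swBasis_apply]
          change Commute _ _
          have c1 : Commute (i gA) (j gB) := hc.symm
          have c2 : Commute (i xA) (j gB) := h1.symm
          have c3 : Commute (i gA) (j xB) := h2.symm
          have c4 : Commute (i xA) (j xB) := h3.symm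
          have d1 := c1.mul_left c2
          have d2 := c3.mul_left c4
          fin_cases p <;> fin_cases q <;>
            simp [c1, c2, c3, c4, d1, d2, Commute.mul_right]
        exact fun a c => LinearMap.congr_fun₂ this a c
      obtain ⟨φ, hφ⟩ := exists_lift i j hcomm
      exact ⟨(BialgEquiv.ofBijective φ (by rw [hφ]; exact hbij)).symm⟩
    · right
      have hb' : ⇑b = fun p : Fin 4 × Fin 4 => ![(1 : E), i gA, i xA, i gA * i xA] p.1 *
        ![(1 : E), j gB, j xB, j gB * j xB] p.2 := funext hb
      exact ⟨lam, j gB, j xB, i gA, i xA,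
        { g_sq := hg.G_sq
          G_sq := hG.G_sq
          x_sq := hg.X_sq
          X_sq := hG.X_sq
          gx_eq := by rw [hg.XG, neg_neg]
          GX_eq := by rw [hG.XG, neg_neg]
          gG_comm := hc
          gX_anticomm := h1
          xG_anticomm := h2
          xX_rel := h3
          li := hb' ▸ b.linearIndependent
          span := hb' ▸ b.span_eq
          comul_g := hg.comul_G
          comul_G := hG.comul_G
          comul_x := hg.comul_X
          comul_X := hG.comul_X
          counit_g := hg.counit_G
          counit_G := hG.counit_G
          counit_x := hg.counit_X
          counit_X := hG.counit_X }⟩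
  · rintro (⟨⟨e⟩⟩ | ⟨lam, g, x, G, X, h⟩)
    · obtain ⟨i, j, hi, hj⟩ := exists_incl (k := k) (A := A) (B := B)
      have hbij : Function.Bijective (canon ((e.symm : A ⊗[k] B →ₐc[k] E).comp i)
          ((e.symm : A ⊗[k] B →ₐc[k] E).comp j)) := by
        have : ⇑(canon ((e.symm : A ⊗[k] B →ₐc[k] E).comp i)
          ((e.symm : A ⊗[k] B →ₐc[k] E).comp j)) = e.symm := by
          ext z
          induction z with
          | zero => simp
          | add u1 u2 h1 h2 => simp only [map_add, h1, h2]
          | tmul a c =>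
            rw [canon_tmul]
            change e.symm (i a) * e.symm (j c) = _
            rw [← map_mul, hi, hj, Algebra.TensorProduct.tmul_mul_tmul, mul_one, one_mul]
        rw [this]
        exact e.symm.bijective
      exact ⟨_, _, (inj_of_bij _ _ hbij.1).1, (inj_of_bij _ _ hbij.1).2, hbij⟩
    · have hG : Sw4 k G X := ⟨h.G_sq, h.X_sq, by rw [h.GX_eq, neg_neg], h.comul_G, h.comul_X,
        h.counit_G, h.counit_X⟩
      have hg : Sw4 k g x := ⟨h.g_sq, h.x_sq, by rw [h.gx_eq, neg_neg], h.comul_g, h.comul_x,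
        h.counit_g, h.counit_x⟩
      obtain ⟨i, rfl, rfl⟩ := exists_hom hA hG
      obtain ⟨j, rfl, rfl⟩ := exists_hom hB hg
      let b := Module.Basis.mk h.li h.span.ge
      have hbij : Function.Bijective (canon i j) := by
        have : canon i j = (((swBasis hA).tensorProduct (swBasis hB)).equiv b (Equiv.refl _)) := by
          refine ((swBasis hA).tensorProduct (swBasis hB)).ext fun p => ?_
          rw [canon_basis]
          simp [b]
        rw [this]
        exact LinearEquiv.bijective _
      exact ⟨_, _, (inj_of_bij _ _ hbij.1).1, (inj_of_bij _ _ hbij.1).2, hbij⟩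

end
end

section
/- Let k be a field of characteristic ≠ 2. The group Aut_Hopf(D(H_4)) of Hopf algebra automorphisms of the Drinfel'd double of Sweedler's Hopf algebra is isomorphic to the semidirect product k^* ⋊_f ℤ_2, where f : ℤ_2 → Aut(k^*) is the action f(1 + 2ℤ)(α) = α^{-1} for all α ∈ k^*. -/
open TensorProduct

noncomputable section

/-- The convolution product on the linear dual of a coalgebra:
`(F * F')(a) = Σ F(a₍₁₎) F'(a₍₂₎)`. -/
def conv (k : Type*) [CommRing k] {H : Type*} [AddCommGroup H] [Module k H] [Coalgebra k H]
    (F F' : Module.Dual k H) : Module.Dual k H :=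
  LinearMap.mul' k k ∘ₗ TensorProduct.map F F' ∘ₗ Coalgebra.comul (R := k)

/-- `D` is (a model of) the Drinfel'd double `D(H₄) = (H₄*)^cop ⋈ H₄` of Sweedler's Hopf
algebra `H₄` (given as `H` with generators `g`, `x` and dual basis `os, gs, xs, gxs` of
the basis `{1, g, x, gx}`).  The data consists of the two canonical factors: a morphism
of Hopf algebras `j : H₄ → D` and a linear map `i : (H₄*)^cop → D` which is an algebra
morphism for the convolution product and a coalgebra morphism for the co-opposite dual
coalgebra structure (expressed on the dual basis), such that multiplication
`(H₄*)^cop ⊗ H₄ → D`, `f ⊗ h ↦ i(f)j(h)` is bijective and the straightening relations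
`j(h) i(f) = Σ i(f(S⁻¹(h₍₃₎) · ? · h₍₁₎)) j(h₍₂₎)` of the Drinfel'd double hold
(written out on the basis `{1, g, x, gx}`, using `S⁻¹(1) = 1`, `S⁻¹(g) = g`,
`S⁻¹(x) = gx`, `S⁻¹(gx) = -x`). -/
structure DrinfeldDoubleStructure (k H D : Type*) [CommRing k] [Ring H] [HopfAlgebra k H]
    [Ring D] [HopfAlgebra k D] (g x : H) where
  i : Module.Dual k H →ₗ[k] D
  j : H →ₗ[k] D
  os : Module.Dual k H
  gs : Module.Dual k H
  xs : Module.Dual k H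
  gxs : Module.Dual k H
  /-- `os, gs, xs, gxs` is the dual basis of the basis `1, g, x, gx` of `H₄`. -/
  os_one : os 1 = 1
  os_g : os g = 0
  os_x : os x = 0
  os_gx : os (g * x) = 0
  gs_one : gs 1 = 0
  gs_g : gs g = 1
  gs_x : gs x = 0
  gs_gx : gs (g * x) = 0
  xs_one : xs 1 = 0
  xs_g : xs g = 0
  xs_x : xs x = 1
  xs_gx : xs (g * x) = 0
  gxs_one : gxs 1 = 0
  gxs_g : gxs g = 0
  gxs_x : gxs x = 0
  gxs_gx : gxs (g * x) = 1
  /-- `j` is a morphism of Hopf algebras (of bialgebras). -/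
  j_one : j 1 = 1
  j_mul : ∀ a b : H, j (a * b) = j a * j b
  counit_j : ∀ h : H, Coalgebra.counit (R := k) (j h) = Coalgebra.counit (R := k) h
  comul_j_g : Coalgebra.comul (R := k) (j g) = j g ⊗ₜ[k] j g
  comul_j_x : Coalgebra.comul (R := k) (j x) = j x ⊗ₜ[k] (1 : D) + j g ⊗ₜ[k] j x
  comul_j_gx : Coalgebra.comul (R := k) (j (g * x)) =
    j (g * x) ⊗ₜ[k] j g + (1 : D) ⊗ₜ[k] j (g * x)
  /-- `i` is an algebra morphism from the convolution algebra `H₄*`. -/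
  i_one : i (Coalgebra.counit (R := k)) = 1
  i_mul : ∀ F F' : Module.Dual k H, i (conv k F F') = i F * i F'
  /-- `i` is a coalgebra morphism from the co-opposite dual coalgebra `(H₄*)^cop`,
  expressed on the dual basis. -/
  counit_i : ∀ F : Module.Dual k H, Coalgebra.counit (R := k) (i F) = F 1
  comul_i_os : Coalgebra.comul (R := k) (i os) = i os ⊗ₜ[k] i os + i gs ⊗ₜ[k] i gs
  comul_i_gs : Coalgebra.comul (R := k) (i gs) = i os ⊗ₜ[k] i gs + i gs ⊗ₜ[k] i os
  comul_i_xs : Coalgebra.comul (R := k) (i xs) =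
    i xs ⊗ₜ[k] i os + i os ⊗ₜ[k] i xs + i gxs ⊗ₜ[k] i gs - i gs ⊗ₜ[k] i gxs
  comul_i_gxs : Coalgebra.comul (R := k) (i gxs) =
    i gxs ⊗ₜ[k] i os + i os ⊗ₜ[k] i gxs + i xs ⊗ₜ[k] i gs - i gs ⊗ₜ[k] i xs
  /-- `D` factorizes through `(H₄*)^cop` and `H₄`. -/
  factor : Function.Bijective (LinearMap.mul' k D ∘ₗ TensorProduct.map i j)
  /-- Straightening relations of the Drinfel'd double on the basis `{1, g, x, gx}`. -/
  straight_g : ∀ F : Module.Dual k H,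
    j g * i F = i (F ∘ₗ (LinearMap.mulRight k g ∘ₗ LinearMap.mulLeft k g)) * j g
  straight_x : ∀ F : Module.Dual k H,
    j x * i F = i (F ∘ₗ LinearMap.mulRight k x)
      + i (F ∘ₗ LinearMap.mulRight k g) * j x
      + i (F ∘ₗ (LinearMap.mulRight k g ∘ₗ LinearMap.mulLeft k (g * x))) * j g
  straight_gx : ∀ F : Module.Dual k H,
    j (g * x) * i F = i (F ∘ₗ (LinearMap.mulRight k (g * x) ∘ₗ LinearMap.mulLeft k g)) * j g
      + i (F ∘ₗ LinearMap.mulLeft k g) * j (g * x)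
      - i (F ∘ₗ LinearMap.mulLeft k x)

/-- The action of `ℤ₂ = Multiplicative (ZMod 2)` on `kˣ` by inversion,
`f(1 + 2ℤ)(α) = α⁻¹`. -/
def inversionAction (k : Type*) [Field k] :
    Multiplicative (ZMod 2) →* MulAut kˣ where
  toFun z := if Multiplicative.toAdd z = 0 then 1 else MulEquiv.inv kˣ
  map_one' := by simp
  map_mul' := by
    intro a b
    have h : ∀ z : ZMod 2, z = 0 ∨ z = 1 := by decide
    have key : (MulEquiv.inv kˣ) * (MulEquiv.inv kˣ) = 1 := by
      ext u; simp [MulAut.mul_apply]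
    rcases h (Multiplicative.toAdd a) with ha | ha <;>
      rcases h (Multiplicative.toAdd b) with hb | hb <;>
        simp [toAdd_mul, ha, hb, key, show (1 + 1 : ZMod 2) = 0 from by decide]

/-- The action of `ℤ₂ = Multiplicative (ZMod 2)` on `kˣ × kˣ` by swapping the factors,
`g(1 + 2ℤ)(α, β) = (β, α)`. -/
def swapAction (k : Type*) [Field k] :
    Multiplicative (ZMod 2) →* MulAut (kˣ × kˣ) where
  toFun z := if Multiplicative.toAdd z = 0 then 1
    else (MulEquiv.prodComm : (kˣ × kˣ) ≃* (kˣ × kˣ))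
  map_one' := by simp
  map_mul' := by
    intro a b
    have h : ∀ z : ZMod 2, z = 0 ∨ z = 1 := by decide
    have key : ((MulEquiv.prodComm : (kˣ × kˣ) ≃* (kˣ × kˣ))) *
        ((MulEquiv.prodComm : (kˣ × kˣ) ≃* (kˣ × kˣ))) = 1 := by
      ext u <;> simp [MulAut.mul_apply]
    rcases h (Multiplicative.toAdd a) with ha | ha <;>
      rcases h (Multiplicative.toAdd b) with hb | hb <;>
        simp [toAdd_mul, ha, hb, key, show (1 + 1 : ZMod 2) = 0 from by decide]

set_option linter.unusedSimpArgs false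

structure DRel {A : Type*} [Ring A] (G X g x : A) : Prop where
  GG : G * G = 1
  XX : X * X = 0
  XG : X * G = -(G * X)
  gg : g * g = 1
  xx : x * x = 0
  xg : x * g = -(g * x)
  gG : g * G = G * g
  gX : g * X = -(X * g)
  xG : x * G = -(G * x)
  xX : x * X = 1 - G * g - X * x

theorem mul_rel_assoc {A : Type*} [Ring A] {a b c : A} (h : a * b = c) (t : A) :
    a * (b * t) = c * t := by rw [← mul_assoc, h]

theorem DRel.swap {A : Type*} [Ring A] {G X g x : A} (h : DRel G X g x) : DRel g x G X where
  GG := h.gg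
  XX := h.xx
  XG := h.xg
  gg := h.GG
  xx := h.XX
  xg := h.XG
  gG := h.gG.symm
  gX := by rw [h.xG, neg_neg]
  xG := by rw [h.gX, neg_neg]
  xX := by rw [h.xX, h.gG]; abel

theorem DRel.scale {k A : Type*} [Field k] [Ring A] [Algebra k A] {G X g x : A}
    (h : DRel G X g x) {α β : k} (hab : β * α = 1) : DRel G (α • X) g (β • x) where
  GG := h.GG
  XX := by simp [h.XX]
  XG := by simp [h.XG]
  gg := h.gg
  xx := by simp [h.xx]
  xg := by simp [h.xg]
  gG := h.gG
  gX := by simp [h.gX]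
  xG := by simp [h.xG]
  xX := by
    have hba : α * β = 1 := by rw [mul_comm, hab]
    simp [h.xX, smul_smul, hab, hba]

structure DDat (k : Type*) {D : Type*} [Field k] [Ring D] [HopfAlgebra k D] (G X g x : D) where
  rel : DRel G X g x
  cG : Coalgebra.comul (R := k) G = G ⊗ₜ[k] G
  cX : Coalgebra.comul (R := k) X = X ⊗ₜ[k] (1 : D) + G ⊗ₜ[k] X
  cg : Coalgebra.comul (R := k) g = g ⊗ₜ[k] g
  cx : Coalgebra.comul (R := k) x = x ⊗ₜ[k] (1 : D) + g ⊗ₜ[k] x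
  eG : Coalgebra.counit (R := k) G = 1
  eX : Coalgebra.counit (R := k) X = 0
  eg : Coalgebra.counit (R := k) g = 1
  ex : Coalgebra.counit (R := k) x = 0
  b : Module.Basis (Fin 4 × Fin 4) k D
  hb : ∀ p q, b (p, q) = ![1, G, X, G * X] p * ![1, g, x, g * x] q

namespace DDat

variable {k D : Type*} [Field k] [Ring D] [HopfAlgebra k D] {G X g x : D}

theorem lin_ext {M : Type*} [AddCommGroup M] [Module k M] (d : DDat k G X g x) {φ ψ : D →ₗ[k] M}
    (h : ∀ p q, φ (![1, G, X, G * X] p * ![1, g, x, g * x] q)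
      = ψ (![1, G, X, G * X] p * ![1, g, x, g * x] q)) : φ = ψ :=
  d.b.ext fun ⟨p, q⟩ => by rw [d.hb]; exact h p q

theorem alg_ext {A : Type*} [Ring A] [Algebra k A] (d : DDat k G X g x) {φ ψ : D →ₐ[k] A}
    (hG : φ G = ψ G) (hX : φ X = ψ X) (hg : φ g = ψ g) (hx : φ x = ψ x) : φ = ψ := by
  have : φ.toLinearMap = ψ.toLinearMap := by
    apply d.lin_ext
    intro p q
    fin_cases p <;> fin_cases q <;> simp [hG, hX, hg, hx]
  exact AlgHom.toLinearMap_injective this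

set_option maxHeartbeats 4000000 in
theorem lift {A : Type*} [Ring A] [Algebra k A] (d : DDat k G X g x) {G' X' g' x' : A}
    (r : DRel G' X' g' x') : ∃ φ : D →ₐ[k] A, φ G = G' ∧ φ X = X' ∧ φ g = g' ∧ φ x = x' := by
  let φ : D →ₗ[k] A := d.b.constr k
    fun pq => ![1, G', X', G' * X'] pq.1 * ![1, g', x', g' * x'] pq.2
  have hφ : ∀ p q, φ (![1, G, X, G * X] p * ![1, g, x, g * x] q)
      = ![1, G', X', G' * X'] p * ![1, g', x', g' * x'] q := by
    intro p q
    rw [← d.hb]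
    simp [φ]
  clear_value φ
  have h00 := hφ 0 0
  have h01 := hφ 0 1
  have h02 := hφ 0 2
  have h03 := hφ 0 3
  have h10 := hφ 1 0
  have h11 := hφ 1 1
  have h12 := hφ 1 2
  have h13 := hφ 1 3
  have h20 := hφ 2 0
  have h21 := hφ 2 1
  have h22 := hφ 2 2
  have h23 := hφ 2 3
  have h30 := hφ 3 0
  have h31 := hφ 3 1
  have h32 := hφ 3 2
  have h33 := hφ 3 3
  simp [mul_assoc] at h00 h01 h02 h03 h10 h11 h12 h13 h20 h21 h22 h23 h30 h31 h32 h33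
  obtain ⟨GG, XX, XG, gg, xx, xg, gG, gX, xG, xX⟩ := d.rel
  obtain ⟨GG', XX', XG', gg', xx', xg', gG', gX', xG', xX'⟩ := r
  have key : ∀ s ∈ ({G, X, g, x} : Set D), ∀ t, φ (s * t) = φ s * φ t := by
    intro s hs t
    have : φ ∘ₗ LinearMap.mulLeft k s = LinearMap.mulLeft k (φ s) ∘ₗ φ := by
      apply d.lin_ext
      intro p q
      simp only [LinearMap.comp_apply, LinearMap.mulLeft_apply]
      have a1 := mul_rel_assoc GG
      have a2 := mul_rel_assoc XX
      have a3 := mul_rel_assoc XG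
      have a4 := mul_rel_assoc gg
      have a5 := mul_rel_assoc xx
      have a6 := mul_rel_assoc xg
      have a7 := mul_rel_assoc gG
      have a8 := mul_rel_assoc gX
      have a9 := mul_rel_assoc xG
      have a10 := mul_rel_assoc xX
      have b1 := mul_rel_assoc GG'
      have b2 := mul_rel_assoc XX'
      have b3 := mul_rel_assoc XG'
      have b4 := mul_rel_assoc gg'
      have b5 := mul_rel_assoc xx'
      have b6 := mul_rel_assoc xg'
      have b7 := mul_rel_assoc gG'
      have b8 := mul_rel_assoc gX'
      have b9 := mul_rel_assoc xG'
      have b10 := mul_rel_assoc xX'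
      rcases hs with rfl | rfl | rfl | rfl <;> fin_cases p <;> fin_cases q <;>
        simp [mul_assoc, sub_mul, mul_sub, mul_add, *]
    exact congrArg (fun f => f t) this
  have hprod : ∀ s t, (∀ u, φ (s * u) = φ s * φ u) → (∀ u, φ (t * u) = φ t * φ u) →
      ∀ u, φ (s * t * u) = φ (s * t) * φ u := by
    intro s t h1 h2 u
    rw [mul_assoc, h1, h2, h1, mul_assoc]
  have h1 : ∀ u, φ (1 * u) = φ 1 * φ u := by intro u; simp [h00]
  have kG := key G (by simp)
  have kX := key X (by simp)
  have kg := key g (by simp)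
  have kx := key x (by simp)
  have hmul : ∀ s t, φ (s * t) = φ s * φ t := by
    intro s t
    have : φ ∘ₗ LinearMap.mulRight k t = LinearMap.mulRight k (φ t) ∘ₗ φ := by
      apply d.lin_ext
      intro p q
      simp only [LinearMap.comp_apply, LinearMap.mulRight_apply]
      apply hprod
      · fin_cases p
        exacts [h1, kG, kX, hprod _ _ kG kX]
      · fin_cases q
        exacts [h1, kg, kx, hprod _ _ kg kx]
    exact congrArg (fun f => f s) this
  exact ⟨AlgHom.ofLinearMap φ h00 hmul, h10, h20, h01, h02⟩

/-- swapping -/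
theorem exists_hom (d : DDat k G X g x) {G' X' g' x' : D} (d' : DRel G' X' g' x')
    (cG : Coalgebra.comul (R := k) G' = G' ⊗ₜ[k] G')
    (cX : Coalgebra.comul (R := k) X' = X' ⊗ₜ[k] (1 : D) + G' ⊗ₜ[k] X')
    (cg : Coalgebra.comul (R := k) g' = g' ⊗ₜ[k] g')
    (cx : Coalgebra.comul (R := k) x' = x' ⊗ₜ[k] (1 : D) + g' ⊗ₜ[k] x')
    (eG : Coalgebra.counit (R := k) G' = 1)
    (eX : Coalgebra.counit (R := k) X' = 0)
    (eg : Coalgebra.counit (R := k) g' = 1)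
    (ex : Coalgebra.counit (R := k) x' = 0) :
    ∃ φ : D →ₐc[k] D, φ G = G' ∧ φ X = X' ∧ φ g = g' ∧ φ x = x' := by
  obtain ⟨φ, h1, h2, h3, h4⟩ := d.lift d'
  refine ⟨BialgHom.ofAlgHom φ ?_ ?_, h1, h2, h3, h4⟩
  · apply d.alg_ext <;>
      simp [h1, h2, h3, h4, eG, eX, eg, ex, d.eG, d.eX, d.eg, d.ex]
  · apply d.alg_ext <;>
      simp [h1, h2, h3, h4, cG, cX, cg, cx, d.cG, d.cX, d.cg, d.cx]

theorem bialg_ext (d : DDat k G X g x) {φ ψ : D →ₐc[k] D}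
    (hG : φ G = ψ G) (hX : φ X = ψ X) (hg : φ g = ψ g) (hx : φ x = ψ x) : φ = ψ := by
  have : (φ : D →ₐ[k] D) = ψ := d.alg_ext hG hX hg hx
  ext t
  exact congrArg (fun f : D →ₐ[k] D => f t) this

theorem equiv_ext (d : DDat k G X g x) {φ ψ : D ≃ₐc[k] D}
    (hG : φ G = ψ G) (hX : φ X = ψ X) (hg : φ g = ψ g) (hx : φ x = ψ x) : φ = ψ := by
  have : (φ : D →ₐc[k] D) = ψ := d.bialg_ext hG hX hg hx
  ext t
  exact congrArg (fun f : D →ₐc[k] D => f t) this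

theorem exists_scale (d : DDat k G X g x) (α : kˣ) :
    ∃ φ : D ≃ₐc[k] D, φ G = G ∧ φ X = (α⁻¹ : kˣ) • X ∧ φ g = g ∧ φ x = α • x := by
  have key : ∀ α : kˣ, ∃ φ : D →ₐc[k] D, 
      φ G = G ∧ φ X = ((α⁻¹ : kˣ) : k) • X ∧ φ g = g ∧ φ x = (α : k) • x := by
    intro α
    apply d.exists_hom (d.rel.scale (by simp))
    · exact d.cG
    · simp [d.cX, TensorProduct.smul_tmul']
    · exact d.cg
    · simp [d.cx, TensorProduct.smul_tmul']
    · exact d.eG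
    · simp [d.eX]
    · exact d.eg
    · simp [d.ex]
  obtain ⟨φ, h1, h2, h3, h4⟩ := key α
  obtain ⟨ψ, h1', h2', h3', h4'⟩ := key α⁻¹
  refine ⟨BialgEquiv.ofBialgHom φ ψ ?_ ?_, h1, h2, h3, h4⟩ <;>
  · apply d.bialg_ext <;> simp [h1, h2, h3, h4, h1', h2', h3', h4', smul_smul]

theorem exists_swap (d : DDat k G X g x) :
    ∃ φ : D ≃ₐc[k] D, φ G = g ∧ φ X = x ∧ φ g = G ∧ φ x = X := by
  obtain ⟨φ, h1, h2, h3, h4⟩ :=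
    d.exists_hom d.rel.swap d.cg d.cx d.cG d.cX d.eg d.ex d.eG d.eX
  refine ⟨BialgEquiv.ofBialgHom φ φ ?_ ?_, h1, h2, h3, h4⟩ <;>
  · apply d.bialg_ext <;> simp [h1, h2, h3, h4]

def dd (k : Type*) [Field k] (a m n : Fin 4) : k :=
  if (a = 0 ∧ m = 0 ∧ n = 0) ∨ (a = 1 ∧ m = 1 ∧ n = 1) ∨ (a = 2 ∧ m = 2 ∧ n = 0) ∨
    (a = 2 ∧ m = 1 ∧ n = 2) ∨ (a = 3 ∧ m = 3 ∧ n = 1) ∨ (a = 3 ∧ m = 0 ∧ n = 3) then 1 else 0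

theorem comul_aux {G X : D} (cG : Coalgebra.comul (R := k) G = G ⊗ₜ[k] G)
    (cX : Coalgebra.comul (R := k) X = X ⊗ₜ[k] (1 : D) + G ⊗ₜ[k] X) (hGG : G * G = 1) (a : Fin 4) :
    Coalgebra.comul (R := k) (![1, G, X, G * X] a) =
      ∑ p : Fin 4 × Fin 4, dd k a p.1 p.2 •
        (![1, G, X, G * X] p.1 ⊗ₜ[k] ![1, G, X, G * X] p.2) := by
  rw [Fintype.sum_prod_type]
  fin_cases a <;> simp [Fin.sum_univ_four, dd, cG, cX, mul_add, hGG,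
    Algebra.TensorProduct.one_def, add_comm]

theorem comul_basis (d : DDat k G X g x) (a b : Fin 4) :
    Coalgebra.comul (R := k) (d.b (a, b)) =
      ∑ p : (Fin 4 × Fin 4) × (Fin 4 × Fin 4), (dd k a p.1.1 p.2.1 * dd k b p.1.2 p.2.2) •
        (d.b.tensorProduct d.b) p := by
  rw [d.hb, Bialgebra.comul_mul, comul_aux d.cG d.cX d.rel.GG, comul_aux d.cg d.cx d.rel.gg,
    Finset.sum_mul_sum, ← Fintype.sum_prod_type']
  refine Fintype.sum_equiv (Equiv.prodProdProdComm _ _ _ _) _ _ ?_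
  rintro ⟨⟨m1, n1⟩, ⟨m2, n2⟩⟩
  simp [d.hb, smul_smul, mul_comm]

theorem coef (d : DDat k G X g x) (y : D) (m n : Fin 4 × Fin 4) :
    (d.b.tensorProduct d.b).repr (Coalgebra.comul (R := k) y) (m, n) =
      ∑ a, ∑ b, d.b.repr y (a, b) * (dd k a m.1 n.1 * dd k b m.2 n.2) := by
  conv_lhs => rw [← d.b.sum_repr y]
  rw [map_sum, map_sum, Finsupp.finsetSum_apply, Fintype.sum_prod_type]
  refine Finset.sum_congr rfl fun a _ => Finset.sum_congr rfl fun b _ => ?_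
  rw [map_smul, map_smul, Finsupp.smul_apply, d.comul_basis, Module.Basis.repr_sum_self]
  simp

theorem expand (d : DDat k G X g x) (y : D) :
    y = ∑ a, ∑ b, d.b.repr y (a, b) • (![1, G, X, G * X] a * ![1, g, x, g * x] b) := by
  conv_lhs => rw [← d.b.sum_repr y]
  rw [Fintype.sum_prod_type]
  simp [d.hb]

theorem grouplike (d : DDat k G X g x) (h : D) (e : Coalgebra.counit (R := k) h = 1)
    (c : Coalgebra.comul (R := k) h = h ⊗ₜ[k] h) : h = 1 ∨ h = g ∨ h = G ∨ h = G * g := by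
  have key : ∀ m n : Fin 4 × Fin 4, d.b.repr h n * d.b.repr h m =
      ∑ a, ∑ b, d.b.repr h (a, b) * (dd k a m.1 n.1 * dd k b m.2 n.2) := by
    intro m n
    rw [← d.coef, c]; simp
  have z : ∀ m : Fin 4 × Fin 4, (m.1 = 2 ∨ m.1 = 3 ∨ m.2 = 2 ∨ m.2 = 3) → d.b.repr h m = 0 := by
    rintro ⟨m, n⟩ hm
    have := key (m, n) (m, n)
    rcases hm with hm | hm | hm | hm <;> simp only at hm <;> subst hm <;>
      simpa [dd] using this
  have h20 := z (2, 0) (by simp)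
  have h21 := z (2, 1) (by simp)
  have h22 := z (2, 2) (by simp)
  have h23 := z (2, 3) (by simp)
  have h30 := z (3, 0) (by simp)
  have h31 := z (3, 1) (by simp)
  have h32 := z (3, 2) (by simp)
  have h33 := z (3, 3) (by simp)
  have h02 := z (0, 2) (by simp)
  have h03 := z (0, 3) (by simp)
  have h12 := z (1, 2) (by simp)
  have h13 := z (1, 3) (by simp)
  have ex := d.expand h
  simp [Fin.sum_univ_four, *] at ex
  have e' := e
  rw [ex] at e'
  simp [d.eG, d.eg] at e'
  have c1 := key (0, 0) (0, 1)
  have c2 := key (0, 0) (1, 0)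
  have c3 := key (0, 0) (1, 1)
  have c4 := key (0, 1) (1, 0)
  have c5 := key (0, 1) (1, 1)
  have c6 := key (1, 0) (1, 1)
  simp [dd] at c1 c2 c3 c4 c5 c6
  clear key z e c
  generalize d.b.repr h (0, 0) = p at *
  generalize d.b.repr h (0, 1) = q at *
  generalize d.b.repr h (1, 0) = r at *
  generalize d.b.repr h (1, 1) = s at *
  by_cases hp : p = 0
  · by_cases hq : q = 0
    · by_cases hr : r = 0
      · subst hp hq hr
        simp at e'
        right; right; right
        rw [ex]; simp [e']
      · have hs : s = 0 := by tauto
        subst hp hq hs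
        simp at e'
        right; right; left
        rw [ex]; simp [e']
    · have hs : s = 0 := by tauto
      have hr : r = 0 := by tauto
      subst hp hr hs
      simp at e'
      right; left
      rw [ex]; simp [e']
  · have hs : s = 0 := by tauto
    have hr : r = 0 := by tauto
    have hq : q = 0 := by tauto
    subst hq hr hs
    simp at e'
    left
    rw [ex]; simp [e']

theorem skew (d : DDat k G X g x) (h y : D) 
    (c : Coalgebra.comul (R := k) y = y ⊗ₜ[k] (1 : D) + h ⊗ₜ[k] y)
    (p q : Fin 4) (hp : p = 0 ∨ p = 1) (hq : q = 0 ∨ q = 1)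
    (hh : h = d.b (p, q)) :
    ∃ c0 c1 c2 c3 s t : k, y = c0 • 1 + c1 • g + c2 • G + c3 • (G * g) + s • x + t • X ∧
      (s ≠ 0 → p = 0 ∧ q = 1) ∧ (t ≠ 0 → p = 1 ∧ q = 0) := by
  have one : (1 : D) = d.b (0, 0) := by simp [d.hb]
  have key : ∀ m n : Fin 4 × Fin 4, (if (0, 0) = n then d.b.repr y m else 0) +
      d.b.repr y n * (if (p, q) = m then 1 else 0) =
      ∑ a, ∑ b, d.b.repr y (a, b) * (dd k a m.1 n.1 * dd k b m.2 n.2) := by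
    intro m n
    rw [← d.coef, c, hh, one]; simp [Finsupp.single_apply]
  have p2 : p ≠ 2 := by rcases hp with rfl | rfl <;> decide
  have p3 : p ≠ 3 := by rcases hp with rfl | rfl <;> decide
  have q2 : q ≠ 2 := by rcases hq with rfl | rfl <;> decide
  have q3 : q ≠ 3 := by rcases hq with rfl | rfl <;> decide
  have h22 := key (2, 1) (0, 2)
  have h23 := key (2, 0) (0, 3)
  have h32 := key (3, 1) (1, 2)
  have h33 := key (3, 0) (1, 3)
  have h21 := key (2, 1) (0, 1)
  have h30 := key (3, 0) (1, 0)
  have h31 := key (3, 1) (1, 1)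
  have h12 := key (1, 2) (1, 0)
  have h03 := key (0, 3) (0, 1)
  have h13 := key (1, 3) (1, 1)
  have h20 := key (1, 0) (2, 0)
  have h02 := key (0, 1) (0, 2)
  simp [dd, Fin.sum_univ_four, p2, p3, q2, q3]
    at h22 h23 h32 h33 h21 h30 h31 h12 h03 h13 h20 h02
  have ex := d.expand y
  simp [Fin.sum_univ_four, ← h22, ← h23, ← h32, ← h33, ← h21, ← h30, ← h31, ← h12, ← h03, ← h13]
    at ex
  refine ⟨d.b.repr y (0, 0), d.b.repr y (0, 1), d.b.repr y (1, 0), d.b.repr y (1, 1),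
    d.b.repr y (0, 2), d.b.repr y (2, 0), ?_, ?_, ?_⟩
  · conv_lhs => rw [ex]
    abel
  · intro hne
    tauto
  · intro hne
    tauto

theorem classify (d : DDat k G X g x) (h2 : (2 : k) ≠ 0) (h y : D) 
    (e : Coalgebra.counit (R := k) h = 1)
    (ch : Coalgebra.comul (R := k) h = h ⊗ₜ[k] h) 
    (c : Coalgebra.comul (R := k) y = y ⊗ₜ[k] (1 : D) + h ⊗ₜ[k] y)
    (hy : y * h = -(h * y)) (hhh : h * h = 1) (y0 : y ≠ 0) :
    (h = g ∧ ∃ α : k, y = α • x) ∨ (h = G ∧ ∃ α : k, y = α • X) := by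
  have hh : ∃ p q : Fin 4, (p = 0 ∨ p = 1) ∧ (q = 0 ∨ q = 1) ∧ h = d.b (p, q) := by
    rcases d.grouplike h e ch with rfl | rfl | rfl | rfl
    · exact ⟨0, 0, by simp [d.hb]⟩
    · exact ⟨0, 1, by simp [d.hb]⟩
    · exact ⟨1, 0, by simp [d.hb]⟩
    · exact ⟨1, 1, by simp [d.hb]⟩
  obtain ⟨p, q, hp, hq, hh⟩ := hh
  obtain ⟨c0, c1, c2, c3, s, t, hyy, hs, ht⟩ := d.skew h y c p q hp hq hh
  have gG := d.rel.gG
  -- the group part commutes with `h`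
  have comm : ∀ z : D, z * h = h * z → ∀ v : D, v * h = -(h * v) → y = z + v → z = 0 := by
    intro z hz v hv hzv
    rw [hzv, add_mul, mul_add, hz, hv, neg_add] at hy
    have h3 : h * z = -(h * z) := add_right_cancel hy
    have h4 : (2 : k) • (h * z) = 0 := by
      rw [two_smul]; nth_rewrite 1 [h3]; simp
    have h5 : h * z = 0 := (smul_eq_zero.1 h4).resolve_left h2
    calc z = h * h * z := by rw [hhh, one_mul]
      _ = 0 := by rw [mul_assoc, h5, mul_zero]
  have hgrp : h * g = g * h ∧ h * G = G * h := by
    rw [hh, d.hb]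
    rcases hp with rfl | rfl <;> rcases hq with rfl | rfl <;>
      simp [mul_assoc, gG, mul_rel_assoc d.rel.gG, mul_rel_assoc d.rel.GG]
  have hz : (c0 • 1 + c1 • g + c2 • G + c3 • (G * g)) * h =
      h * (c0 • 1 + c1 • g + c2 • G + c3 • (G * g)) := by
    have : h * (G * g) = G * g * h := by
      rw [← mul_assoc, hgrp.2, mul_assoc, hgrp.1, mul_assoc]
    simp [add_mul, mul_add, hgrp.1, hgrp.2, this]
  have hsx : s • x * h = - (h * (s • x)) := by
    by_cases s0 : s = 0
    · simp [s0]
    · obtain ⟨rfl, rfl⟩ := hs s0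
      rw [hh]; simp [d.hb, d.rel.xg]
  have htX : t • X * h = - (h * (t • X)) := by
    by_cases t0 : t = 0
    · simp [t0]
    · obtain ⟨rfl, rfl⟩ := ht t0
      rw [hh]; simp [d.hb, d.rel.XG]
  have hz0 := comm _ hz (s • x + t • X) (by rw [add_mul, mul_add, hsx, htX, neg_add])
    (by rw [hyy]; abel)
  rw [hz0, zero_add] at hyy
  by_cases s0 : s = 0
  · by_cases t0 : t = 0
    · simp [s0, t0] at hyy; exact absurd hyy y0
    · obtain ⟨rfl, rfl⟩ := ht t0
      right
      exact ⟨by simp [hh, d.hb], t, by simpa [s0] using hyy⟩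
  · obtain ⟨rfl, rfl⟩ := hs s0
    have t0 : t = 0 := by
      by_contra t0
      simpa using ht t0
    left
    exact ⟨by simp [hh, d.hb], s, by simpa [t0] using hyy⟩

theorem ne_zero_basis (d : DDat k G X g x) : X ≠ 0 ∧ x ≠ 0 ∧ g ≠ G ∧ 1 - G * g ≠ 0 := by
  have h20 := d.hb 2 0
  have h02 := d.hb 0 2
  have h10 := d.hb 1 0
  have h01 := d.hb 0 1
  have h11 := d.hb 1 1
  have h00 := d.hb 0 0
  simp at h20 h02 h10 h01 h11 h00
  refine ⟨?_, ?_, ?_, ?_⟩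
  · rw [← h20]; exact d.b.ne_zero _
  · rw [← h02]; exact d.b.ne_zero _
  · intro h
    have := d.b.injective (h01.trans (h.trans h10.symm))
    simp at this
  · rw [sub_ne_zero]
    intro h
    have := d.b.injective (h00.trans (h.trans h11.symm))
    simp at this

theorem classify_aut (d : DDat k G X g x) (h2 : (2 : k) ≠ 0) (φ : D ≃ₐc[k] D) :
    ∃ α : kˣ, (φ G = G ∧ φ X = (α⁻¹ : kˣ) • X ∧ φ g = g ∧ φ x = α • x) ∨
      (φ G = g ∧ φ X = α • x ∧ φ g = G ∧ φ x = (α⁻¹ : kˣ) • X) := by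
  obtain ⟨X0, x0, gG, hne⟩ := d.ne_zero_basis
  have inj : Function.Injective φ := EquivLike.injective φ
  have hcom : ∀ t, Coalgebra.comul (R := k) (φ t) =
      TensorProduct.map (φ : D →ₗ[k] D) (φ : D →ₗ[k] D) (Coalgebra.comul (R := k) t) := fun t =>
    (CoalgHomClass.map_comp_comul_apply φ t).symm
  have hcou : ∀ t, Coalgebra.counit (R := k) (φ t) = Coalgebra.counit (R := k) t := fun t =>
    CoalgHomClass.counit_comp_apply φ t
  have A := d.classify h2 (φ g) (φ x) (by rw [hcou, d.eg]) (by rw [hcom, d.cg]; simp)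
    (by rw [hcom, d.cx]; simp) (by rw [← map_mul, d.rel.xg, map_neg, map_mul])
    (by rw [← map_mul, d.rel.gg, map_one])
    (by intro h; apply x0; apply inj; rw [h, map_zero])
  have B := d.classify h2 (φ G) (φ X) (by rw [hcou, d.eG]) (by rw [hcom, d.cG]; simp)
    (by rw [hcom, d.cX]; simp) (by rw [← map_mul, d.rel.XG, map_neg, map_mul])
    (by rw [← map_mul, d.rel.GG, map_one])
    (by intro h; apply X0; apply inj; rw [h, map_zero])
  have R := congrArg φ d.rel.xX
  simp only [map_mul, map_sub, map_one] at R
  have R2 : x * X + X * x = 1 - G * g := by rw [d.rel.xX]; abel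
  have R3 := d.rel.gG
  rcases A with ⟨a1, α, a2⟩ | ⟨a1, α, a2⟩ <;> rcases B with ⟨b1, β, b2⟩ | ⟨b1, β, b2⟩
  · exact absurd (inj (a1.trans b1.symm)) gG
  · rw [a1, a2, b1, b2] at R
    have R' : (α * β) • (1 - G * g) = 1 - G * g := by
      have : α • x * β • X + β • X * α • x = 1 - G * g := by rw [R]; abel
      refine Eq.trans ?_ this
      rw [← R2]
      simp [smul_smul, mul_comm β α]
    have hab : α * β = 1 := by
      have : (α * β - 1) • (1 - G * g) = 0 := by rw [sub_smul, R', one_smul, sub_self]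
      exact sub_eq_zero.1 ((smul_eq_zero.1 this).resolve_right hne)
    refine ⟨⟨α, β, hab, by rw [mul_comm, hab]⟩, Or.inl ⟨b1, b2, a1, a2⟩⟩
  · rw [a1, a2, b1, b2] at R
    have R' : (α * β) • (1 - G * g) = 1 - G * g := by
      have : α • X * β • x + β • x * α • X = 1 - G * g := by rw [R, R3]; abel
      refine Eq.trans ?_ this
      rw [← R2]
      simp [smul_smul, mul_comm β α, add_comm]
    have hab : α * β = 1 := by
      have : (α * β - 1) • (1 - G * g) = 0 := by rw [sub_smul, R', one_smul, sub_self]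
      exact sub_eq_zero.1 ((smul_eq_zero.1 this).resolve_right hne)
    refine ⟨⟨β, α, by rw [mul_comm, hab], hab⟩, Or.inr ⟨b1, b2, a1, a2⟩⟩
  · exact absurd (inj (a1.trans b1.symm)) gG

theorem main (d : DDat k G X g x) (h2 : (2 : k) ≠ 0) :
    ∃ Γ : (kˣ ⋊[inversionAction k] Multiplicative (ZMod 2)) → (D ≃ₐc[k] D),
      Function.Bijective Γ ∧ ∀ u v, Γ (u * v) = (Γ v).trans (Γ u) := by
  obtain ⟨X0, x0, gG, hne⟩ := d.ne_zero_basis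
  choose S S1 S2 S3 S4 using d.exists_scale
  obtain ⟨σ, σ1, σ2, σ3, σ4⟩ := d.exists_swap
  have h01 : ∀ z : Multiplicative (ZMod 2), z = 1 ∨ z = Multiplicative.ofAdd 1 := by decide
  have hn : Multiplicative.ofAdd (1 : ZMod 2) ≠ 1 := by decide
  have hsq : Multiplicative.ofAdd (1 : ZMod 2) * Multiplicative.ofAdd (1 : ZMod 2) = 1 := by decide
  have i1 : ∀ a, inversionAction k (Multiplicative.ofAdd (1 : ZMod 2)) a = a⁻¹ := by
    intro a; simp [inversionAction]
  have tr : ∀ (φ ψ : D ≃ₐc[k] D) (t : D), (φ.trans ψ) t = ψ (φ t) := fun _ _ _ => rfl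
  have lin : ∀ (φ : D ≃ₐc[k] D) (a : kˣ) (t : D), φ (a • t) = a • φ t := by
    intro φ a t
    exact map_smul φ (a : k) t
  have smul_inj : ∀ (a b : kˣ) (t : D), t ≠ 0 → a • t = b • t → a = b := by
    intro a b t ht h
    have h' : (a : k) • t = (b : k) • t := h
    exact Units.ext (smul_left_injective k ht h')
  refine ⟨fun u => if u.right = 1 then S u.left else σ.trans (S u.left), ⟨?_, ?_⟩, ?_⟩
  · rintro ⟨a, z⟩ ⟨b, z'⟩ h
    rcases h01 z with rfl | rfl <;> rcases h01 z' with rfl | rfl <;> simp [hn] at h ⊢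
    · have := congrArg (fun f : D ≃ₐc[k] D => f x) h
      simp only [S4] at this
      exact smul_inj _ _ _ x0 this
    · have := congrArg (fun f : D ≃ₐc[k] D => f g) h
      simp only [tr, S3, S1, σ3] at this
      exact absurd this gG
    · have := congrArg (fun f : D ≃ₐc[k] D => f g) h
      simp only [tr, S3, S1, σ3] at this
      exact absurd this.symm gG
    · have := congrArg (fun f : D ≃ₐc[k] D => f X) h
      simp only [tr, S4, σ2] at this
      exact smul_inj _ _ _ x0 this
  · intro φ
    obtain ⟨α, ⟨h1, h2, h3, h4⟩ | ⟨h1, h2, h3, h4⟩⟩ := d.classify_aut h2 φ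
    · refine ⟨⟨α, 1⟩, ?_⟩
      simp only [if_true]
      apply d.equiv_ext <;> simp only [*]
    · refine ⟨⟨α, Multiplicative.ofAdd 1⟩, ?_⟩
      simp only [hn, if_false]
      apply d.equiv_ext <;> simp only [*]
  · rintro ⟨a, z⟩ ⟨b, z'⟩
    rcases h01 z with rfl | rfl <;> rcases h01 z' with rfl | rfl <;>
      simp [hn, hsq, i1] <;> apply d.equiv_ext <;>
      simp only [tr, S1, S2, S3, S4, σ1, σ2, σ3, σ4, lin, smul_smul, mul_inv_rev, inv_inv, mul_comm]

end DDat

set_option maxHeartbeats 2000000 in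
theorem exists_DDat {k : Type*} [Field k] (h2 : (2 : k) ≠ 0)
    {H : Type*} [Ring H] [HopfAlgebra k H] {g x : H} (hs : IsSweedler k H g x)
    {D : Type*} [Ring D] [HopfAlgebra k D] (w : DrinfeldDoubleStructure k H D g x) :
    Nonempty (DDat k (w.i (w.os - w.gs)) (w.i (w.xs + w.gxs)) (w.j g) (w.j x)) := by
  obtain ⟨os1, osg, osx, osgx⟩ := And.intro w.os_one (And.intro w.os_g (And.intro w.os_x w.os_gx))
  obtain ⟨gs1, gsg, gsx, gsgx⟩ := And.intro w.gs_one (And.intro w.gs_g (And.intro w.gs_x w.gs_gx))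
  obtain ⟨xs1, xsg, xsx, xsgx⟩ := And.intro w.xs_one (And.intro w.xs_g (And.intro w.xs_x w.xs_gx))
  obtain ⟨gxs1, gxsg, gxsx, gxsgx⟩ :=
    And.intro w.gxs_one (And.intro w.gxs_g (And.intro w.gxs_x w.gxs_gx))
  let bH : Module.Basis (Fin 4) k H := Module.Basis.mk hs.li (by
    rw [← hs.span]
    apply Submodule.span_mono
    rintro y (rfl | rfl | rfl | rfl)
    exacts [⟨0, rfl⟩, ⟨1, rfl⟩, ⟨2, rfl⟩, ⟨3, rfl⟩])
  have hbH : ∀ q, bH q = ![(1 : H), g, x, g * x] q := fun q => by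
    simp [bH]
  have dext : ∀ F F' : Module.Dual k H, F 1 = F' 1 → F g = F' g → F x = F' x →
      F (g * x) = F' (g * x) → F = F' := by
    intro F F' a1 a2 a3 a4
    apply bH.ext
    intro q
    rw [hbH]
    fin_cases q
    exacts [a1, a2, a3, a4]
  have cgx : Coalgebra.comul (R := k) (g * x) = (g * x) ⊗ₜ[k] g + (1 : H) ⊗ₜ[k] (g * x) := by
    rw [Bialgebra.comul_mul, hs.comul_g, hs.comul_x]
    simp [mul_add, hs.g_sq]
  have egx : Coalgebra.counit (R := k) (g * x) = 0 := by
    rw [Bialgebra.counit_mul, hs.counit_x, mul_zero]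
  have v1 : ∀ F F' : Module.Dual k H, conv k F F' 1 = F 1 * F' 1 := by
    intro F F'; simp [conv, Algebra.TensorProduct.one_def]
  have vg : ∀ F F' : Module.Dual k H, conv k F F' g = F g * F' g := by
    intro F F'; simp [conv, hs.comul_g]
  have vx : ∀ F F' : Module.Dual k H, conv k F F' x = F x * F' 1 + F g * F' x := by
    intro F F'; simp [conv, hs.comul_x]
  have vgx : ∀ F F' : Module.Dual k H,
      conv k F F' (g * x) = F (g * x) * F' g + F 1 * F' (g * x) := by
    intro F F'; simp only [conv, LinearMap.comp_apply, cgx]; simp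
  have gg := hs.g_sq
  have xx := hs.x_sq
  have xg := hs.x_mul_g
  have ggx : g * (g * x) = x := by rw [← mul_assoc, gg, one_mul]
  have xgx : x * (g * x) = 0 := by rw [← mul_assoc, xg, neg_mul, mul_assoc, xx]; simp
  have one : w.i (w.os + w.gs) = 1 := by
    rw [← w.i_one]; congr 1
    apply dext <;> simp [os1, osg, osx, osgx, gs1, gsg, gsx, gsgx, xs1, xsg, xsx, xsgx, gxs1, gxsg, gxsx, gxsgx,
        v1, vg, vx, vgx, gg, xx, xg, ggx, xgx, egx, hs.counit_g, hs.counit_x]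
  have hone : Coalgebra.counit (R := k) = w.os + w.gs := by
    apply dext <;> simp [os1, osg, osx, osgx, gs1, gsg, gsx, gsgx, xs1, xsg, xsx, xsgx, gxs1, gxsg, gxsx, gxsgx,
        v1, vg, vx, vgx, gg, xx, xg, ggx, xgx, egx, hs.counit_g, hs.counit_x]
  have hGX : w.i (w.os - w.gs) * w.i (w.xs + w.gxs) = w.i (w.gxs - w.xs) := by
    rw [← w.i_mul]; congr 1
    apply dext <;> simp [os1, osg, osx, osgx, gs1, gsg, gsx, gsgx, xs1, xsg, xsx, xsgx, gxs1, gxsg, gxsx, gxsgx,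
        v1, vg, vx, vgx, gg, xx, xg, ggx, xgx]
  have hrel : DRel (w.i (w.os - w.gs)) (w.i (w.xs + w.gxs)) (w.j g) (w.j x) := by
    refine ⟨?_, ?_, ?_, ?_, ?_, ?_, ?_, ?_, ?_, ?_⟩
    · rw [← w.i_mul, ← one]; congr 1
      apply dext <;> simp [os1, osg, osx, osgx, gs1, gsg, gsx, gsgx, xs1, xsg, xsx, xsgx, gxs1, gxsg, gxsx, gxsgx,
        v1, vg, vx, vgx, gg, xx, xg, ggx, xgx]
    · rw [← w.i_mul, ← map_zero w.i]; congr 1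
      apply dext <;> simp [os1, osg, osx, osgx, gs1, gsg, gsx, gsgx, xs1, xsg, xsx, xsgx, gxs1, gxsg, gxsx, gxsgx,
        v1, vg, vx, vgx, gg, xx, xg, ggx, xgx]
    · rw [hGX, ← w.i_mul, ← map_neg]; congr 1
      apply dext <;> simp [os1, osg, osx, osgx, gs1, gsg, gsx, gsgx, xs1, xsg, xsx, xsgx, gxs1, gxsg, gxsx, gxsgx,
        v1, vg, vx, vgx, gg, xx, xg, ggx, xgx]
    · rw [← w.j_mul, gg, w.j_one]
    · rw [← w.j_mul, xx, map_zero]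
    · rw [← w.j_mul, ← w.j_mul, xg, map_neg]
    · rw [w.straight_g]; congr 2
      apply dext <;> simp [os1, osg, osx, osgx, gs1, gsg, gsx, gsgx, xs1, xsg, xsx, xsgx, gxs1, gxsg, gxsx, gxsgx,
        v1, vg, vx, vgx, gg, xx, xg, ggx, xgx, mul_assoc]
    · rw [w.straight_g, ← neg_mul, ← map_neg]; congr 2
      apply dext <;> simp [os1, osg, osx, osgx, gs1, gsg, gsx, gsgx, xs1, xsg, xsx, xsgx, gxs1, gxsg, gxsx, gxsgx,
        v1, vg, vx, vgx, gg, xx, xg, ggx, xgx, mul_assoc]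
    · rw [w.straight_x]
      have e1 : (w.os - w.gs) ∘ₗ LinearMap.mulRight k x = 0 := by
        apply dext <;> simp [os1, osg, osx, osgx, gs1, gsg, gsx, gsgx, xs1, xsg, xsx, xsgx, gxs1, gxsg, gxsx, gxsgx,
        v1, vg, vx, vgx, gg, xx, xg, ggx, xgx, mul_assoc]
      have e2 : (w.os - w.gs) ∘ₗ LinearMap.mulRight k g = -(w.os - w.gs) := by
        apply dext <;> simp [os1, osg, osx, osgx, gs1, gsg, gsx, gsgx, xs1, xsg, xsx, xsgx, gxs1, gxsg, gxsx, gxsgx,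
        v1, vg, vx, vgx, gg, xx, xg, ggx, xgx, mul_assoc]
      have e3 : (w.os - w.gs) ∘ₗ (LinearMap.mulRight k g ∘ₗ LinearMap.mulLeft k (g * x)) = 0 := by
        apply dext <;> simp [os1, osg, osx, osgx, gs1, gsg, gsx, gsgx, xs1, xsg, xsx, xsgx, gxs1, gxsg, gxsx, gxsgx,
        v1, vg, vx, vgx, gg, xx, xg, ggx, xgx, mul_assoc]
      rw [e1, e2, e3]
      simp only [map_zero, map_neg, zero_mul, neg_mul, zero_add, add_zero]
    · rw [w.straight_x]
      have e1 : (w.xs + w.gxs) ∘ₗ LinearMap.mulRight k x = w.os + w.gs := by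
        apply dext <;> simp [os1, osg, osx, osgx, gs1, gsg, gsx, gsgx, xs1, xsg, xsx, xsgx, gxs1, gxsg, gxsx, gxsgx,
        v1, vg, vx, vgx, gg, xx, xg, ggx, xgx, mul_assoc]
      have e2 : (w.xs + w.gxs) ∘ₗ LinearMap.mulRight k g = -(w.xs + w.gxs) := by
        apply dext <;> simp [os1, osg, osx, osgx, gs1, gsg, gsx, gsgx, xs1, xsg, xsx, xsgx, gxs1, gxsg, gxsx, gxsgx,
        v1, vg, vx, vgx, gg, xx, xg, ggx, xgx, mul_assoc]
      have e3 : (w.xs + w.gxs) ∘ₗ (LinearMap.mulRight k g ∘ₗ LinearMap.mulLeft k (g * x)) =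
          -(w.os - w.gs) := by
        apply dext <;> simp [os1, osg, osx, osgx, gs1, gsg, gsx, gsgx, xs1, xsg, xsx, xsgx, gxs1, gxsg, gxsx, gxsgx,
        v1, vg, vx, vgx, gg, xx, xg, ggx, xgx, mul_assoc]
      rw [e1, e2, e3, one, map_neg, map_neg, neg_mul, neg_mul]; abel
  let F : Fin 4 → Module.Dual k H := ![w.os + w.gs, w.os - w.gs, w.xs + w.gxs, w.gxs - w.xs]
  have hF : LinearIndependent k F := by
    rw [Fintype.linearIndependent_iff]
    intro c hc
    have z1 := congrArg (fun f : Module.Dual k H => f 1) hc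
    have z2 := congrArg (fun f : Module.Dual k H => f g) hc
    have z3 := congrArg (fun f : Module.Dual k H => f x) hc
    have z4 := congrArg (fun f : Module.Dual k H => f (g * x)) hc
    simp [F, Fin.sum_univ_four,
        os1, osg, osx, osgx, gs1, gsg, gsx, gsgx, xs1, xsg, xsx, xsgx, gxs1, gxsg, gxsx, gxsgx,
        v1, vg, vx, vgx, gg, xx, xg, ggx, xgx] at z1 z2 z3 z4
    have y0 : 2 * c 0 = 0 := by linear_combination z1 + z2
    have y1 : 2 * c 1 = 0 := by linear_combination z1 - z2
    have y2 : 2 * c 2 = 0 := by linear_combination z3 + z4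
    have y3 : 2 * c 3 = 0 := by linear_combination z4 - z3
    intro q
    fin_cases q
    exacts [(mul_eq_zero.1 y0).resolve_left h2, (mul_eq_zero.1 y1).resolve_left h2,
      (mul_eq_zero.1 y2).resolve_left h2, (mul_eq_zero.1 y3).resolve_left h2]
  have hfin : Module.Finite k H := Module.Finite.of_basis bH
  have hrank : Module.finrank k H = 4 := by
    rw [Module.finrank_eq_card_basis bH]; simp
  let bF : Module.Basis (Fin 4) k (Module.Dual k H) :=
    basisOfLinearIndependentOfCardEqFinrank hF (by
      rw [Subspace.dual_finrank_eq, hrank]; simp)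
  have hbF : ∀ p, bF p = F p := fun p => by simp [bF]
  have addi := map_add w.i
  have subi := map_sub w.i
  have ione : w.i w.os + w.i w.gs = 1 := by rw [← map_add, one]
  refine ⟨⟨hrel, ?_, ?_, w.comul_j_g, w.comul_j_x, ?_, ?_, ?_, ?_,
    (bF.tensorProduct bH).map (LinearEquiv.ofBijective _ w.factor), ?_⟩⟩
  · simp only [map_sub, w.comul_i_os, w.comul_i_gs, TensorProduct.sub_tmul, TensorProduct.tmul_sub]
    abel
  · simp only [map_sub, map_add, w.comul_i_xs, w.comul_i_gxs, ← ione, TensorProduct.sub_tmul,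
      TensorProduct.tmul_sub, TensorProduct.add_tmul, TensorProduct.tmul_add]
    abel
  · simp [w.counit_i,
        os1, osg, osx, osgx, gs1, gsg, gsx, gsgx, xs1, xsg, xsx, xsgx, gxs1, gxsg, gxsx, gxsgx,
        v1, vg, vx, vgx, gg, xx, xg, ggx, xgx]
  · simp [w.counit_i,
        os1, osg, osx, osgx, gs1, gsg, gsx, gsgx, xs1, xsg, xsx, xsgx, gxs1, gxsg, gxsx, gxsgx,
        v1, vg, vx, vgx, gg, xx, xg, ggx, xgx]
  · rw [w.counit_j, hs.counit_g]
  · rw [w.counit_j, hs.counit_x]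
  · intro p q
    rw [hGX, ← w.j_mul]
    simp only [Module.Basis.map_apply, Module.Basis.tensorProduct_apply, hbF, hbH,
      LinearEquiv.ofBijective_apply, LinearMap.comp_apply, TensorProduct.map_tmul,
      LinearMap.mul'_apply]
    fin_cases p <;> fin_cases q <;> simp [F, w.j_one, ione]

/-- The group of Hopf algebra automorphisms of the Drinfel'd double `D(H₄)` of Sweedler's
Hopf algebra over a field `k` of characteristic `≠ 2` is isomorphic to the semidirect
product `kˣ ⋊ ℤ₂`, where `ℤ₂` acts on `kˣ` by inversion: there is a bijection
`Γ : kˣ ⋊ ℤ₂ → Aut_Hopf(D(H₄))` with `Γ(uv) = Γ(u) ∘ Γ(v)`. -/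
theorem drinfeldDouble_sweedler_automorphism_group
    {k : Type*} [Field k] (hchar : (2 : k) ≠ 0)
    {H : Type*} [Ring H] [HopfAlgebra k H] {g x : H} (hs : IsSweedler k H g x)
    {D : Type*} [Ring D] [HopfAlgebra k D] (w : DrinfeldDoubleStructure k H D g x) :
    ∃ Γ : (kˣ ⋊[inversionAction k] Multiplicative (ZMod 2)) → (D ≃ₐc[k] D),
      Function.Bijective Γ ∧ ∀ u v, Γ (u * v) = (Γ v).trans (Γ u) := by
  obtain ⟨d⟩ := exists_DDat hchar hs w
  exact d.main hchar

end
end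

section
/- Let k be a field of characteristic ≠ 2. Both Aut_Hopf(H_{16,0}) and Aut_Hopf(H_4 ⊗ H_4) are isomorphic to the semidirect product (k^* × k^*) ⋊_g ℤ_2, where g : ℤ_2 → Aut(k^* × k^*) is the action g(1 + 2ℤ)(α, β) = (β, α) for all (α, β) ∈ k^* × k^*; in particular Aut_Hopf(H_{16,0}) ≅ Aut_Hopf(H_4 ⊗ H_4). -/
open TensorProduct

noncomputable section

universe u

/-- The common relations of `𝓗_{16,0}` (`s = -1`) and `H₄ ⊗ H₄` (`s = 1`). -/
structure HRel (k : Type*) [Field k] (C : Type*) [Ring C] [Algebra k C]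
    (s : k) (g x G X : C) : Prop where
  ss : s * s = 1
  gg : g * g = 1
  GG : G * G = 1
  xx : x * x = 0
  XX : X * X = 0
  xg : x * g = -(g * x)
  XG : X * G = -(G * X)
  gG : g * G = G * g
  gX : g * X = s • (X * g)
  xG : x * G = s • (G * x)
  xX : x * X = s • (X * x)

def hmon {C : Type*} [Ring C] (g x G X : C) (p : Fin 4 × Fin 4) : C :=
  ![(1 : C), G, X, G * X] p.1 * ![(1 : C), g, x, g * x] p.2

lemma assoc_aux {C : Type*} [Ring C] {a b c : C} (h : a * b = c) (z : C) :
    a * (b * z) = c * z := by rw [← mul_assoc, h]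

theorem adjoin_of_basis {k : Type*} [Field k] {C : Type*} [Ring C] [Algebra k C]
    {g x G X : C} (e : Module.Basis (Fin 4 × Fin 4) k C) (he : ∀ p, e p = hmon g x G X p) :
    Algebra.adjoin k {g, x, G, X} = ⊤ := by
  have hg : g ∈ Algebra.adjoin k {g, x, G, X} := Algebra.subset_adjoin (by simp)
  have hx : x ∈ Algebra.adjoin k {g, x, G, X} := Algebra.subset_adjoin (by simp)
  have hG : G ∈ Algebra.adjoin k {g, x, G, X} := Algebra.subset_adjoin (by simp)
  have hX : X ∈ Algebra.adjoin k {g, x, G, X} := Algebra.subset_adjoin (by simp)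
  have h1 : (1 : C) ∈ Algebra.adjoin k {g, x, G, X} := one_mem _
  rw [← Algebra.toSubmodule_eq_top, eq_top_iff, ← e.span_eq, Submodule.span_le]
  rintro _ ⟨⟨i, j⟩, rfl⟩
  rw [he]
  change _ ∈ Algebra.adjoin k {g, x, G, X}
  apply mul_mem
  · fin_cases i
    exacts [h1, hG, hX, mul_mem hG hX]
  · fin_cases j
    exacts [h1, hg, hx, mul_mem hg hx]

theorem hext {k : Type*} [Field k] {C : Type*} [Ring C] [Algebra k C]
    {D : Type*} [Semiring D] [Algebra k D]
    {g x G X : C} (e : Module.Basis (Fin 4 × Fin 4) k C) (he : ∀ p, e p = hmon g x G X p)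
    {φ ψ : C →ₐ[k] D} (h1 : φ g = ψ g) (h2 : φ x = ψ x) (h3 : φ G = ψ G) (h4 : φ X = ψ X) :
    φ = ψ := by
  apply AlgHom.ext_of_adjoin_eq_top (adjoin_of_basis e he)
  rintro y (rfl | rfl | rfl | rfl) <;> assumption

set_option maxHeartbeats 1000000 in
theorem hlift {k : Type*} [Field k] {C : Type*} [Ring C] [Algebra k C]
    {D : Type*} [Ring D] [Algebra k D] {s : k}
    {g x G X : C} (e : Module.Basis (Fin 4 × Fin 4) k C) (he : ∀ p, e p = hmon g x G X p)
    (h : HRel k C s g x G X) {g' x' G' X' : D} (h' : HRel k D s g' x' G' X') :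
    ∃ φ : C →ₐ[k] D, φ g = g' ∧ φ x = x' ∧ φ G = G' ∧ φ X = X' := by
  let f : C →ₗ[k] D := e.constr k (hmon g' x' G' X')
  have hf : ∀ i j, f (hmon g x G X (i, j)) = hmon g' x' G' X' (i, j) := by
    intro i j; rw [← he]; exact e.constr_basis k _ _
  have f00 : f 1 = 1 := by simpa [hmon] using hf 0 0
  have f01 : f g = g' := by simpa [hmon] using hf 0 1
  have f02 : f x = x' := by simpa [hmon] using hf 0 2
  have f03 : f (g * x) = g' * x' := by simpa [hmon] using hf 0 3
  have f10 : f G = G' := by simpa [hmon] using hf 1 0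
  have f11 : f (G * g) = G' * g' := by simpa [hmon] using hf 1 1
  have f12 : f (G * x) = G' * x' := by simpa [hmon] using hf 1 2
  have f13 : f (G * (g * x)) = G' * (g' * x') := by simpa [hmon] using hf 1 3
  have f20 : f X = X' := by simpa [hmon] using hf 2 0
  have f21 : f (X * g) = X' * g' := by simpa [hmon] using hf 2 1
  have f22 : f (X * x) = X' * x' := by simpa [hmon] using hf 2 2
  have f23 : f (X * (g * x)) = X' * (g' * x') := by simpa [hmon] using hf 2 3
  have f30 : f (G * X) = G' * X' := by simpa [hmon] using hf 3 0
  have f31 : f (G * (X * g)) = G' * (X' * g') := by simpa [hmon, mul_assoc] using hf 3 1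
  have f32 : f (G * (X * x)) = G' * (X' * x') := by simpa [hmon, mul_assoc] using hf 3 2
  have f33 : f (G * (X * (g * x))) = G' * (X' * (g' * x')) := by
    simpa [hmon, mul_assoc] using hf 3 3
  have key : ∀ y ∈ ({g, x, G, X} : Set C), ∀ z, f (y * z) = f y * f z := by
    intro y hy z
    have : f ∘ₗ LinearMap.mulLeft k y = LinearMap.mulLeft k (f y) ∘ₗ f := by
      apply e.ext
      rintro ⟨i, j⟩
      rw [he]
      rcases hy with rfl | rfl | rfl | rfl <;> fin_cases i <;> fin_cases j <;>
      simp [hmon, mul_assoc, h.gg, h.GG, h.xx, h.XX, h.xg, h.XG, h.gG, h.gX, h.xG, h.xX,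
        assoc_aux h.gg, assoc_aux h.GG, assoc_aux h.XX, assoc_aux h.xg,
        assoc_aux h.XG, assoc_aux h.gG, assoc_aux h.gX, assoc_aux h.xG, assoc_aux h.xX,
        h'.gg, h'.GG, h'.xx, h'.XX, h'.xg, h'.XG, h'.gG, h'.gX, h'.xG, h'.xX,
        assoc_aux h'.gg, assoc_aux h'.GG, assoc_aux h'.XX, assoc_aux h'.xg,
        assoc_aux h'.XG, assoc_aux h'.gG, assoc_aux h'.gX, assoc_aux h'.xG, assoc_aux h'.xX,
        f00, f01, f02, f03, f10, f11, f12, f13, f20, f21, f22, f23, f30, f31, f32, f33]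
    exact LinearMap.congr_fun this z
  have key2 : ∀ y : C, ∀ z, f (y * z) = f y * f z := by
    intro y
    have hy : y ∈ Algebra.adjoin k {g, x, G, X} := by
      rw [adjoin_of_basis e he]; trivial
    induction hy using Algebra.adjoin_induction with
    | mem y hy => exact key y hy
    | algebraMap r => intro z; simp [Algebra.algebraMap_eq_smul_one, f00]
    | add a b _ _ ha hb => intro z; simp [add_mul, ha, hb]
    | mul a b _ _ ha hb => intro z; rw [mul_assoc, ha, hb, ha, mul_assoc]
  exact ⟨AlgHom.ofLinearMap f f00 key2, f01, f02, f10, f20⟩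

/-- A bialgebra of the common shape of `𝓗_{16,0}` and `H₄ ⊗ H₄`. -/
structure HGen (k : Type*) [Field k] (E : Type*) [Ring E] [Bialgebra k E]
    (s : k) (g x G X : E) (e : Module.Basis (Fin 4 × Fin 4) k E) : Prop where
  rel : HRel k E s g x G X
  he : ∀ p, e p = hmon g x G X p
  dg : Coalgebra.comul (R := k) g = g ⊗ₜ[k] g
  dG : Coalgebra.comul (R := k) G = G ⊗ₜ[k] G
  dx : Coalgebra.comul (R := k) x = x ⊗ₜ[k] (1 : E) + g ⊗ₜ[k] x
  dX : Coalgebra.comul (R := k) X = X ⊗ₜ[k] (1 : E) + G ⊗ₜ[k] X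
  cg : Coalgebra.counit (R := k) g = 1
  cG : Coalgebra.counit (R := k) G = 1
  cx : Coalgebra.counit (R := k) x = 0
  cX : Coalgebra.counit (R := k) X = 0

def hgam (p : Fin 4 × Fin 4) : Fin 4 × Fin 4 := (![0, 1, 0, 1] p.1, ![0, 1, 0, 1] p.2)
def hdel (p : Fin 4 × Fin 4) : Fin 4 × Fin 4 := (![0, 1, 1, 0] p.1, ![0, 1, 1, 0] p.2)

section
variable {k : Type*} [Field k] {E : Type*} [Ring E] [Bialgebra k E]
    {s : k} {g x G X : E} {e : Module.Basis (Fin 4 × Fin 4) k E}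

theorem HRel.kill {C : Type*} [Ring C] [Algebra k C] {g x G X : C} (h : HRel k C s g x G X) :
    HRel k C s g 0 G 0 :=
  ⟨h.ss, h.gg, h.GG, by simp, by simp, by simp, by simp, h.gG, by simp, by simp, by simp⟩

theorem HRel.scale {C : Type*} [Ring C] [Algebra k C] {g x G X : C} (h : HRel k C s g x G X)
    (a b : k) : HRel k C s g (a • x) G (b • X) :=
  ⟨h.ss, h.gg, h.GG, by simp [h.xx], by simp [h.XX], by simp [h.xg], by simp [h.XG], h.gG,
    by simp [h.gX, smul_smul, mul_comm], by simp [h.xG, smul_smul, mul_comm],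
    by simp [h.xX, smul_smul, mul_comm, mul_left_comm]⟩

theorem HRel.swap {C : Type*} [Ring C] [Algebra k C] {g x G X : C} (h : HRel k C s g x G X) :
    HRel k C s G X g x :=
  ⟨h.ss, h.GG, h.gg, h.XX, h.xx, h.XG, h.xg, h.gG.symm,
    by simp [h.xG, smul_smul, h.ss], by simp [h.gX, smul_smul, h.ss],
    by simp [h.xX, smul_smul, h.ss]⟩

/-- The projection onto the group algebra. -/
theorem HGen.exists_pi (h : HGen k E s g x G X e) :
    ∃ π : E →ₐ[k] E, π g = g ∧ π x = 0 ∧ π G = G ∧ π X = 0 :=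
  hlift e h.he h.rel h.rel.kill

theorem pi_basis (h : HGen k E s g x G X e) {π : E →ₐ[k] E}
    (hp : π g = g ∧ π x = 0 ∧ π G = G ∧ π X = 0) (p) :
    π (e p) = if hgam p = p then e p else 0 := by
  obtain ⟨h1, h2, h3, h4⟩ := hp
  obtain ⟨i, j⟩ := p
  rw [h.he]
  fin_cases i <;> fin_cases j <;> simp [hmon, hgam, h1, h2, h3, h4]

theorem P_basis (h : HGen k E s g x G X e) {π : E →ₐ[k] E}
    (hp : π g = g ∧ π x = 0 ∧ π G = G ∧ π X = 0) (p) :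
    TensorProduct.map LinearMap.id π.toLinearMap (Coalgebra.comul (R := k) (e p))
      = e p ⊗ₜ[k] e (hgam p) := by
  obtain ⟨h1, h2, h3, h4⟩ := hp
  change (Algebra.TensorProduct.map (AlgHom.id k E) π) (Bialgebra.comulAlgHom k E (e p)) = _
  obtain ⟨i, j⟩ := p
  rw [h.he, h.he]
  fin_cases i <;> fin_cases j <;>
   simp [hmon, hgam, h1, h2, h3, h4, h.dg, h.dG, h.dx, h.dX, Algebra.TensorProduct.one_def]

theorem Q_basis (h : HGen k E s g x G X e) {π : E →ₐ[k] E}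
    (hp : π g = g ∧ π x = 0 ∧ π G = G ∧ π X = 0) (p) :
    TensorProduct.map π.toLinearMap LinearMap.id (Coalgebra.comul (R := k) (e p))
      = e (hdel p) ⊗ₜ[k] e p := by
  obtain ⟨h1, h2, h3, h4⟩ := hp
  change (Algebra.TensorProduct.map π (AlgHom.id k E)) (Bialgebra.comulAlgHom k E (e p)) = _
  obtain ⟨i, j⟩ := p
  rw [h.he, h.he]
  fin_cases i <;> fin_cases j <;>
   simp [hmon, hdel, h1, h2, h3, h4, h.dg, h.dG, h.dx, h.dX, Algebra.TensorProduct.one_def,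
    h.rel.gg, h.rel.GG]

theorem pi_coord (h : HGen k E s g x G X e) {π : E →ₐ[k] E}
    (hp : π g = g ∧ π x = 0 ∧ π G = G ∧ π X = 0) (p) (y : E) :
    e.coord p (π y) = if hgam p = p then e.coord p y else 0 := by
  have : e.coord p ∘ₗ π.toLinearMap = if hgam p = p then e.coord p else 0 := by
    apply e.ext
    intro r
    simp only [LinearMap.comp_apply, AlgHom.toLinearMap_apply, pi_basis h hp]
    split_ifs with h1 h2 h2 <;> simp [Finsupp.single_apply]
    · rintro rfl; contradiction
    · rintro rfl; contradiction
  have := LinearMap.congr_fun this y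
  split_ifs at * <;> simpa using this

theorem P_coord (h : HGen k E s g x G X e) {π : E →ₐ[k] E}
    (hp : π g = g ∧ π x = 0 ∧ π G = G ∧ π X = 0) (p q) (y : E) :
    TensorProduct.lid k k (TensorProduct.map (e.coord p) (e.coord q)
      (TensorProduct.map LinearMap.id π.toLinearMap (Coalgebra.comul (R := k) y)))
      = if hgam p = q then e.coord p y else 0 := by
  have : (TensorProduct.lid k k).toLinearMap ∘ₗ (TensorProduct.map (e.coord p) (e.coord q)) ∘ₗ
      (TensorProduct.map LinearMap.id π.toLinearMap) ∘ₗ (Coalgebra.comul (R := k) (A := E))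
      = if hgam p = q then e.coord p else 0 := by
    apply e.ext
    intro r
    simp only [LinearMap.comp_apply, P_basis h hp]
    by_cases hr : r = p
    · subst hr; split_ifs with h2 <;> simp [Finsupp.single_apply, h2]
    · split_ifs <;> simp [Finsupp.single_apply, hr]
  have := LinearMap.congr_fun this y
  split_ifs at * <;> simpa using this

theorem Q_coord (h : HGen k E s g x G X e) {π : E →ₐ[k] E}
    (hp : π g = g ∧ π x = 0 ∧ π G = G ∧ π X = 0) (p q) (y : E) :
    TensorProduct.lid k k (TensorProduct.map (e.coord p) (e.coord q)
      (TensorProduct.map π.toLinearMap LinearMap.id (Coalgebra.comul (R := k) y)))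
      = if hdel q = p then e.coord q y else 0 := by
  have : (TensorProduct.lid k k).toLinearMap ∘ₗ (TensorProduct.map (e.coord p) (e.coord q)) ∘ₗ
      (TensorProduct.map π.toLinearMap LinearMap.id) ∘ₗ (Coalgebra.comul (R := k) (A := E))
      = if hdel q = p then e.coord q else 0 := by
    apply e.ext
    intro r
    simp only [LinearMap.comp_apply, Q_basis h hp]
    by_cases hr : r = q
    · subst hr; split_ifs with h2 <;> simp [Finsupp.single_apply, h2]
    · split_ifs <;> simp [Finsupp.single_apply, hr]
  have := LinearMap.congr_fun this y
  split_ifs at * <;> simpa using this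

theorem grouplike_class (h : HGen k E s g x G X e) {y : E} (hy0 : y ≠ 0)
    (hy : Coalgebra.comul (R := k) y = y ⊗ₜ[k] y) : ∃ t, hgam t = t ∧ y = e t := by
  obtain ⟨π, hp⟩ := h.exists_pi
  have hP : ∀ p q, (if hgam p = q then e.coord p y else 0)
      = e.coord p y * (if hgam q = q then e.coord q y else 0) := by
    intro p q; rw [← P_coord h hp, ← pi_coord h hp, hy]; simp
  have hQ : ∀ p q, (if hdel q = p then e.coord q y else 0)
      = (if hgam p = p then e.coord p y else 0) * e.coord q y := by
    intro p q; rw [← Q_coord h hp, ← pi_coord h hp, hy]; simp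
  have hgg : ∀ p, hgam (hgam p) = hgam p := by decide
  have hgd : ∀ p, hgam (hdel p) = hdel p := by decide
  have hgd2 : ∀ p, hdel p = hgam p → hgam p = p := by decide
  have hc : ∀ p, e.coord p y ≠ 0 → e.coord (hgam p) y = 1 := by
    intro p h0
    have := hP p (hgam p)
    simp only [if_true, hgg] at this
    exact mul_left_cancel₀ h0 (by rw [← this, mul_one])
  have hd : ∀ p, e.coord p y ≠ 0 → hgam p = p := by
    intro p h0
    by_contra hne
    have h1 := hQ (hgam p) p
    rw [if_neg (fun hh => hne (hgd2 p hh)), if_pos (hgg p), hc p h0] at h1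
    simp at h1
    exact h0 (by simpa using h1.symm)
  have : ∃ t, e.coord t y ≠ 0 := by
    by_contra hh
    push Not at hh
    exact hy0 (e.ext_elem (by intro i; simpa using hh i))
  obtain ⟨t, ht⟩ := this
  have htt := hd t ht
  refine ⟨t, htt, ?_⟩
  apply e.ext_elem
  intro q
  have h1 : e.coord t y = 1 := by simpa [htt] using hc t ht
  by_cases hq : q = t
  · subst hq; simpa using h1
  · have h2 := hP t q
    rw [htt, if_neg (Ne.symm hq), h1, one_mul] at h2
    have h3 : e.coord q y = 0 := by
      by_contra h4
      rw [if_pos (hd q h4)] at h2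
      exact h4 h2.symm
    simpa [Finsupp.single_apply, Ne.symm hq] using h3

theorem skew_class (h : HGen k E s g x G X e) {y : E} {t} (ht : hgam t = t)
    (hy : Coalgebra.comul (R := k) y = y ⊗ₜ[k] 1 + e t ⊗ₜ[k] y) (q)
    (hq : e.coord q y ≠ 0) : q = 0 ∨ q = t ∨ (hgam q = 0 ∧ hdel q = t) := by
  obtain ⟨π, hp⟩ := h.exists_pi
  have h1 : (1 : E) = e 0 := by rw [h.he]; simp [hmon]
  have hP : ∀ p q, (if hgam p = q then e.coord p y else 0)
      = e.coord p y * (if q = 0 then 1 else 0) +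
        (if p = t then 1 else 0) * (if hgam q = q then e.coord q y else 0) := by
    intro p q; rw [← P_coord h hp, ← pi_coord h hp, hy, h1]
    have hpi : π (e 0) = e 0 := by rw [← h1, map_one]
    simp [Finsupp.single_apply, hpi, eq_comm]
  have hQ : ∀ p q, (if hdel q = p then e.coord q y else 0)
      = (if hgam p = p then e.coord p y else 0) * (if q = 0 then 1 else 0) +
        (if p = t then 1 else 0) * e.coord q y := by
    intro p q; rw [← Q_coord h hp, ← pi_coord h hp, hy, h1]
    have hpi : π (e t) = e t := by rw [pi_basis h hp, if_pos ht]
    simp [Finsupp.single_apply, hpi, eq_comm]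
  by_cases h0 : q = 0
  · exact Or.inl h0
  by_cases h2 : q = t
  · exact Or.inr (Or.inl h2)
  refine Or.inr (Or.inr ⟨?_, ?_⟩)
  · by_contra hne
    have := hP q (hgam q)
    simp only [if_true, if_neg hne, if_neg h2, mul_zero, zero_mul, add_zero] at this
    exact hq this
  · by_contra hne
    have := hQ t q
    simp only [if_neg hne, if_neg h0, if_true, mul_zero, one_mul, zero_add] at this
    exact hq this.symm

end

section
variable {k : Type*} [Field k] {E : Type*} [Ring E] [Bialgebra k E]
    {s : k} {g x G X : E} {e : Module.Basis (Fin 4 × Fin 4) k E}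

theorem two_cancel (hchar : (2 : k) ≠ 0) {z : E} (h : z = -z) : z = 0 := by
  have h1 : (2 : k) • z = 0 := by rw [two_smul]; nth_rewrite 1 [h]; simp
  exact (smul_eq_zero.1 h1).resolve_left hchar

theorem expand (y : E) (S : Finset (Fin 4 × Fin 4)) (hS : ∀ q, e.coord q y ≠ 0 → q ∈ S) :
    y = ∑ q ∈ S, e.coord q y • e q := by
  conv_lhs => rw [← e.sum_repr y]
  symm
  apply Finset.sum_subset (Finset.subset_univ S)
  intro q _ hq
  have : e.coord q y = 0 := by by_contra hh; exact hq (hS q hh)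
  rw [this, zero_smul]

theorem lin2 (hchar : (2 : k) ≠ 0) {y z w : E} (hz : z * z = 1) {a b c : k}
    (hy : y = a • 1 + b • z + c • w) (hw : w * z = -(z * w)) (hyz : y * z = -(z * y)) :
    y = c • w := by
  have h1 : (a • 1 + b • z) * z = 0 := by
    have h2 : (a • 1 + b • z) * z = z * (a • 1 + b • z) := by simp [mul_add, add_mul]
    apply two_cancel hchar
    nth_rewrite 2 [h2]
    rw [hy, add_mul, mul_add] at hyz
    have h3 : (c • w) * z = -(z * (c • w)) := by simp [hw]
    rw [h3, neg_add] at hyz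
    exact add_right_cancel hyz
  have h4 : (a • 1 + b • z) = 0 := by
    have : (a • 1 + b • z) * z * z = 0 := by rw [h1, zero_mul]
    rwa [mul_assoc, hz, mul_one] at this
  rw [hy, h4, zero_add]

theorem HGen.e00 (h : HGen k E s g x G X e) : e 0 = 1 := by rw [h.he]; simp [hmon]
theorem HGen.e01 (h : HGen k E s g x G X e) : e (0, 1) = g := by rw [h.he]; simp [hmon]
theorem HGen.e02 (h : HGen k E s g x G X e) : e (0, 2) = x := by rw [h.he]; simp [hmon]
theorem HGen.e10 (h : HGen k E s g x G X e) : e (1, 0) = G := by rw [h.he]; simp [hmon]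
theorem HGen.e20 (h : HGen k E s g x G X e) : e (2, 0) = X := by rw [h.he]; simp [hmon]
theorem HGen.e11 (h : HGen k E s g x G X e) : e (1, 1) = G * g := by rw [h.he]; simp [hmon]
theorem HGen.e22 (h : HGen k E s g x G X e) : e (2, 2) = X * x := by rw [h.he]; simp [hmon]

theorem pair_class (hchar : (2 : k) ≠ 0) (h : HGen k E s g x G X e) {z y : E}
    (hz0 : z ≠ 0) (hz1 : z ≠ 1) (hy0 : y ≠ 0)
    (hz : Coalgebra.comul (R := k) z = z ⊗ₜ[k] z)
    (hy : Coalgebra.comul (R := k) y = y ⊗ₜ[k] 1 + z ⊗ₜ[k] y) (hyz : y * z = -(z * y)) :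
    (z = g ∧ ∃ c : kˣ, y = (c : k) • x) ∨ (z = G ∧ ∃ c : kˣ, y = (c : k) • X) := by
  obtain ⟨t, ht, rfl⟩ := grouplike_class h hz0 hz
  have hsk := skew_class h ht hy
  have hcases : ∀ t, hgam t = t → t = 0 ∨ t = (0, 1) ∨ t = (1, 0) ∨ t = (1, 1) := by decide
  have unit : ∀ (w : E) (c : k), y = c • w → ∃ c : kˣ, y = (c : k) • w := by
    intro w c hc
    have : c ≠ 0 := by rintro rfl; exact hy0 (by simpa using hc)
    exact ⟨Units.mk0 c this, hc⟩
  rcases hcases t ht with rfl | rfl | rfl | rfl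
  · exact absurd h.e00 hz1
  · left
    refine ⟨h.e01, ?_⟩
    have hd : ∀ q : Fin 4 × Fin 4, (q = 0 ∨ q = (0, 1) ∨ (hgam q = 0 ∧ hdel q = (0, 1))) →
      q ∈ ({0, (0, 1), (0, 2)} : Finset (Fin 4 × Fin 4)) := by decide
    have hs := expand (e := e) y _ (fun q hq => hd q (hsk q hq))
    rw [Finset.sum_insert (by decide), Finset.sum_insert (by decide), Finset.sum_singleton,
      h.e00, h.e01, h.e02, ← add_assoc] at hs
    rw [h.e01] at hyz
    exact unit _ _ (lin2 hchar h.rel.gg hs h.rel.xg hyz)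
  · right
    refine ⟨h.e10, ?_⟩
    have hd : ∀ q : Fin 4 × Fin 4, (q = 0 ∨ q = (1, 0) ∨ (hgam q = 0 ∧ hdel q = (1, 0))) →
      q ∈ ({0, (1, 0), (2, 0)} : Finset (Fin 4 × Fin 4)) := by decide
    have hs := expand (e := e) y _ (fun q hq => hd q (hsk q hq))
    rw [Finset.sum_insert (by decide), Finset.sum_insert (by decide), Finset.sum_singleton,
      h.e00, h.e10, h.e20, ← add_assoc] at hs
    rw [h.e10] at hyz
    exact unit _ _ (lin2 hchar h.rel.GG hs h.rel.XG hyz)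
  · exfalso
    have hd : ∀ q : Fin 4 × Fin 4, (q = 0 ∨ q = (1, 1) ∨ (hgam q = 0 ∧ hdel q = (1, 1))) →
      q ∈ ({0, (1, 1), (2, 2)} : Finset (Fin 4 × Fin 4)) := by decide
    have hs := expand (e := e) y _ (fun q hq => hd q (hsk q hq))
    rw [Finset.sum_insert (by decide), Finset.sum_insert (by decide), Finset.sum_singleton,
      h.e00, h.e11, h.e22, ← add_assoc] at hs
    rw [h.e11] at hyz
    have r := h.rel
    have hzz : G * g * (G * g) = 1 := by
      rw [mul_assoc, assoc_aux r.gG, mul_assoc, assoc_aux r.GG, one_mul, r.gg]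
    have hcomm : X * x * (G * g) = G * g * (X * x) := by
      simp [mul_assoc, r.xg, r.XG, r.gX, r.xG, assoc_aux r.xg, assoc_aux r.XG, assoc_aux r.gX,
        assoc_aux r.xG]
    have h2 : y * (G * g) = G * g * y := by
      rw [hs]
      simp only [add_mul, mul_add, smul_mul_assoc, mul_smul_comm, hcomm, one_mul, mul_one]
    have h3 : y * (G * g) = 0 := two_cancel hchar (hyz.trans (by rw [h2]))
    apply hy0
    have : y * (G * g) * (G * g) = 0 := by rw [h3, zero_mul]
    rwa [mul_assoc, hzz, mul_one] at this

theorem g_ne_G (h : HGen k E s g x G X e) : g ≠ G := by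
  rw [← h.e01, ← h.e10]; intro hh; exact absurd (e.injective hh) (by decide)

theorem equiv_class (hchar : (2 : k) ≠ 0) (h : HGen k E s g x G X e) (ψ : E ≃ₐc[k] E) :
    ∃ a b : kˣ, (ψ g = g ∧ ψ x = (a : k) • x ∧ ψ G = G ∧ ψ X = (b : k) • X) ∨
      (ψ g = G ∧ ψ x = (b : k) • X ∧ ψ G = g ∧ ψ X = (a : k) • x) := by
  have hinj : Function.Injective ψ := ψ.injective
  have hne : ∀ z : E, z ≠ 0 → ψ z ≠ 0 := fun z hz hh => hz (hinj (by rw [hh, map_zero]))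
  have hne1 : ∀ z : E, z ≠ 1 → ψ z ≠ 1 := fun z hz hh => hz (hinj (by rw [hh, map_one]))
  have n1 : g ≠ 0 := by rw [← h.e01]; exact e.ne_zero _
  have n2 : x ≠ 0 := by rw [← h.e02]; exact e.ne_zero _
  have n3 : G ≠ 0 := by rw [← h.e10]; exact e.ne_zero _
  have n4 : X ≠ 0 := by rw [← h.e20]; exact e.ne_zero _
  have n5 : g ≠ 1 := by
    rw [← h.e01, ← h.e00]; intro hh; exact absurd (e.injective hh) (by decide)
  have n6 : G ≠ 1 := by
    rw [← h.e10, ← h.e00]; intro hh; exact absurd (e.injective hh) (by decide)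
  have hc : ∀ z, Coalgebra.comul (R := k) (ψ z)
      = TensorProduct.map (ψ : E →ₗ[k] E) (ψ : E →ₗ[k] E) (Coalgebra.comul z) :=
    fun z => (CoalgHomClass.map_comp_comul_apply ψ z).symm
  have c1 := pair_class hchar h (hne g n1) (hne1 g n5) (hne x n2) (by rw [hc, h.dg]; simp)
    (by rw [hc, h.dx]; simp) (by rw [← map_mul, h.rel.xg]; simp)
  have c2 := pair_class hchar h (hne G n3) (hne1 G n6) (hne X n4) (by rw [hc, h.dG]; simp)
    (by rw [hc, h.dX]; simp) (by rw [← map_mul, h.rel.XG]; simp)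
  have hgG := g_ne_G h
  rcases c1 with ⟨h1, a, ha⟩ | ⟨h1, a, ha⟩ <;> rcases c2 with ⟨h2, b, hb⟩ | ⟨h2, b, hb⟩
  · exact absurd (hinj (h1.trans h2.symm)) hgG
  · exact ⟨a, b, Or.inl ⟨h1, ha, h2, hb⟩⟩
  · exact ⟨b, a, Or.inr ⟨h1, ha, h2, hb⟩⟩
  · exact absurd (hinj (h1.trans h2.symm)) hgG

theorem equiv_ext (h : HGen k E s g x G X e) {ψ φ : E ≃ₐc[k] E} (h1 : ψ g = φ g)
    (h2 : ψ x = φ x) (h3 : ψ G = φ G) (h4 : ψ X = φ X) : ψ = φ := by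
  have : (ψ : E →ₐ[k] E) = (φ : E →ₐ[k] E) := hext e h.he h1 h2 h3 h4
  ext z
  exact AlgHom.congr_fun this z

/-- Existence of bialgebra endomorphisms. -/
theorem exists_hom (h : HGen k E s g x G X e) {g' x' G' X' : E} (h' : HRel k E s g' x' G' X')
    (dg : Coalgebra.comul (R := k) g' = g' ⊗ₜ[k] g')
    (dG : Coalgebra.comul (R := k) G' = G' ⊗ₜ[k] G')
    (dx : Coalgebra.comul (R := k) x' = x' ⊗ₜ[k] (1 : E) + g' ⊗ₜ[k] x')
    (dX : Coalgebra.comul (R := k) X' = X' ⊗ₜ[k] (1 : E) + G' ⊗ₜ[k] X')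
    (cg : Coalgebra.counit (R := k) g' = 1)
    (cG : Coalgebra.counit (R := k) G' = 1)
    (cx : Coalgebra.counit (R := k) x' = 0)
    (cX : Coalgebra.counit (R := k) X' = 0) :
    ∃ φ : E →ₐc[k] E, φ g = g' ∧ φ x = x' ∧ φ G = G' ∧ φ X = X' := by
  obtain ⟨f, f1, f2, f3, f4⟩ := hlift e h.he h.rel h'
  refine ⟨BialgHom.ofAlgHom f (hext e h.he ?_ ?_ ?_ ?_) (hext e h.he ?_ ?_ ?_ ?_), f1, f2, f3, f4⟩
  · simp [f1, h.cg, cg]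
  · simp [f2, h.cx, cx]
  · simp [f3, h.cG, cG]
  · simp [f4, h.cX, cX]
  · simp [f1, h.dg, dg]
  · simp [f1, f2, h.dx, dx]
  · simp [f3, h.dG, dG]
  · simp [f3, f4, h.dX, dX]

theorem hom_ext (h : HGen k E s g x G X e) {ψ φ : E →ₐc[k] E} (h1 : ψ g = φ g)
    (h2 : ψ x = φ x) (h3 : ψ G = φ G) (h4 : ψ X = φ X) : ψ = φ := by
  have : (ψ : E →ₐ[k] E) = (φ : E →ₐ[k] E) := hext e h.he h1 h2 h3 h4
  ext z
  exact AlgHom.congr_fun this z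

theorem exists_diag (h : HGen k E s g x G X e) (a b : kˣ) :
    ∃ φ : E ≃ₐc[k] E, φ g = g ∧ φ x = (a : k) • x ∧ φ G = G ∧ φ X = (b : k) • X := by
  have key : ∀ a b : kˣ, ∃ φ : E →ₐc[k] E,
      φ g = g ∧ φ x = (a : k) • x ∧ φ G = G ∧ φ X = (b : k) • X := fun a b =>
    exists_hom h (h.rel.scale (a : k) (b : k)) h.dg h.dG (by simp [h.dx, smul_tmul'])
      (by simp [h.dX, smul_tmul']) h.cg h.cG (by simp [h.cx]) (by simp [h.cX])
  obtain ⟨φ, p1, p2, p3, p4⟩ := key a b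
  obtain ⟨ψ, q1, q2, q3, q4⟩ := key a⁻¹ b⁻¹
  refine ⟨BialgEquiv.ofBialgHom φ ψ (hom_ext h ?_ ?_ ?_ ?_) (hom_ext h ?_ ?_ ?_ ?_),
    p1, p2, p3, p4⟩ <;> simp [p1, p2, p3, p4, q1, q2, q3, q4, smul_smul]

theorem exists_hswap (h : HGen k E s g x G X e) :
    ∃ φ : E ≃ₐc[k] E, φ g = G ∧ φ x = X ∧ φ G = g ∧ φ X = x := by
  obtain ⟨φ, p1, p2, p3, p4⟩ :=
    exists_hom h h.rel.swap h.dG h.dg h.dX h.dx h.cG h.cg h.cX h.cx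
  refine ⟨BialgEquiv.ofBialgHom φ φ (hom_ext h ?_ ?_ ?_ ?_) (hom_ext h ?_ ?_ ?_ ?_),
    p1, p2, p3, p4⟩ <;> simp [p1, p2, p3, p4]

theorem tr_apply (a b : E ≃ₐc[k] E) (z : E) : (a.trans b) z = b (a z) := rfl

set_option maxHeartbeats 1000000 in
theorem main_gen (hchar : (2 : k) ≠ 0) (h : HGen k E s g x G X e) :
    ∃ Γ : ((kˣ × kˣ) ⋊[swapAction k] Multiplicative (ZMod 2)) → (E ≃ₐc[k] E),
      Function.Bijective Γ ∧ ∀ u v, Γ (u * v) = (Γ v).trans (Γ u) := by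
  have hgG := g_ne_G h
  have nx : x ≠ 0 := by rw [← h.e02]; exact e.ne_zero _
  have nX : X ≠ 0 := by rw [← h.e20]; exact e.ne_zero _
  choose D D1 D2 D3 D4 using exists_diag h
  obtain ⟨S, S1, S2, S3, S4⟩ := exists_hswap h
  let Γ : ((kˣ × kˣ) ⋊[swapAction k] Multiplicative (ZMod 2)) → (E ≃ₐc[k] E) :=
    fun u => if Multiplicative.toAdd u.right = 0 then D u.left.1 u.left.2
      else S.trans (D u.left.1 u.left.2)
  have hz : ∀ z : ZMod 2, z = 0 ∨ z = 1 := by decide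
  have rep : ∀ u : ((kˣ × kˣ) ⋊[swapAction k] Multiplicative (ZMod 2)),
      ∃ a b, u = ⟨(a, b), 1⟩ ∨ u = ⟨(a, b), Multiplicative.ofAdd 1⟩ := by
    rintro ⟨⟨a, b⟩, c⟩
    refine ⟨a, b, ?_⟩
    rcases hz (Multiplicative.toAdd c) with hc | hc
    · left; congr 1
    · right; congr 1
  have Γ0 : ∀ a b, Γ ⟨(a, b), 1⟩ = D a b := fun a b => by simp [Γ]
  have Γ1 : ∀ a b, Γ ⟨(a, b), Multiplicative.ofAdd 1⟩ = S.trans (D a b) := fun a b => by simp [Γ]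
  have sx : ∀ a b : kˣ, (a : k) • x = (b : k) • x → a = b := fun a b hh =>
    Units.ext (smul_left_injective k nx hh)
  have sX : ∀ a b : kˣ, (a : k) • X = (b : k) • X → a = b := fun a b hh =>
    Units.ext (smul_left_injective k nX hh)
  refine ⟨Γ, ⟨?_, ?_⟩, ?_⟩
  · intro u v huv
    obtain ⟨a, b, rfl | rfl⟩ := rep u <;> obtain ⟨c, d, rfl | rfl⟩ := rep v <;>
      simp only [Γ0, Γ1] at huv
    · have e1 := sx a c (by rw [← D2 a b, huv, D2])
      have e2 := sX b d (by rw [← D4 a b, huv, D4])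
      rw [e1, e2]
    · exfalso; have := congr($huv g); simp only [tr_apply, D1, S1, D3] at this; exact hgG this
    · exfalso; have := congr($huv g); simp only [tr_apply, D1, S1, D3] at this; exact hgG this.symm
    · have e1 := sx a c (by have := congr($huv X); simpa only [tr_apply, S4, D2] using this)
      have e2 := sX b d (by have := congr($huv x); simpa only [tr_apply, S2, D4] using this)
      rw [e1, e2]
  · intro ψ
    obtain ⟨a, b, ⟨h1, h2, h3, h4⟩ | ⟨h1, h2, h3, h4⟩⟩ := equiv_class hchar h ψ
    · refine ⟨⟨(a, b), 1⟩, ?_⟩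
      rw [Γ0]
      apply equiv_ext h <;> simp only [tr_apply, D1, D2, D3, D4, S1, S2, S3, S4, h1, h2, h3, h4]
    · refine ⟨⟨(a, b), Multiplicative.ofAdd 1⟩, ?_⟩
      rw [Γ1]
      apply equiv_ext h <;> simp only [tr_apply, D1, D2, D3, D4, S1, S2, S3, S4, h1, h2, h3, h4]
  · intro u v
    have hs : ∀ c d : kˣ, swapAction k (Multiplicative.ofAdd 1) (c, d) = (d, c) := by
      intro c d; simp [swapAction]
    have h11 : (Multiplicative.ofAdd (1 : ZMod 2)) * Multiplicative.ofAdd 1 = 1 := rfl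
    obtain ⟨a, b, rfl | rfl⟩ := rep u <;> obtain ⟨c, d, rfl | rfl⟩ := rep v <;>
      simp only [SemidirectProduct.mul_def,
        hs, h11, map_one, MulAut.one_apply, Prod.mk_mul_mk, one_mul, mul_one] <;>
      simp only [Γ0, Γ1] <;>
      apply equiv_ext h <;>
      simp only [tr_apply, D1, D2, D3, D4, S1, S2, S3, S4, map_smul, smul_smul, mul_comm,
        Units.val_mul]

end

theorem HGen_of_H16 {k : Type*} [Field k] {E : Type*} [Ring E] [HopfAlgebra k E] {g x G X : E}
    (h : IsH16 k E g x G X 0) : ∃ e, HGen k E (-1) g x G X e := by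
  refine ⟨Module.Basis.mk h.li h.span.ge, ⟨by simp, h.g_sq, h.G_sq, h.x_sq, h.X_sq, ?_, ?_,
    h.gG_comm, ?_, ?_, ?_⟩, ?_, h.comul_g, h.comul_G, h.comul_x, h.comul_X, h.counit_g,
    h.counit_G, h.counit_x, h.counit_X⟩
  · simp [h.gx_eq]
  · simp [h.GX_eq]
  · simp [h.gX_anticomm]
  · simp [h.xG_anticomm]
  · have := h.xX_rel
    rw [zero_smul] at this
    simpa using eq_neg_of_add_eq_zero_left this
  · intro p; simp [hmon]

theorem sweedler_basis {k : Type*} [Field k] {A : Type*} [Ring A] [HopfAlgebra k A] {g x : A}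
    (h : IsSweedler k A g x) :
    ∃ b : Module.Basis (Fin 4) k A, ∀ i, b i = ![(1 : A), g, x, g * x] i := by
  refine ⟨Module.Basis.mk h.li ?_, fun i => by rw [Module.Basis.mk_apply]⟩
  rw [← h.span]
  apply Submodule.span_mono
  rintro y (rfl | rfl | rfl | rfl)
  exacts [⟨0, rfl⟩, ⟨1, rfl⟩, ⟨2, rfl⟩, ⟨3, rfl⟩]

theorem HGen_of_tensor {k : Type*} [Field k] {A : Type*} [Ring A] [HopfAlgebra k A] {gA xA : A}
    (hA : IsSweedler k A gA xA)
    {B : Type*} [Ring B] [HopfAlgebra k B] {gB xB : B} (hB : IsSweedler k B gB xB) :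
    ∃ e, HGen k (A ⊗[k] B) 1 (gA ⊗ₜ[k] 1) (xA ⊗ₜ[k] 1) (1 ⊗ₜ[k] gB) (1 ⊗ₜ[k] xB) e := by
  obtain ⟨a, ha⟩ := sweedler_basis hA
  obtain ⟨b, hb⟩ := sweedler_basis hB
  refine ⟨(a.tensorProduct b).reindex (Equiv.prodComm _ _), ⟨by simp, ?_, ?_, ?_, ?_, ?_, ?_,
    ?_, ?_, ?_, ?_⟩, ?_, ?_, ?_, ?_, ?_, ?_, ?_, ?_, ?_⟩
  · simp [hA.g_sq, Algebra.TensorProduct.one_def]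
  · simp [hB.g_sq, Algebra.TensorProduct.one_def]
  · simp [hA.x_sq]
  · simp [hB.x_sq]
  · simp [hA.x_mul_g, neg_tmul]
  · simp [hB.x_mul_g, tmul_neg]
  · simp
  · simp
  · simp
  · simp
  · rintro ⟨i, j⟩
    simp only [Module.Basis.reindex_apply, Equiv.prodComm_symm, Equiv.prodComm_apply,
      Prod.swap_prod_mk, Module.Basis.tensorProduct_apply, ha, hb]
    fin_cases i <;> fin_cases j <;> simp [hmon, Algebra.TensorProduct.one_def]
  · simp [TensorProduct.comul_tmul, hA.comul_g, Algebra.TensorProduct.one_def]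
  · simp [TensorProduct.comul_tmul, hB.comul_g, Algebra.TensorProduct.one_def]
  · simp [TensorProduct.comul_tmul, hA.comul_x, Algebra.TensorProduct.one_def, add_tmul]
  · simp [TensorProduct.comul_tmul, hB.comul_x, Algebra.TensorProduct.one_def, tmul_add]
  · simp [hA.counit_g]
  · simp [hB.counit_g]
  · simp [hA.counit_x]
  · simp [hB.counit_x]


/-- Over a field `k` of characteristic `≠ 2`, both the group of Hopf algebra
automorphisms of `𝓗_{16, 0}` and the group of Hopf algebra automorphisms of `H₄ ⊗ H₄`
are isomorphic to the semidirect product `(kˣ × kˣ) ⋊ ℤ₂`, where `ℤ₂` acts on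
`kˣ × kˣ` by swapping the factors; in particular
`Aut_Hopf(𝓗_{16, 0}) ≅ Aut_Hopf(H₄ ⊗ H₄)`. -/
theorem h16zero_tensor_automorphism_groups
    {k : Type u} [Field k] (hchar : (2 : k) ≠ 0)
    {E : Type u} [Ring E] [HopfAlgebra k E] {g₀ x₀ G₀ X₀ : E}
    (hE : IsH16 k E g₀ x₀ G₀ X₀ 0)
    {A : Type u} [Ring A] [HopfAlgebra k A] {gA xA : A} (hA : IsSweedler k A gA xA)
    {B : Type u} [Ring B] [HopfAlgebra k B] {gB xB : B} (hB : IsSweedler k B gB xB) :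
    (∃ Γ : ((kˣ × kˣ) ⋊[swapAction k] Multiplicative (ZMod 2)) → (E ≃ₐc[k] E),
      Function.Bijective Γ ∧ ∀ u v, Γ (u * v) = (Γ v).trans (Γ u)) ∧
    (∃ Γ' : ((kˣ × kˣ) ⋊[swapAction k] Multiplicative (ZMod 2)) →
        ((A ⊗[k] B) ≃ₐc[k] (A ⊗[k] B)),
      Function.Bijective Γ' ∧ ∀ u v, Γ' (u * v) = (Γ' v).trans (Γ' u)) ∧
    (∃ Θ : (E ≃ₐc[k] E) → ((A ⊗[k] B) ≃ₐc[k] (A ⊗[k] B)),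
      Function.Bijective Θ ∧ ∀ ψ φ, Θ (ψ.trans φ) = (Θ ψ).trans (Θ φ)) := by
  obtain ⟨e, he⟩ := HGen_of_H16 hE
  obtain ⟨f, hf⟩ := HGen_of_tensor hA hB
  obtain ⟨Γ, hΓ, mΓ⟩ := main_gen hchar he
  obtain ⟨Γ', hΓ', mΓ'⟩ := main_gen hchar hf
  refine ⟨⟨Γ, hΓ, mΓ⟩, ⟨Γ', hΓ', mΓ'⟩, ?_⟩
  let F := Equiv.ofBijective Γ hΓ
  refine ⟨fun ψ => Γ' (F.symm ψ), hΓ'.comp F.symm.bijective, ?_⟩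
  intro ψ φ
  obtain ⟨u, rfl⟩ := F.surjective ψ
  obtain ⟨v, rfl⟩ := F.surjective φ
  have : (F u).trans (F v) = F (v * u) := (mΓ v u).symm
  rw [this]
  simp only [Equiv.symm_apply_apply]
  exact mΓ' v u

end
end
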